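/- Let N ≥ 1 be an integer, p, q ∈ ℂ with 0 < |p| < 1, 0 < |q| < 1, and let t, t₁, …, t₆ ∈ ℂ with 0 < |t| < 1, 0 < |t_m| < 1 (m = 1, …, 6), and the balancing condition t^{2N−2}·∏_{m=1}^{6} t_m = pq. Then the elliptic Selberg integral evaluation holds: ((p;p)_∞^{N}(q;q)_∞^{N}/(2^N N!)) · Γ(t;p,q)^{N−1} · ∫_{𝕋^{N}} ∏_{1≤i<j≤N} [Γ(t z_i z_j;p,q) Γ(t z_i z_j^{−1};p,q) Γ(t z_i^{−1} z_j;p,q) Γ(t z_i^{−1} z_j^{−1};p,q)] / [Γ(z_i z_j;p,q) Γ(z_i z_j^{−1};p,q) Γ(z_i^{−1} z_j;p,q) Γ(z_i^{−1} z_j^{−1};p,q)] · ∏_{j=1}^{N} [∏_{m=1}^{6} Γ(t_m z_j;p,q) Γ(t_m z_j^{−1};p,q)] / [Γ(z_j²;p,q) Γ(z_j^{−2};p,q)] ∏_{j=1}^{N} dz_j/(2πi z_j) = ∏_{j=2}^{N} Γ(t^j;p,q) · ∏_{j=1}^{N} ∏_{1≤m<s≤6} Γ(t^{j−1} t_m t_s;p,q).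 -/

import Mathlib

open scoped BigOperators

/-- The infinite q-Pochhammer symbol `(x;p)_∞ = ∏_{j≥0} (1 - x p^j)`. -/
noncomputable def pochInf (x p : ℂ) : ℂ := ∏' j : ℕ, (1 - x * p ^ j)

/-- The elliptic gamma function `Γ(z;p,q)`. -/
noncomputable def ellGamma (z p q : ℂ) : ℂ :=
  ∏' jk : ℕ × ℕ, (1 - z⁻¹ * p ^ (jk.1 + 1) * q ^ (jk.2 + 1)) / (1 - z * p ^ jk.1 * q ^ jk.2)

/-- The contour integral `(2πi)⁻¹ ∮_{𝕋} f(z) dz/z` over the positively oriented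
unit circle. -/
noncomputable def circleInt (f : ℂ → ℂ) : ℂ :=
  (2 * (Real.pi : ℂ) * Complex.I)⁻¹ * ∮ z in C(0, 1), f z / z

/-- The iterated contour integral `∫_{𝕋^n} f ∏_{j=1}^n dz_j/(2πi z_j)`. -/
noncomputable def torusInt : (n : ℕ) → ((Fin n → ℂ) → ℂ) → ℂ
  | 0, f => f Fin.elim0
  | n + 1, f => circleInt fun z => torusInt n fun w => f (Fin.cons z w)

namespace ESI

open Filter Topology

section product
variable {ι : Type*} {c : ι → ℂ}

lemma mult_lin (hc : Summable fun i => ‖c i‖) (x : ℂ) : Multipliable fun i => (1 - x * c i) := by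
  have : Summable fun i => ‖-(x * c i)‖ := by
    simpa [norm_mul] using hc.mul_left ‖x‖
  simpa [sub_eq_add_neg] using multipliable_one_add_of_summable this

lemma tprod_lin_ne (hc : Summable fun i => ‖c i‖) (x : ℂ) (h : ∀ i, x * c i ≠ 1) :
    ∏' i, (1 - x * c i) ≠ 0 := by
  have : Summable fun i => ‖-(x * c i)‖ := by
    simpa [norm_mul] using hc.mul_left ‖x‖
  have := tprod_one_add_ne_zero_of_summable (f := fun i => -(x * c i)) (fun i h0 => h i ?_) this
  · simpa [sub_eq_add_neg] using this
  · linear_combination -h0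

lemma tprod_lin_eq_zero (x : ℂ) (i : ι) (h : x * c i = 1) :
    ∏' i, (1 - x * c i) = 0 :=
  (hasProd_zero_of_exists_eq_zero ⟨i, by simp [h]⟩).tprod_eq

lemma tprod_lin_diff (hc : Summable fun i => ‖c i‖) :
    Differentiable ℂ fun x : ℂ => ∏' i, (1 - x * c i) := by
  intro x0
  have hb : DifferentiableOn ℂ (fun x : ℂ => ∏' i, (1 + -(x * c i))) (Metric.ball 0 (‖x0‖ + 1)) := by
    have h1 := Summable.hasProdLocallyUniformlyOn_one_add (K := Metric.ball (0:ℂ) (‖x0‖ + 1))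
      (f := fun i x => -(x * c i)) Metric.isOpen_ball (hc.mul_left (‖x0‖ + 1))
      (Eventually.of_forall fun i x hx => by
        rw [norm_neg, norm_mul]
        have : ‖x‖ < ‖x0‖ + 1 := by simpa using hx
        gcongr) (fun i => by fun_prop)
    refine TendstoLocallyUniformlyOn.differentiableOn h1 (Eventually.of_forall fun s => ?_)
      Metric.isOpen_ball
    fun_prop
  have := hb.differentiableAt (Metric.isOpen_ball.mem_nhds (x := x0) (by simp))
  simpa [sub_eq_add_neg] using this

end product

variable {p q : ℂ}

lemma summ1 (hp : ‖p‖ < 1) : Summable fun j : ℕ => ‖p ^ j‖ := by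
  simpa [norm_pow] using summable_geometric_of_lt_one (norm_nonneg p) hp

lemma summ2 (hp : ‖p‖ < 1) (hq : ‖q‖ < 1) :
    Summable fun jk : ℕ × ℕ => ‖p ^ jk.1 * q ^ jk.2‖ := by
  have := (summ1 hp).mul_of_nonneg (summ1 hq) (fun _ => norm_nonneg _) (fun _ => norm_nonneg _)
  simpa [norm_mul] using this

/-- double product `∏ (1 - x p^j q^k)` -/
noncomputable def E2 (p q x : ℂ) : ℂ := ∏' jk : ℕ × ℕ, (1 - x * (p ^ jk.1 * q ^ jk.2))

lemma poch_diff (hp : ‖p‖ < 1) : Differentiable ℂ fun x => pochInf x p := tprod_lin_diff (summ1 hp)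

lemma E2_diff (hp : ‖p‖ < 1) (hq : ‖q‖ < 1) : Differentiable ℂ (E2 p q) :=
  tprod_lin_diff (summ2 hp hq)

lemma poch_ne (hp : ‖p‖ < 1) {x : ℂ} (h : ∀ j : ℕ, x * p ^ j ≠ 1) : pochInf x p ≠ 0 :=
  tprod_lin_ne (summ1 hp) x h

lemma poch_ne_of_lt (hp : ‖p‖ < 1) {x : ℂ} (hx : ‖x‖ < 1) : pochInf x p ≠ 0 := by
  refine poch_ne hp fun j h => ?_
  have : ‖x * p ^ j‖ < 1 := by
    rw [norm_mul, norm_pow]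
    exact mul_lt_one_of_nonneg_of_lt_one_left (norm_nonneg _) hx (pow_le_one₀ (norm_nonneg _) hp.le)
  rw [h] at this
  simp at this

lemma E2_ne (hp : ‖p‖ < 1) (hq : ‖q‖ < 1) {x : ℂ} (h : ∀ j k : ℕ, x * (p ^ j * q ^ k) ≠ 1) :
    E2 p q x ≠ 0 := tprod_lin_ne (summ2 hp hq) x (fun jk => h jk.1 jk.2)

lemma E2_ne_of_lt (hp : ‖p‖ < 1) (hq : ‖q‖ < 1) {x : ℂ} (hx : ‖x‖ < 1) : E2 p q x ≠ 0 := by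
  refine E2_ne hp hq fun j k h => ?_
  have : ‖x * (p ^ j * q ^ k)‖ < 1 := by
    rw [norm_mul, norm_mul, norm_pow, norm_pow]
    exact mul_lt_one_of_nonneg_of_lt_one_left (norm_nonneg _) hx
      (mul_le_one₀ (pow_le_one₀ (norm_nonneg _) hp.le) (by positivity)
        (pow_le_one₀ (norm_nonneg _) hq.le))
  rw [h] at this
  simp at this

lemma poch_succ (hp : ‖p‖ < 1) (x : ℂ) : pochInf x p = (1 - x) * pochInf (p * x) p := by
  have h := tprod_eq_zero_mul' (f := fun j : ℕ => 1 - x * p ^ j) (by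
    have := mult_lin (summ1 hp) (p * x)
    refine this.congr fun j => ?_
    ring)
  simp only [pochInf]
  rw [h]
  simp only [pow_zero, mul_one]
  congr 1
  refine tprod_congr fun j => ?_
  ring

lemma E2_comm (p q x : ℂ) : E2 p q x = E2 q p x := by
  unfold E2
  rw [← (Equiv.prodComm ℕ ℕ).tprod_eq]
  refine tprod_congr fun jk => ?_
  simp [mul_comm]

lemma E2_prod (hp : ‖p‖ < 1) (hq : ‖q‖ < 1) (x : ℂ) :
    HasProd (fun j : ℕ => pochInf (x * p ^ j) q) (E2 p q x) := by
  have h := (mult_lin (summ2 hp hq) x).hasProd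
  refine h.prod_fiberwise fun j => ?_
  have := (mult_lin (summ1 hq) (x * p ^ j)).hasProd
  refine (this.congr_fun ?_)
  intro k
  simp [mul_assoc]

lemma E2_p (hp : ‖p‖ < 1) (hq : ‖q‖ < 1) (x : ℂ) : E2 p q x = pochInf x q * E2 p q (p * x) := by
  have h1 := E2_prod hp hq (p * x)
  have h0 := E2_prod hp hq x
  have h := tprod_eq_zero_mul' (f := fun j : ℕ => pochInf (x * p ^ j) q) (by
    refine h1.multipliable.congr fun j => ?_
    congr 1; ring)
  rw [h0.tprod_eq] at h
  rw [h, ← h1.tprod_eq]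
  simp only [pow_zero, mul_one]
  congr 1
  refine tprod_congr fun j => ?_
  congr 1; ring

lemma E2_q (hp : ‖p‖ < 1) (hq : ‖q‖ < 1) (x : ℂ) : E2 p q x = pochInf x p * E2 p q (q * x) := by
  rw [E2_comm, E2_p hq hp, E2_comm]

lemma ellGamma_eq (hp : ‖p‖ < 1) (hq : ‖q‖ < 1) (z : ℂ) :
    ellGamma z p q = E2 p q (p * q / z) / E2 p q z := by
  by_cases h : ∀ j k : ℕ, z * (p ^ j * q ^ k) ≠ 1
  · have h0 := E2_ne hp hq h
    rw [E2, E2, ← Multipliable.tprod_div₀ (mult_lin (summ2 hp hq) _) (mult_lin (summ2 hp hq) _) h0]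
    unfold ellGamma
    refine tprod_congr fun jk => ?_
    congr 1 <;> ring
  · push Not at h
    obtain ⟨j, k, h⟩ := h
    have h1 : E2 p q z = 0 := tprod_lin_eq_zero (c := fun jk : ℕ × ℕ => p ^ jk.1 * q ^ jk.2) z (j, k) h
    rw [h1, div_zero]
    refine (hasProd_zero_of_exists_eq_zero ⟨(j, k), ?_⟩).tprod_eq
    have : (1 - z * p ^ j * q ^ k) = 0 := by linear_combination -h
    simp [this]

/-- theta function -/
noncomputable def th (p x : ℂ) : ℂ := pochInf x p * pochInf (p / x) p

lemma th_p_mul (hp : ‖p‖ < 1) (hp0 : p ≠ 0) {x : ℂ} (hx : x ≠ 0) : th p (p * x) = th p x⁻¹ := by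
  unfold th
  have : p / (p * x) = x⁻¹ := by field_simp
  rw [this]
  simp [mul_comm]

lemma th_inv (hp : ‖p‖ < 1) {x : ℂ} (hx : x ≠ 0) : th p x⁻¹ = -x⁻¹ * th p x := by
  unfold th
  rw [poch_succ hp x⁻¹, poch_succ hp x]
  have : p / x⁻¹ = p * x := by field_simp
  have h2 : p / x = p * x⁻¹ := by field_simp
  rw [this, h2]
  field_simp
  ring

lemma th_p (hp : ‖p‖ < 1) (hp0 : p ≠ 0) {x : ℂ} (hx : x ≠ 0) : th p (p * x) = -x⁻¹ * th p x := by
  rw [th_p_mul hp hp0 hx, th_inv hp hx]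

lemma th_one (hp : ‖p‖ < 1) : th p 1 = 0 := by
  simp [th, poch_succ hp 1]

lemma th_diff (hp : ‖p‖ < 1) {x : ℂ} (hx : x ≠ 0) : DifferentiableAt ℂ (th p) x := by
  unfold th
  refine DifferentiableAt.mul (poch_diff hp x) ?_
  exact DifferentiableAt.fun_comp' x (poch_diff hp (p / x)) (by fun_prop (disch := assumption))

lemma th_ne (hp : ‖p‖ < 1) {x : ℂ} (hx : x ≠ 0) (h : ∀ k : ℤ, x ≠ p ^ k) : th p x ≠ 0 := by
  refine mul_ne_zero (poch_ne hp fun j hj => ?_) (poch_ne hp fun j hj => ?_)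
  · apply h (-(j:ℤ))
    rw [zpow_neg, zpow_natCast]
    exact eq_inv_of_mul_eq_one_left hj
  · apply h (j + 1)
    by_cases hp0 : p = 0
    · simp [hp0] at hj
    · rw [zpow_add_one₀ hp0, zpow_natCast]
      field_simp at hj
      rw [← hj, mul_comm]

lemma th_ne_of (hp : ‖p‖ < 1) {x : ℂ} (h1 : ‖p‖ < ‖x‖) (h2 : ‖x‖ < 1) : th p x ≠ 0 := by
  refine mul_ne_zero (poch_ne_of_lt hp h2) (poch_ne_of_lt hp ?_)
  rw [norm_div]
  exact (div_lt_one (lt_of_le_of_lt (norm_nonneg _) h1)).2 h1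

lemma th_zero_iff (hp : ‖p‖ < 1) (hp0 : p ≠ 0) {x : ℂ} (hx : x ≠ 0) :
    th p x = 0 ↔ ∃ k : ℤ, x = p ^ k := by
  constructor
  · intro h
    by_contra h'
    push Not at h'
    exact th_ne hp hx h' h
  · have key : ∀ n : ℕ, th p (p ^ n) = 0 := by
      intro n
      induction n with
      | zero => simpa using th_one hp
      | succ n ih =>
        rw [pow_succ', th_p hp hp0 (pow_ne_zero _ hp0), ih, mul_zero]
    rintro ⟨k, rfl⟩
    obtain ⟨n, rfl | rfl⟩ := k.eq_nat_or_neg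
    · simpa using key n
    · rw [zpow_neg, zpow_natCast, th_inv hp (pow_ne_zero _ hp0), key, mul_zero]

lemma pq_lt {p q : ℂ} (hp : ‖p‖ < 1) (hq : ‖q‖ < 1) : ‖p * q‖ < 1 := by
  rw [norm_mul]; exact mul_lt_one_of_nonneg_of_lt_one_left (norm_nonneg _) hp hq.le

/-- `Γ(qz) = θ(z;p) Γ(z)` -/
lemma gam_q (hp : ‖p‖ < 1) (hq : ‖q‖ < 1) (hq0 : q ≠ 0) {z : ℂ} (hz : z ≠ 0)
    (h : E2 p q z ≠ 0) :
    ellGamma (q * z) p q = th p z * ellGamma z p q := by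
  rw [ellGamma_eq hp hq, ellGamma_eq hp hq]
  have h1 := E2_q hp hq z
  have h2 := E2_q hp hq (p / z)
  have e1 : p * q / (q * z) = p / z := by field_simp
  have e2 : q * (p / z) = p * q / z := by ring
  rw [e1, h2, e2]
  have h3 : E2 p q (q * z) ≠ 0 := fun h0 => h (by rw [h1, h0, mul_zero])
  have h4 : pochInf z p ≠ 0 := fun h0 => h (by rw [h1, h0, zero_mul])
  rw [h1]
  unfold th
  field_simp

lemma ellGamma_comm (hp : ‖p‖ < 1) (hq : ‖q‖ < 1) (z : ℂ) : ellGamma z p q = ellGamma z q p := by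
  rw [ellGamma_eq hp hq, ellGamma_eq hq hp, E2_comm, E2_comm p q, mul_comm]

lemma gam_refl (hp : ‖p‖ < 1) (hq : ‖q‖ < 1) (hp0 : p ≠ 0) (hq0 : q ≠ 0) {z w : ℂ}
    (hzw : z * w = p * q) (h1 : ‖z‖ < 1) (h2 : ‖w‖ < 1) :
    ellGamma z p q * ellGamma w p q = 1 := by
  have hz : z ≠ 0 := by rintro rfl; simp [hp0, hq0] at hzw; 
  have hw : w ≠ 0 := by rintro rfl; simp [hp0, hq0] at hzw
  rw [ellGamma_eq hp hq, ellGamma_eq hp hq]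
  have e1 : p * q / z = w := by rw [← hzw]; field_simp
  have e2 : p * q / w = z := by rw [← hzw]; field_simp
  rw [e1, e2]
  have := E2_ne_of_lt hp hq h1
  have := E2_ne_of_lt hp hq h2
  field_simp

lemma gam_ne (hp : ‖p‖ < 1) (hq : ‖q‖ < 1) {z : ℂ} (h1 : ‖z‖ < 1)
    (h2 : ‖p * q‖ < ‖z‖) : ellGamma z p q ≠ 0 := by
  rw [ellGamma_eq hp hq]
  refine div_ne_zero (E2_ne_of_lt hp hq ?_) (E2_ne_of_lt hp hq h1)
  rw [norm_div]
  exact (div_lt_one (lt_of_le_of_lt (norm_nonneg _) h2)).2 h2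

lemma gam_diff (hp : ‖p‖ < 1) (hq : ‖q‖ < 1) {z : ℂ} (h0 : z ≠ 0) (h1 : E2 p q z ≠ 0) :
    DifferentiableAt ℂ (fun z => ellGamma z p q) z := by
  have : (fun z => ellGamma z p q) = fun z => E2 p q (p * q / z) / E2 p q z :=
    funext fun z => ellGamma_eq hp hq z
  rw [this]
  refine DifferentiableAt.div ?_ (E2_diff hp hq z) h1
  exact DifferentiableAt.fun_comp' z (E2_diff hp hq _) (by fun_prop (disch := assumption))

lemma gam_diff_of_lt (hp : ‖p‖ < 1) (hq : ‖q‖ < 1) {z : ℂ} (h0 : z ≠ 0) (h1 : ‖z‖ < 1) :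
    DifferentiableAt ℂ (fun z => ellGamma z p q) z :=
  gam_diff hp hq h0 (E2_ne_of_lt hp hq h1)

lemma E2_pq (hp : ‖p‖ < 1) (hq : ‖q‖ < 1) (x : ℂ) :
    E2 p q x = (1 - x) * (pochInf (p * x) p * pochInf (q * x) q * E2 p q (p * q * x)) := by
  rw [E2_q hp hq, E2_p hp hq (q * x), poch_succ hp]
  ring_nf

/-- `1/(Γ(z)Γ(1/z)) = θ(z;p) θ(1/z;q)` on the unit circle, junk values included -/
lemma gam_inv (hp : ‖p‖ < 1) (hq : ‖q‖ < 1) {z : ℂ} (hz : ‖z‖ = 1) :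
    (ellGamma z p q * ellGamma z⁻¹ p q)⁻¹ = th p z * th q z⁻¹ := by
  have hz0 : z ≠ 0 := by rintro rfl; simp at hz
  rw [ellGamma_eq hp hq, ellGamma_eq hp hq]
  by_cases h1 : z = 1
  · subst h1
    simp [th_one hp, E2_pq hp hq 1]
  have hzi : ‖z⁻¹‖ = 1 := by simp [hz]
  have hpq := pq_lt hp hq
  have e0 : p * q / z⁻¹ = p * q * z := by field_simp
  have e0' : p * q / z = p * q * z⁻¹ := by field_simp
  have n1 : E2 p q (p * q * z) ≠ 0 := E2_ne_of_lt hp hq (by rw [norm_mul, hz, mul_one]; exact hpq)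
  have n2 : E2 p q (p * q * z⁻¹) ≠ 0 :=
    E2_ne_of_lt hp hq (by rw [norm_mul, hzi, mul_one]; exact hpq)
  rw [e0, e0', E2_pq hp hq z, E2_pq hp hq z⁻¹]
  unfold th
  have e1 : p / z = p * z⁻¹ := by field_simp
  have e2 : q / z⁻¹ = q * z := by field_simp
  rw [e1, e2, poch_succ hp z, poch_succ hq z⁻¹]
  generalize E2 p q (p * q * z) = A at *
  generalize E2 p q (p * q * z⁻¹) = B at *
  generalize pochInf (p * z) p = a1
  generalize pochInf (p * z⁻¹) p = a2
  generalize pochInf (q * z) q = a3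
  generalize pochInf (q * z⁻¹) q = a4
  rw [div_mul_div_comm, inv_div]
  rw [div_eq_iff (mul_ne_zero n2 n1)]
  ring

end ESI

namespace ESI

open Filter Topology Complex

/-- integral over a circle of radius r -/
noncomputable def Mi (F : ℂ → ℂ) (r : ℝ) : ℂ := ∫ θ in (0:ℝ)..2 * Real.pi, F (circleMap 0 r θ)

lemma Mi_const_mul (F : ℂ → ℂ) (r : ℝ) (a : ℂ) : Mi (fun x => a * F x) r = a * Mi F r := by
  unfold Mi
  rw [intervalIntegral.integral_const_mul]

lemma Mi_congr {F G : ℂ → ℂ} {r : ℝ} (hr : 0 ≤ r) (h : ∀ z, ‖z‖ = r → F z = G z) :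
    Mi F r = Mi G r := by
  unfold Mi
  refine intervalIntegral.integral_congr fun θ _ => h _ ?_
  rw [norm_circleMap_zero, abs_of_nonneg hr]

lemma Mi_mul (F : ℂ → ℂ) (r : ℝ) (a : ℂ) : Mi (fun x => F (a * x)) r = Mi F (‖a‖ * r) := by
  unfold Mi
  have h1 : ∀ θ : ℝ, a * circleMap 0 r θ = circleMap 0 (‖a‖ * r) (θ + arg a) := by
    intro θ
    have := norm_mul_exp_arg_mul_I a
    simp only [circleMap_zero]
    conv_lhs => rw [← this]
    push_cast
    rw [add_mul, Complex.exp_add]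
    ring
  simp_rw [h1]
  rw [intervalIntegral.integral_comp_add_right (fun θ => F (circleMap 0 (‖a‖ * r) θ))]
  have hper : Function.Periodic (fun θ => F (circleMap 0 (‖a‖ * r) θ)) (2 * Real.pi) :=
    (periodic_circleMap 0 (‖a‖ * r)).comp F
  have := hper.intervalIntegral_add_eq (arg a) 0
  rw [zero_add] at this
  rw [← this, zero_add, add_comm]

lemma Mi_inv (F : ℂ → ℂ) (r : ℝ) : Mi (fun x => F x⁻¹) r = Mi F r⁻¹ := by
  unfold Mi
  simp_rw [circleMap_zero_inv]
  rw [intervalIntegral.integral_comp_neg (fun θ => F (circleMap 0 r⁻¹ θ))]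
  have hper : Function.Periodic (fun θ => F (circleMap 0 r⁻¹ θ)) (2 * Real.pi) :=
    (periodic_circleMap 0 r⁻¹).comp F
  have := hper.intervalIntegral_add_eq (-(2 * Real.pi)) 0
  simp only [zero_add, neg_add_cancel] at this
  rw [neg_zero, this]

lemma Mi_circle (F : ℂ → ℂ) {r : ℝ} (hr : 0 < r) :
    (∮ z in C(0, r), (z - 0)⁻¹ • F z) = I * Mi F r := by
  unfold Mi circleIntegral
  rw [← intervalIntegral.integral_const_mul]
  refine intervalIntegral.integral_congr fun θ _ => ?_
  simp only [deriv_circleMap, smul_eq_mul, sub_zero]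
  have : circleMap 0 r θ ≠ 0 := circleMap_ne_center hr.ne'
  field_simp

lemma Mi_annulus {F : ℂ → ℂ} {r R : ℝ} (h0 : 0 < r) (hle : r ≤ R)
    (hd : ∀ z, r ≤ ‖z‖ → ‖z‖ ≤ R → DifferentiableAt ℂ F z) : Mi F r = Mi F R := by
  have h := circleIntegral_sub_center_inv_smul_eq_of_differentiable_on_annulus_off_countable
    (c := 0) h0 hle (f := F) Set.countable_empty
    (fun z hz => by
      have h1 : ‖z‖ ≤ R := by simpa using hz.1
      have h2 : r ≤ ‖z‖ := by simpa using hz.2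
      exact (hd z h2 h1).continuousAt.continuousWithinAt)
    (fun z hz => by
      have h1 : ‖z‖ < R := by simpa using hz.1.1
      have h2 : r < ‖z‖ := by simpa using hz.1.2
      exact hd z h2.le h1.le)
  rw [Mi_circle F h0, Mi_circle F (h0.trans_le hle)] at h
  exact (mul_left_cancel₀ I_ne_zero h).symm

lemma zero_of_Mi {f : ℂ → ℂ} (hf : ∀ z, ‖z‖ = 1 → ContinuousAt f z)
    (h : ∀ k : ℤ, Mi (fun z => z ^ k * f z) 1 = 0) : ∀ z, ‖z‖ = 1 → f z = 0 := by
  haveI : Fact (0 < 2 * Real.pi) := ⟨by positivity⟩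
  let F : C(AddCircle (2 * Real.pi), ℂ) := ⟨fun x => f (AddCircle.toCircle x), by
    rw [continuous_iff_continuousAt]
    intro x
    refine ContinuousAt.comp (f := fun x => ((AddCircle.toCircle x : Circle) : ℂ)) (hf _ (Circle.norm_coe _)) ?_
    exact (continuous_subtype_val.comp AddCircle.continuous_toCircle).continuousAt⟩
  have hc : fourierCoeff F = 0 := by
    funext n
    rw [fourierCoeff_eq_intervalIntegral F n 0]
    have := h (-n)
    unfold Mi at this
    rw [zero_add]
    have e : ∀ x : ℝ, (fourier (-n) (x : AddCircle (2 * Real.pi)) : ℂ) • F x =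
        (circleMap 0 1 x) ^ (-n) * f (circleMap 0 1 x) := by
      intro x
      have h1 : (circleMap 0 1 x) ^ (-n) = fourier (-n) (x : AddCircle (2 * Real.pi)) := by
        rw [circleMap_zero, fourier_coe_apply]
        rw [ofReal_one, one_mul, ← Complex.exp_int_mul]
        congr 1
        have : (Real.pi : ℂ) ≠ 0 := by exact_mod_cast Real.pi_ne_zero
        push_cast
        field_simp
      have h2 : circleMap 0 1 x = (AddCircle.toCircle (x : AddCircle (2 * Real.pi)) : Circle) := by
        rw [AddCircle.toCircle_apply_mk, Circle.coe_exp, circleMap_zero]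
        rw [ofReal_one, one_mul, div_self (by positivity), one_mul]
      rw [h1, smul_eq_mul]
      congr 1
      rw [h2]
      rfl
    simp_rw [e]
    rw [this]
    simp
  intro z hz
  have hs : Summable (fourierCoeff F) := by rw [hc]; exact summable_zero
  have h2 := hasSum_fourier_series_of_summable hs
  rw [hc] at h2
  simp only [Pi.zero_apply, zero_smul] at h2
  have h3 : F = 0 := h2.unique hasSum_zero
  obtain ⟨x, hx⟩ := (AddCircle.homeomorphCircle (T := 2 * Real.pi) (by positivity)).surjective
    ⟨z, by simpa [Submonoid.unitSphere] using hz⟩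
  have h4 := congrArg (fun G : C(AddCircle (2 * Real.pi), ℂ) => G x) h3
  simp only [AddCircle.homeomorphCircle_apply] at hx
  have h5 : f ((AddCircle.toCircle x : Circle) : ℂ) = 0 := h4
  rwa [hx] at h5

variable {p q : ℂ}

/-- degree-two theta functions -/
structure V2 (p C : ℂ) (f : ℂ → ℂ) : Prop where
  diff : ∀ x, x ≠ 0 → DifferentiableAt ℂ f x
  qp : ∀ x, x ≠ 0 → f (p * x) = C * (x ^ 2)⁻¹ * f x

lemma Mi_rec (hp : ‖p‖ < 1) (hp0 : p ≠ 0) {C : ℂ} {f : ℂ → ℂ} (hf : V2 p C f)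
    (k : ℤ) : Mi (fun z => z ^ k * f z) 1 = p ^ k * C * Mi (fun z => z ^ (k - 2) * f z) 1 := by
  have hpn : 0 < ‖p‖ := norm_pos_iff.2 hp0
  have h1 := Mi_annulus (F := fun z => z ^ k * f z) hpn hp.le (fun z h1 _ => by
    have hz : z ≠ 0 := norm_pos_iff.1 (hpn.trans_le h1)
    exact (differentiableAt_zpow.2 (Or.inl hz)).mul (hf.diff z hz))
  have h2 := Mi_mul (fun z => z ^ k * f z) 1 p
  rw [mul_one] at h2
  rw [← h1, ← h2, ← Mi_const_mul]
  refine Mi_congr zero_le_one fun z hz => ?_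
  have hz0 : z ≠ 0 := by rintro rfl; simp at hz
  rw [hf.qp z hz0, mul_zpow, zpow_sub₀ hz0]
  norm_cast
  ring

lemma V2.zero (hp : ‖p‖ < 1) (hp0 : p ≠ 0) {C : ℂ} (hC : C ≠ 0) {f : ℂ → ℂ} (hf : V2 p C f)
    (h0 : Mi (fun z => f z) 1 = 0) (h1 : Mi (fun z => z * f z) 1 = 0) :
    ∀ x, x ≠ 0 → f x = 0 := by
  have key : ∀ n : ℕ, (Mi (fun z => z ^ (n : ℤ) * f z) 1 = 0 ∧
      Mi (fun z => z ^ ((n : ℤ) + 1) * f z) 1 = 0) ∧ (Mi (fun z => z ^ (-(n : ℤ)) * f z) 1 = 0 ∧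
      Mi (fun z => z ^ (-(n : ℤ) + 1) * f z) 1 = 0) := by
    intro n
    induction n with
    | zero => simp [h0, h1]
    | succ n ih =>
      obtain ⟨⟨a, b⟩, c, d⟩ := ih
      refine ⟨⟨by simpa using b, ?_⟩, ?_, ?_⟩
      · rw [Mi_rec hp hp0 hf]
        have : ((n + 1 : ℕ) : ℤ) + 1 - 2 = n := by push_cast; ring
        rw [this, a, mul_zero]
      · have := Mi_rec hp hp0 hf (-(n : ℤ) + 1)
        rw [d] at this
        have e : -(n : ℤ) + 1 - 2 = -((n + 1 : ℕ) : ℤ) := by push_cast; ring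
        rw [e] at this
        have h3 : p ^ (-(n : ℤ) + 1) * C ≠ 0 := mul_ne_zero (zpow_ne_zero _ hp0) hC
        exact (mul_eq_zero.1 this.symm).resolve_left h3
      · have e : -((n + 1 : ℕ) : ℤ) + 1 = -(n : ℤ) := by push_cast; ring
        rw [e, c]
  have hz := zero_of_Mi (f := f) (fun z hz => (hf.diff z (by rintro rfl; simp at hz)).continuousAt)
    (fun k => by
      obtain ⟨n, rfl | rfl⟩ := k.eq_nat_or_neg
      · exact (key n).1.1
      · exact (key n).2.1)
  have han : AnalyticOnNhd ℂ f {x | x ≠ 0} := by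
    have : DifferentiableOn ℂ f {x | x ≠ 0} := fun x hx => (hf.diff x hx).differentiableWithinAt
    exact this.analyticOnNhd isOpen_ne
  have hconn : IsPreconnected {x : ℂ | x ≠ 0} :=
    (isConnected_compl_singleton_of_one_lt_rank (by simp) (0:ℂ)).isPreconnected
  have := han.eqOn_of_preconnected_of_frequently_eq (g := fun _ => 0) analyticOnNhd_const hconn
    (z₀ := 1) (by simp) (by
      have ht : Tendsto (fun n : ℕ => Complex.exp ((1 / ((n:ℝ) + 1) : ℝ) * I)) atTop (𝓝[≠] 1) := by
        refine tendsto_nhdsWithin_iff.2 ⟨?_, Eventually.of_forall fun n => ?_⟩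
        · have h1 : Tendsto (fun n : ℕ => (1 / ((n:ℝ) + 1) : ℝ)) atTop (𝓝 0) :=
            tendsto_one_div_add_atTop_nhds_zero_nat
          have h2 : Continuous fun x : ℝ => Complex.exp (x * I) := by fun_prop
          have := (h2.tendsto 0).comp h1
          simpa [Function.comp_def] using this
        · intro h
          have h' : Complex.exp ((1 / ((n:ℝ) + 1) : ℝ) * I) = 1 := h
          have him := congrArg Complex.im h'
          rw [Complex.exp_ofReal_mul_I_im] at him
          have hpos : 0 < Real.sin (1 / ((n:ℝ) + 1)) := by
            apply Real.sin_pos_of_pos_of_lt_pi (by positivity)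
            have : (1 / ((n:ℝ) + 1)) ≤ 1 := by
              rw [div_le_one (by positivity)]; linarith [(Nat.cast_nonneg n : (0:ℝ) ≤ n)]
            linarith [Real.pi_gt_three]
          rw [him] at hpos
          simp at hpos
      refine ht.frequently (Frequently.of_forall fun n => hz _ ?_)
      rw [Complex.norm_exp_ofReal_mul_I])
  exact fun x hx => this hx

lemma V2.lin {C : ℂ} {f g h : ℂ → ℂ} (hf : V2 p C f) (hg : V2 p C g) (hh : V2 p C h)
    (a b c : ℂ) : V2 p C (fun x => a * f x + b * g x + c * h x) := by
  refine ⟨fun x hx => ?_, fun x hx => ?_⟩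
  · exact (((hf.diff x hx).const_mul a).add ((hg.diff x hx).const_mul b)).add
      ((hh.diff x hx).const_mul c)
  · rw [hf.qp x hx, hg.qp x hx, hh.qp x hx]; ring

lemma V2.Mi_lin {C : ℂ} {f g h : ℂ → ℂ} (hf : V2 p C f) (hg : V2 p C g) (hh : V2 p C h)
    (a b c : ℂ) (k : ℕ) : Mi (fun z => z ^ k * (a * f z + b * g z + c * h z)) 1 =
      a * Mi (fun z => z ^ k * f z) 1 + b * Mi (fun z => z ^ k * g z) 1
        + c * Mi (fun z => z ^ k * h z) 1 := by
  have key : ∀ f, V2 p C f → IntervalIntegrable (fun θ => (circleMap 0 1 θ) ^ k * f (circleMap 0 1 θ))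
      MeasureTheory.volume 0 (2 * Real.pi) := by
    intro f hf
    apply Continuous.intervalIntegrable
    rw [continuous_iff_continuousAt]
    intro θ
    refine ContinuousAt.mul (((continuous_circleMap 0 1).pow k).continuousAt) ?_
    refine ContinuousAt.comp (f := circleMap 0 1) (hf.diff _ (circleMap_ne_center one_ne_zero)).continuousAt
      (continuous_circleMap 0 1).continuousAt
  unfold Mi
  rw [← intervalIntegral.integral_const_mul, ← intervalIntegral.integral_const_mul,
    ← intervalIntegral.integral_const_mul, ← intervalIntegral.integral_add ((key f hf).const_mul a)
    ((key g hg).const_mul b), ← intervalIntegral.integral_add (((key f hf).const_mul a).add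
    ((key g hg).const_mul b)) ((key h hh).const_mul c)]
  refine intervalIntegral.integral_congr fun θ _ => ?_
  ring

lemma V2.two (hp : ‖p‖ < 1) (hp0 : p ≠ 0) {C : ℂ} (hC : C ≠ 0) {f g h : ℂ → ℂ}
    (hf : V2 p C f) (hg : V2 p C g) (hh : V2 p C h) {u v : ℂ} (hu : u ≠ 0) (hv : v ≠ 0)
    (gu : g u = 0) (hv0 : h v = 0) (gv : g v ≠ 0) (hu0 : h u ≠ 0) (fu : f u = 0) (fv : f v = 0) :
    ∀ x, x ≠ 0 → f x = 0 := by
  have zz : ∀ a b c : ℂ, (∀ k : ℕ, k ≤ 1 → a * Mi (fun z => z ^ k * f z) 1 +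
      b * Mi (fun z => z ^ k * g z) 1 + c * Mi (fun z => z ^ k * h z) 1 = 0) →
      ∀ x, x ≠ 0 → a * f x + b * g x + c * h x = 0 := by
    intro a b c habc
    refine V2.zero hp hp0 hC (hf.lin hg hh a b c) ?_ ?_
    · have := hf.Mi_lin hg hh a b c 0
      rw [habc 0 (by norm_num)] at this
      simpa using this
    · have := hf.Mi_lin hg hh a b c 1
      rw [habc 1 (by norm_num)] at this
      simpa using this
  set f0 := Mi (fun z => z ^ 0 * f z) 1 with hf0
  set g0 := Mi (fun z => z ^ 0 * g z) 1 with hg0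
  set h0 := Mi (fun z => z ^ 0 * h z) 1 with hh0
  set f1 := Mi (fun z => z ^ 1 * f z) 1 with hf1
  set g1 := Mi (fun z => z ^ 1 * g z) 1 with hg1
  set h1 := Mi (fun z => z ^ 1 * h z) 1 with hh1
  have zz' : ∀ a b c : ℂ, a * f0 + b * g0 + c * h0 = 0 → a * f1 + b * g1 + c * h1 = 0 →
      ∀ x, x ≠ 0 → a * f x + b * g x + c * h x = 0 := by
    intro a b c e0 e1
    apply zz
    intro k hk
    interval_cases k
    · exact e0
    · exact e1
  by_cases hd : g0 * h1 - g1 * h0 = 0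
  · exfalso
    have A0 := zz' 0 h0 (-g0) (by ring) (by linear_combination -hd)
    have A1 := zz' 0 h1 (-g1) (by linear_combination hd) (by ring)
    have a1 := A0 u hu
    have a2 := A1 u hu
    simp only [gu, zero_mul, mul_zero, zero_add, mul_eq_zero, neg_eq_zero, hu0, or_false] at a1 a2
    have := zz' 0 1 0 (by rw [a1]; ring) (by rw [a2]; ring) v hv
    apply gv
    linear_combination this
  · have A := zz' (g0 * h1 - g1 * h0) (h0 * f1 - h1 * f0) (f0 * g1 - f1 * g0) (by ring) (by ring)
    have au := A u hu
    have av := A v hv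
    simp only [fu, gu, zero_mul, mul_zero, zero_add, mul_eq_zero, hu0, or_false] at au
    simp only [fv, hv0, zero_mul, mul_zero, zero_add, add_zero, mul_eq_zero, gv, or_false] at av
    intro x hx
    have ax := A x hx
    rw [au, av] at ax
    simp only [zero_mul, add_zero, mul_eq_zero] at ax
    exact ax.resolve_left hd

end ESI

namespace ESI

open Filter Topology Complex

variable {p q : ℂ}

lemma V2_th (hp : ‖p‖ < 1) (hp0 : p ≠ 0) {b b' : ℂ} (hb : b ≠ 0) (hb' : b' ≠ 0) :
    V2 p (b * b') (fun x => th p (x / b) * th p (x / b')) := by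
  refine ⟨fun x hx => ?_, fun x hx => ?_⟩
  · refine DifferentiableAt.mul ?_ ?_
    · exact DifferentiableAt.fun_comp' x (th_diff hp (div_ne_zero hx hb)) (by fun_prop)
    · exact DifferentiableAt.fun_comp' x (th_diff hp (div_ne_zero hx hb')) (by fun_prop)
  · rw [mul_div_assoc, mul_div_assoc, th_p hp hp0 (div_ne_zero hx hb),
      th_p hp hp0 (div_ne_zero hx hb')]
    field_simp

lemma frob_aux {ι : Type*} [DecidableEq ι] (hp : ‖p‖ < 1) (S : Finset ι)
    (a : ι → ℂ) (i : ι) (hi : i ∈ S) (ha : ∀ i ∈ S, a i ≠ 0)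
    (hd : ∀ i ∈ S, ∀ j ∈ S, i ≠ j → th p (a i / a j) ≠ 0) (g h : ι → ℂ)
    (h0 : ∑ k ∈ S.erase i, (g k * h k) / ∏ l ∈ (S.erase i).erase k, th p (a k / a l) = 0) :
    ∑ k ∈ S, (th p (a k / a i) * g k * h k) / ∏ l ∈ S.erase k, th p (a k / a l) = 0 := by
  rw [← Finset.add_sum_erase _ _ hi, div_self (ha i hi), th_one hp, zero_mul, zero_mul, zero_div,
    zero_add, ← h0]
  refine Finset.sum_congr rfl fun k hk => ?_
  have hki : k ≠ i := Finset.ne_of_mem_erase hk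
  have hik : i ∈ S.erase k := Finset.mem_erase.2 ⟨hki.symm, hi⟩
  rw [← Finset.mul_prod_erase _ _ hik, Finset.erase_right_comm]
  have := hd k (Finset.mem_of_mem_erase hk) i hi hki
  rw [mul_assoc, mul_div_mul_left _ _ this]

lemma frob {ι : Type*} [DecidableEq ι] (hp : ‖p‖ < 1) (hp0 : p ≠ 0) (a : ι → ℂ) : ∀ (n : ℕ)
    (S : Finset ι) (T : Multiset ℂ), S.card = n → Multiset.card T = n → (∀ i ∈ S, a i ≠ 0) →
    (∀ b ∈ T, b ≠ 0) → (∀ i ∈ S, ∀ j ∈ S, i ≠ j → th p (a i / a j) ≠ 0) →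
    ∏ i ∈ S, a i = T.prod →
    ∑ k ∈ S, (T.map fun b => th p (a k / b)).prod / ∏ l ∈ S.erase k, th p (a k / a l) = 0 := by
  intro n
  induction n with
  | zero =>
    intro S T hS _ _ _ _ _
    rw [Finset.card_eq_zero] at hS
    simp [hS]
  | succ n ih =>
    intro S T hS hT ha hb hd hprod
    match n, ih with
    | 0, _ =>
      obtain ⟨i, rfl⟩ := Finset.card_eq_one.1 hS
      obtain ⟨b, rfl⟩ := Multiset.card_eq_one.1 hT
      simp at hprod
      have : a i ≠ 0 := ha i (by simp)
      simp [← hprod, this, th_one hp]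
    | 1, _ =>
      obtain ⟨i, j, hij, rfl⟩ := Finset.card_eq_two.1 hS
      obtain ⟨b, b', rfl⟩ := Multiset.card_eq_two.1 hT
      have hai : a i ≠ 0 := ha i (by simp)
      have haj : a j ≠ 0 := ha j (by simp)
      have hb0 : b ≠ 0 := hb b (by simp)
      have hb0' : b' ≠ 0 := hb b' (by simp)
      have hd1 := hd i (by simp) j (by simp) hij
      rw [Finset.prod_pair hij] at hprod
      simp only [Multiset.insert_eq_cons, Multiset.prod_cons, Multiset.prod_singleton] at hprod
      rw [Finset.sum_pair hij]
      have e1 : ({i, j} : Finset ι).erase i = {j} := by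
        ext k; simp; grind
      have e2 : ({i, j} : Finset ι).erase j = {i} := by
        ext k; simp; grind
      rw [e1, e2]
      simp only [Multiset.insert_eq_cons, Multiset.map_cons, Multiset.map_singleton,
        Multiset.prod_cons, Multiset.prod_singleton, Finset.prod_singleton]
      have f1 : a j / b = (a i / b')⁻¹ := by field_simp; linear_combination hprod
      have f2 : a j / b' = (a i / b)⁻¹ := by field_simp; linear_combination hprod
      have f3 : a j / a i = (a i / a j)⁻¹ := by field_simp
      rw [f1, f2, f3, th_inv hp (div_ne_zero hai hb0), th_inv hp (div_ne_zero hai hb0'),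
        th_inv hp (div_ne_zero hai haj)]
      field_simp
      linear_combination (th p (a i / b)) * th p (a i / b') * hprod
    | n + 2, ih =>
      obtain ⟨b1, T1, rfl⟩ := Multiset.card_pos_iff_exists_mem.1 (by omega : 0 < Multiset.card T) |>.imp
        fun b hb => Multiset.exists_cons_of_mem hb
      rw [Multiset.card_cons] at hT
      obtain ⟨b2, T2, rfl⟩ := Multiset.card_pos_iff_exists_mem.1 (by omega : 0 < Multiset.card T1) |>.imp
        fun b hb => Multiset.exists_cons_of_mem hb
      rw [Multiset.card_cons] at hT
      have hb1 : b1 ≠ 0 := hb b1 (by simp)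
      have hb2 : b2 ≠ 0 := hb b2 (by simp)
      have hc : b1 * b2 ≠ 0 := mul_ne_zero hb1 hb2
      obtain ⟨i, hi, j, hj, hij, hne⟩ : ∃ i ∈ S, ∃ j ∈ S, i ≠ j ∧ th p (a i * a j / (b1 * b2)) ≠ 0 := by
        obtain ⟨i, hi, j, hj, k, hk, hij, hik, hjk⟩ := Finset.two_lt_card.1 (by omega : 2 < S.card)
        by_contra hcon
        push Not at hcon
        have h1 := hcon i hi j hj hij
        have h2 := hcon i hi k hk hik
        have hai := ha i hi
        have haj := ha j hj
        have hak := ha k hk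
        rw [th_zero_iff hp hp0 (by positivity)] at h1 h2
        obtain ⟨m1, h1⟩ := h1
        obtain ⟨m2, h2⟩ := h2
        refine hd j hj k hk hjk ((th_zero_iff hp hp0 (div_ne_zero haj hak)).2 ⟨m1 - m2, ?_⟩)
        rw [zpow_sub₀ hp0, ← h1, ← h2]
        field_simp
      have hai := ha i hi
      have haj := ha j hj
      set c := b1 * b2 with hcdef
      have step : ∀ i ∈ S, ∑ k ∈ S, (th p (a k / a i) * th p (a k / (c / a i)) *
          (T2.map fun b => th p (a k / b)).prod) / ∏ l ∈ S.erase k, th p (a k / a l) = 0 := by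
        intro i hi
        refine frob_aux hp S a i hi ha hd (fun k => th p (a k / (c / a i)))
          (fun k => (T2.map fun b => th p (a k / b)).prod) ?_
        have := ih (S.erase i) ((c / a i) ::ₘ T2) (by rw [Finset.card_erase_of_mem hi]; omega)
          (by rw [Multiset.card_cons]; omega) (fun k hk => ha k (Finset.mem_of_mem_erase hk))
          (by
            intro b hb'
            rcases Multiset.mem_cons.1 hb' with rfl | h
            · exact div_ne_zero hc (ha i hi)
            · exact hb b (by simp [h]))
          (fun k hk l hl => hd k (Finset.mem_of_mem_erase hk) l (Finset.mem_of_mem_erase hl))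
          (by
            rw [← Finset.mul_prod_erase _ _ hi] at hprod
            simp only [Multiset.prod_cons] at hprod ⊢
            have := ha i hi
            field_simp
            rw [mul_comm, hprod, hcdef]
            ring)
        simpa only [Multiset.map_cons, Multiset.prod_cons] using this
      have V : ∀ i ∈ S, V2 p c (fun x => th p (x / a i) * th p (x / (c / a i))) := by
        intro i hi
        have := V2_th hp hp0 (ha i hi) (div_ne_zero hc (ha i hi))
        rwa [mul_div_cancel₀ _ (ha i hi)] at this
      have Vb := V2_th hp hp0 hb1 hb2
      have gv : th p (a j / a i) * th p (a j / (c / a i)) ≠ 0 := by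
        refine mul_ne_zero (hd j hj i hi hij.symm) ?_
        have : a j / (c / a i) = a i * a j / c := by field_simp
        rwa [this]
      have hu0 : th p (a i / a j) * th p (a i / (c / a j)) ≠ 0 := by
        refine mul_ne_zero (hd i hi j hj hij) ?_
        have : a i / (c / a j) = a i * a j / c := by field_simp
        rwa [this]
      set α := th p (a j / b1) * th p (a j / b2) / (th p (a j / a i) * th p (a j / (c / a i))) with hα
      set β := th p (a i / b1) * th p (a i / b2) / (th p (a i / a j) * th p (a i / (c / a j))) with hβ
      have tw := V2.two hp hp0 hc (Vb.lin (V i hi) (V j hj) 1 (-α) (-β)) (V i hi) (V j hj) hai haj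
        (by simp [div_self hai, th_one hp]) (by simp [div_self haj, th_one hp]) gv hu0
        (by
          simp only [div_self hai, th_one hp, zero_mul, mul_zero, hβ]
          rw [neg_mul, div_mul_cancel₀ _ hu0]; ring)
        (by
          simp only [div_self haj, th_one hp, zero_mul, mul_zero, hα]
          rw [neg_mul, div_mul_cancel₀ _ gv]; ring)
      have expand : ∀ k ∈ S, (((b1 ::ₘ b2 ::ₘ T2).map fun b => th p (a k / b)).prod) /
          ∏ l ∈ S.erase k, th p (a k / a l) =
          α * ((th p (a k / a i) * th p (a k / (c / a i)) *
          (T2.map fun b => th p (a k / b)).prod) / ∏ l ∈ S.erase k, th p (a k / a l)) +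
          β * ((th p (a k / a j) * th p (a k / (c / a j)) *
          (T2.map fun b => th p (a k / b)).prod) / ∏ l ∈ S.erase k, th p (a k / a l)) := by
        intro k hk
        have := tw (a k) (ha k hk)
        simp only [Multiset.map_cons, Multiset.prod_cons]
        rw [← mul_assoc, show th p (a k / b1) * th p (a k / b2) =
          α * (th p (a k / a i) * th p (a k / (c / a i))) +
          β * (th p (a k / a j) * th p (a k / (c / a j))) by linear_combination this]
        ring
      rw [Finset.sum_congr rfl expand, Finset.sum_add_distrib, ← Finset.mul_sum, ← Finset.mul_sum,
        step i hi, step j hj]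
      simp

/-- version with one theta shifted -/
lemma frob' {ι κ : Type*} [DecidableEq ι] [DecidableEq κ] (hp : ‖p‖ < 1) (hp0 : p ≠ 0)
    (S : Finset ι) (R : Finset κ)
    (a : ι → ℂ) (t : κ → ℂ) (hcard : S.card = R.card) (ha : ∀ i ∈ S, a i ≠ 0)
    (ht : ∀ i ∈ R, t i ≠ 0) (hd : ∀ i ∈ S, ∀ j ∈ S, i ≠ j → th p (a i / a j) ≠ 0)
    (hprod : (∏ i ∈ S, a i) * ∏ m ∈ R, t m = p) :
    ∑ k ∈ S, a k * (∏ m ∈ R, th p (t m * a k)) / ∏ l ∈ S.erase k, th p (a k / a l) = 0 := by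
  rcases R.eq_empty_or_nonempty with rfl | ⟨m0, hm0⟩
  · rw [Finset.card_empty, Finset.card_eq_zero] at hcard
    simp [hcard]
  have ht0 := ht m0 hm0
  have h := frob hp hp0 a S.card S ((p / t m0) ::ₘ ((R.erase m0).val.map fun m => (t m)⁻¹)) rfl
    (by
      rw [Multiset.card_cons, Multiset.card_map, Finset.card_val, Finset.card_erase_of_mem hm0, hcard]
      have : 0 < R.card := Finset.card_pos.2 ⟨m0, hm0⟩
      omega)
    ha
    (by
      intro b hb
      rcases Multiset.mem_cons.1 hb with rfl | h
      · exact div_ne_zero hp0 ht0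
      · obtain ⟨m, hm, rfl⟩ := Multiset.mem_map.1 h
        exact inv_ne_zero (ht m (Finset.mem_of_mem_erase hm)))
    hd
    (by
      rw [Multiset.prod_cons]
      change _ = p / t m0 * ∏ m ∈ R.erase m0, (t m)⁻¹
      rw [← Finset.mul_prod_erase _ _ hm0] at hprod
      rw [Finset.prod_inv_distrib, ← hprod]
      have : ∏ m ∈ R.erase m0, t m ≠ 0 :=
        Finset.prod_ne_zero_iff.2 fun m hm => ht m (Finset.mem_of_mem_erase hm)
      field_simp)
  have e : ∀ k ∈ S, a k * (∏ m ∈ R, th p (t m * a k)) / ∏ l ∈ S.erase k, th p (a k / a l) =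
      -(p / t m0) * ((((p / t m0) ::ₘ ((R.erase m0).val.map fun m => (t m)⁻¹)).map
        fun b => th p (a k / b)).prod / ∏ l ∈ S.erase k, th p (a k / a l)) := by
    intro k hk
    rw [Multiset.map_cons, Multiset.prod_cons, Multiset.map_map]
    change _ = -(p / t m0) * (th p (a k / (p / t m0)) * (∏ m ∈ R.erase m0, th p (a k / (t m)⁻¹)) / _)
    rw [← Finset.mul_prod_erase _ _ hm0]
    have h1 := th_p hp hp0 (x := a k / (p / t m0)) (div_ne_zero (ha k hk) (div_ne_zero hp0 ht0))
    have h2 : p * (a k / (p / t m0)) = t m0 * a k := by field_simp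
    rw [h2] at h1
    rw [h1]
    have h3 : ∀ m ∈ R.erase m0, th p (a k / (t m)⁻¹) = th p (t m * a k) := by
      intro m _
      rw [div_inv_eq_mul, mul_comm]
    rw [Finset.prod_congr rfl h3]
    have := ha k hk
    field_simp
  rw [Finset.sum_congr rfl e, ← Finset.mul_sum, h, mul_zero]

end ESI

namespace ESI

open Filter Topology Complex MeasureTheory

noncomputable instance : MeasurableSpace Circle := borel Circle
instance : BorelSpace Circle := ⟨rfl⟩

/-- normalized Haar measure on the circle -/
noncomputable def μ : Measure Circle :=
  (ENNReal.ofReal (2 * Real.pi))⁻¹ • Measure.map Circle.exp (volume.restrict (Set.Ioc 0 (2 * Real.pi)))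

instance : IsProbabilityMeasure μ := by
  constructor
  unfold μ
  rw [Measure.smul_apply, Measure.map_apply Circle.exp.continuous.measurable MeasurableSet.univ]
  simp only [Set.preimage_univ, Measure.restrict_apply MeasurableSet.univ, Set.univ_inter,
    Real.volume_Ioc, sub_zero, smul_eq_mul]
  exact ENNReal.inv_mul_cancel (by simp [Real.pi_pos]) ENNReal.ofReal_ne_top

lemma integral_μ {f : Circle → ℂ} (hf : AEStronglyMeasurable f μ) :
    ∫ z, f z ∂μ = (2 * Real.pi : ℂ)⁻¹ * ∫ θ in (0:ℝ)..2 * Real.pi, f (Circle.exp θ) := by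
  have hf' : AEStronglyMeasurable f
      (Measure.map Circle.exp (volume.restrict (Set.Ioc 0 (2 * Real.pi)))) := by
    refine hf.mono_ac ?_
    unfold μ
    exact Measure.absolutelyContinuous_smul (ENNReal.inv_ne_zero.2 ENNReal.ofReal_ne_top)
  unfold μ
  rw [integral_smul_measure, integral_map Circle.exp.continuous.aemeasurable hf',
    intervalIntegral.integral_of_le (by positivity), ENNReal.toReal_inv,
    ENNReal.toReal_ofReal (by positivity), Complex.real_smul]
  push_cast
  rfl

lemma integral_μ_Mi {f : ℂ → ℂ} (hf : AEStronglyMeasurable (fun z : Circle => f z) μ) :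
    ∫ z : Circle, f z ∂μ = (2 * Real.pi : ℂ)⁻¹ * Mi f 1 := by
  rw [integral_μ hf]
  unfold Mi
  congr 1
  refine intervalIntegral.integral_congr fun θ _ => ?_
  simp [circleMap_zero, Circle.coe_exp]

lemma circleInt_eq {f : ℂ → ℂ} (hf : AEStronglyMeasurable (fun z : Circle => f z) μ) :
    circleInt f = ∫ z : Circle, f z ∂μ := by
  rw [integral_μ_Mi hf]
  unfold circleInt
  have := Mi_circle f one_pos
  simp only [sub_zero, smul_eq_mul] at this
  simp_rw [div_eq_inv_mul]
  rw [this]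
  have : (Real.pi : ℂ) ≠ 0 := by exact_mod_cast Real.pi_ne_zero
  have := I_ne_zero
  field_simp

lemma integrable_cont {X : Type*} [TopologicalSpace X] [CompactSpace X] [MeasurableSpace X]
    [BorelSpace X] {ν : Measure X} [IsFiniteMeasure ν] {f : X → ℂ} (hf : Continuous f) :
    Integrable f ν := hf.integrable_of_hasCompactSupport (HasCompactSupport.of_compactSpace f)

/-- the torus -/
abbrev Tor (n : ℕ) := Fin n → Circle

/-- measure on the torus -/
noncomputable abbrev ν (n : ℕ) : Measure (Tor n) := Measure.pi fun _ => μ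

lemma integral_insertNth {n : ℕ} (i : Fin (n + 1)) {F : Tor (n + 1) → ℂ} (hF : Continuous F) :
    ∫ z, F z ∂(ν (n + 1)) = ∫ w, ∫ x, F (i.insertNth x w) ∂μ ∂(ν n) := by
  have h := measurePreserving_piFinSuccAbove (fun _ : Fin (n + 1) => μ) i
  have h2 := h.symm
  rw [← h2.integral_comp (MeasurableEquiv.measurableEmbedding _)]
  have hc : Continuous fun y : Circle × Tor n => F (i.insertNth y.1 y.2) := by
    refine hF.comp ?_
    exact Continuous.finInsertNth i continuous_fst continuous_snd
  exact integral_prod_symm (fun y : Circle × Tor n => F (i.insertNth y.1 y.2)) (integrable_cont hc)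

lemma integral_zero_coord {n : ℕ} (i : Fin (n + 1)) {F : Tor (n + 1) → ℂ} (hF : Continuous F)
    (h : ∀ w, ∫ x, F (i.insertNth x w) ∂μ = 0) : ∫ z, F z ∂(ν (n + 1)) = 0 := by
  rw [integral_insertNth i hF]
  simp [h]

lemma torusInt_eq (n : ℕ) : ∀ f : (Fin n → ℂ) → ℂ,
    Continuous (fun z : Tor n => f (fun i => (z i : ℂ))) →
    torusInt n f = ∫ z : Tor n, f (fun i => (z i : ℂ)) ∂(ν n) := by
  induction n with
  | zero =>
    intro f hf
    have : ∀ z : Tor 0, f (fun i => (z i : ℂ)) = f Fin.elim0 := by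
      intro z
      congr 1
      exact Subsingleton.elim _ _
    simp only [this]
    simp [torusInt]
  | succ n ih =>
    intro f hf
    unfold torusInt
    have hc : Continuous fun y : Circle × Tor n => f (Fin.cons (y.1 : ℂ) fun i => (y.2 i : ℂ)) := by
      have h1 : Continuous fun y : Circle × Tor n => ((Fin.cons y.1 y.2 : Tor (n + 1))) := by
        exact Continuous.finCons continuous_fst continuous_snd
      have := hf.comp h1
      refine this.congr fun y => ?_
      simp only [Function.comp]
      congr 1
      funext i
      refine Fin.cases ?_ (fun j => ?_) i <;> simp
    have e1 : ∀ z : Circle, torusInt n (fun w => f (Fin.cons (z : ℂ) w)) =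
        ∫ w : Tor n, f (Fin.cons (z : ℂ) fun i => (w i : ℂ)) ∂(ν n) := by
      intro z
      rw [ih (fun w => f (Fin.cons (z : ℂ) w))]
      exact hc.comp (Continuous.prodMk_right z)
    have hintg := integrable_cont (ν := μ.prod (ν n)) hc
    have hm : AEStronglyMeasurable (fun z : Circle => torusInt n fun w => f (Fin.cons (z : ℂ) w)) μ := by
      simp_rw [e1]
      exact hintg.integral_prod_left.aestronglyMeasurable
    rw [circleInt_eq hm]
    simp_rw [e1]
    rw [← integral_prod _ hintg]
    have h2 := (measurePreserving_piFinSuccAbove (fun _ : Fin (n + 1) => μ) 0).symm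
    rw [← h2.integral_comp (MeasurableEquiv.measurableEmbedding _)]
    refine integral_congr_ae (Eventually.of_forall fun y => ?_)
    simp only []
    congr 1
    funext i
    refine Fin.cases ?_ (fun j => ?_) i
    · simp [MeasurableEquiv.piFinSuccAbove, MeasurableEquiv.symm]
    · simp [MeasurableEquiv.piFinSuccAbove, MeasurableEquiv.symm]

/-- holomorphic dependence of an integral on a parameter -/
lemma diff_integral {X : Type*} [TopologicalSpace X] [CompactSpace X] [MeasurableSpace X]
    [BorelSpace X] {ν : Measure X} [IsFiniteMeasure ν] {U : Set ℂ} (hU : IsOpen U)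
    {F : ℂ → X → ℂ} (hF : ∀ z ∈ U, ∀ x, ContinuousAt (fun y : ℂ × X => F y.1 y.2) (z, x))
    (hd : ∀ z ∈ U, ∀ x, DifferentiableAt ℂ (fun z => F z x) z) :
    DifferentiableOn ℂ (fun z => ∫ x, F z x ∂ν) U := by
  intro z0 hz0
  refine DifferentiableAt.differentiableWithinAt ?_
  obtain ⟨ε, hε, hball⟩ := Metric.isOpen_iff.1 hU z0 hz0
  have hsub : Metric.closedBall z0 (ε / 2) ⊆ U :=
    (Metric.closedBall_subset_ball (by linarith)).trans hball
  obtain ⟨C, hC⟩ : ∃ C, ∀ y ∈ Metric.closedBall z0 (ε / 2) ×ˢ (Set.univ : Set X),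
      ‖F y.1 y.2‖ ≤ C := by
    refine ((isCompact_closedBall z0 (ε / 2)).prod isCompact_univ).exists_bound_of_continuousOn ?_
    intro y hy
    exact (hF y.1 (hsub hy.1) y.2).continuousWithinAt
  have hcx : ∀ z ∈ U, Continuous (F z) := by
    intro z hz
    rw [continuous_iff_continuousAt]
    intro x
    exact ContinuousAt.comp (f := fun x => (z, x)) (hF z hz x) (Continuous.prodMk_right z).continuousAt
  have hder : ∀ x, ∀ z ∈ Metric.ball z0 (ε / 4), ‖deriv (fun z => F z x) z‖ ≤ C / (ε / 4) := by
    intro x z hz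
    have hsub2 : Metric.closedBall z (ε / 4) ⊆ Metric.closedBall z0 (ε / 2) := by
      intro w hw
      rw [Metric.mem_closedBall] at hw ⊢
      rw [Metric.mem_ball] at hz
      linarith [dist_triangle w z z0]
    refine norm_deriv_le_of_forall_mem_sphere_norm_le (by linarith) ?_ ?_
    · refine DifferentiableOn.diffContOnCl_ball (U := U) ?_ (hsub2.trans hsub)
      exact fun w hw => (hd w hw x).differentiableWithinAt
    · intro w hw
      exact hC (w, x) ⟨hsub2 (Metric.sphere_subset_closedBall hw), trivial⟩
  have hbU : ∀ z ∈ Metric.ball z0 (ε / 4), z ∈ U := fun z hz =>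
    hball (Metric.ball_subset_ball (by linarith) hz)
  have := hasDerivAt_integral_of_dominated_loc_of_deriv_le (μ := ν) (F := F)
    (F' := fun z x => deriv (fun z => F z x) z) (x₀ := z0) (s := Metric.ball z0 (ε / 4))
    (bound := fun _ => C / (ε / 4))
    (Metric.ball_mem_nhds _ (by linarith))
    (by
      filter_upwards [hU.mem_nhds hz0] with z hz
      exact (integrable_cont (hcx z hz)).aestronglyMeasurable)
    (integrable_cont (hcx z0 hz0))
    (by
      have ht : Tendsto (fun n : ℕ => (((ε / 4 / 2) / ((n:ℝ) + 1) : ℝ) : ℂ)) atTop (𝓝[≠] 0) := by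
        refine tendsto_nhdsWithin_iff.2 ⟨?_, Eventually.of_forall fun n => ?_⟩
        · have h1 : Tendsto (fun n : ℕ => ((ε / 4 / 2) / ((n:ℝ) + 1) : ℝ)) atTop (𝓝 0) :=
            tendsto_const_div_atTop_nhds_zero_nat (ε / 4 / 2) |>.comp (tendsto_add_atTop_nat 1)
              |>.congr (fun n => by simp)
          have := (Complex.continuous_ofReal.tendsto 0).comp h1
          simpa [Function.comp_def] using this
        · have : (ε / 4 / 2) / ((n:ℝ) + 1) ≠ 0 := by positivity
          simpa only [Set.mem_compl_iff, Set.mem_singleton_iff, ofReal_eq_zero] using this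
      refine aestronglyMeasurable_of_tendsto_ae atTop (f := fun (n : ℕ) x =>
        (((ε / 4 / 2) / ((n:ℝ) + 1) : ℝ) : ℂ)⁻¹ • (F (z0 + (((ε / 4 / 2) / ((n:ℝ) + 1) : ℝ) : ℂ)) x - F z0 x))
        (fun n => ?_) (Eventually.of_forall fun x => ?_)
      · have hm : z0 + (((ε / 4 / 2) / ((n:ℝ) + 1) : ℝ) : ℂ) ∈ U := by
          apply hbU
          rw [Metric.mem_ball, dist_eq_norm, add_sub_cancel_left, Complex.norm_real, Real.norm_eq_abs,
            abs_of_pos (by positivity), div_lt_iff₀ (by positivity)]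
          have : (0:ℝ) ≤ n := Nat.cast_nonneg n
          nlinarith
        exact (integrable_cont (Continuous.const_smul ((hcx _ hm).sub (hcx z0 hz0))
          ((((ε / 4 / 2) / ((n:ℝ) + 1) : ℝ) : ℂ)⁻¹))).aestronglyMeasurable
      · exact ((hd z0 hz0 x).hasDerivAt.tendsto_slope_zero).comp ht)
    (Eventually.of_forall fun x z hz => hder x z hz)
    (integrable_const _)
    (Eventually.of_forall fun x z hz => (hd z (hbU z hz) x).hasDerivAt)
  exact this.2.differentiableAt

end ESI

namespace ESI

open Filter Topology Complex MeasureTheory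

variable {p q : ℂ}

/-- the set of ordered pairs -/
abbrev prs (κ : Type*) [Fintype κ] [LinearOrder κ] : Finset (κ × κ) :=
  Finset.univ.filter fun ij : κ × κ => ij.1 < ij.2

lemma prs_split {κ : Type*} [Fintype κ] [LinearOrder κ] (f : κ → κ → ℂ)
    (hf : ∀ i j, i ≠ j → f i j = f j i) (i : κ) :
    ∏ ij ∈ prs κ, f ij.1 ij.2 = (∏ j ∈ Finset.univ.erase i, f i j) *
      ∏ ij ∈ (prs κ).filter (fun ij => ij.1 ≠ i ∧ ij.2 ≠ i), f ij.1 ij.2 := by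
  rw [← Finset.prod_filter_mul_prod_filter_not (prs κ) (fun ij => ij.1 ≠ i ∧ ij.2 ≠ i), mul_comm]
  congr 1
  symm
  refine Finset.prod_bij (fun j _ => if i < j then (i, j) else (j, i)) ?_ ?_ ?_ ?_
  · intro j hj
    have : j ≠ i := Finset.ne_of_mem_erase hj
    split_ifs with h
    · simp [h]
    · simp [lt_of_le_of_ne (not_lt.1 h) this]
  · intro j hj k hk h
    have h1 : j ≠ i := Finset.ne_of_mem_erase hj
    have h2 : k ≠ i := Finset.ne_of_mem_erase hk
    split_ifs at h <;> simp_all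
  · rintro ⟨a, b⟩ hab
    simp only [Finset.mem_filter, Finset.mem_univ, true_and, not_and_or, not_not] at hab
    obtain ⟨hlt, rfl | rfl⟩ := hab
    · exact ⟨b, by simp [hlt.ne'], by simp [hlt]⟩
    · exact ⟨a, by simp [hlt.ne], by simp [hlt.not_gt]⟩
  · intro j hj
    have : j ≠ i := Finset.ne_of_mem_erase hj
    split_ifs with h
    · rfl
    · exact hf i j this.symm

lemma cAt_th (hp : ‖p‖ < 1) {X : Type*} [TopologicalSpace X] {f : X → ℂ} {x : X}
    (hf : ContinuousAt f x) (h : f x ≠ 0) : ContinuousAt (fun x => th p (f x)) x :=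
  ContinuousAt.comp (g := th p) (th_diff hp h).continuousAt hf

lemma cAt_gam (hp : ‖p‖ < 1) (hq : ‖q‖ < 1) {X : Type*} [TopologicalSpace X] {f : X → ℂ} {x : X}
    (hf : ContinuousAt f x) (h : f x ≠ 0) (h1 : ‖f x‖ < 1) :
    ContinuousAt (fun x => ellGamma (f x) p q) x :=
  ContinuousAt.comp (g := fun z => ellGamma z p q) (gam_diff_of_lt hp hq h h1).continuousAt hf

lemma dAt_gam (hp : ‖p‖ < 1) (hq : ‖q‖ < 1) {f : ℂ → ℂ} {x : ℂ}
    (hf : DifferentiableAt ℂ f x) (h : f x ≠ 0) (h1 : ‖f x‖ < 1) :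
    DifferentiableAt ℂ (fun x => ellGamma (f x) p q) x :=
  DifferentiableAt.fun_comp' x (gam_diff_of_lt hp hq h h1) hf

lemma dAt_th (hp : ‖p‖ < 1) {f : ℂ → ℂ} {x : ℂ}
    (hf : DifferentiableAt ℂ f x) (h : f x ≠ 0) :
    DifferentiableAt ℂ (fun x => th p (f x)) x :=
  DifferentiableAt.fun_comp' x (th_diff hp h) hf

/-- interaction weight -/
noncomputable def Dd (p q x y : ℂ) : ℂ :=
  th p (x * y) * th p (x * y⁻¹) * (th q (x * y)⁻¹ * th q (x * y⁻¹)⁻¹)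

/-- one-body weight -/
noncomputable def W0 (p q x : ℂ) : ℂ := th p (x ^ 2) * th q (x ^ 2)⁻¹

/-- parameter weight -/
noncomputable def Gw {κ : Type*} [Fintype κ] (p q : ℂ) (t : κ → ℂ) (x : ℂ) : ℂ :=
  ∏ m, ellGamma (t m * x) p q * ellGamma (t m * x⁻¹) p q

/-- type I weight -/
noncomputable def wI {n : ℕ} {κ : Type*} [Fintype κ] (p q : ℂ) (t : κ → ℂ) (z : Fin n → ℂ) : ℂ :=
  (∏ ij ∈ prs (Fin n), Dd p q (z ij.1) (z ij.2)) * ∏ j, (W0 p q (z j) * Gw p q t (z j))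

/-- type I integral -/
noncomputable def II {κ : Type*} [Fintype κ] (n : ℕ) (p q : ℂ) (t : κ → ℂ) : ℂ :=
  ∫ z : Tor n, wI p q t (fun i => (z i : ℂ)) ∂(ν n)

/-- type I evaluation -/
noncomputable def KK {κ : Type*} [Fintype κ] [LinearOrder κ] (p q : ℂ) (t : κ → ℂ) : ℂ :=
  ∏ ij ∈ prs κ, ellGamma (t ij.1 * t ij.2) p q

lemma Dd_symm (hp : ‖p‖ < 1) (hq : ‖q‖ < 1) {x y : ℂ} (hx : x ≠ 0) (hy : y ≠ 0) :
    Dd p q x y = Dd p q y x := by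
  unfold Dd
  have e : y * x⁻¹ = (x * y⁻¹)⁻¹ := by field_simp
  have h0 : x * y⁻¹ ≠ 0 := by positivity
  rw [e, inv_inv, th_inv hp h0, th_inv hq h0, mul_comm y x]
  field_simp

lemma Dd_inv (hp : ‖p‖ < 1) (hq : ‖q‖ < 1) {x y : ℂ} (hx : x ≠ 0) (hy : y ≠ 0) :
    Dd p q x⁻¹ y = Dd p q x y := by
  unfold Dd
  have e : x⁻¹ * y⁻¹ = (x * y)⁻¹ := by field_simp
  have e2 : x⁻¹ * y = (x * y⁻¹)⁻¹ := by field_simp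
  have h0 : x * y⁻¹ ≠ 0 := by positivity
  have h1 : x * y ≠ 0 := by positivity
  rw [e, e2, inv_inv, inv_inv, th_inv hp h0, th_inv hq h0, th_inv hp h1, th_inv hq h1]
  field_simp

lemma W0_inv (hp : ‖p‖ < 1) (hq : ‖q‖ < 1) {x : ℂ} (hx : x ≠ 0) :
    W0 p q x⁻¹ = W0 p q x := by
  unfold W0
  have h0 : x ^ 2 ≠ 0 := by positivity
  rw [inv_pow, inv_inv, th_inv hp h0, th_inv hq h0]
  field_simp

lemma Gw_inv {κ : Type*} [Fintype κ] (t : κ → ℂ) (x : ℂ) : Gw p q t x⁻¹ = Gw p q t x := by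
  unfold Gw
  refine Finset.prod_congr rfl fun m _ => ?_
  rw [inv_inv, mul_comm]

lemma norm_tz {t z : ℂ} (ht : ‖t‖ < 1) (hz : ‖z‖ = 1) : ‖t * z‖ < 1 := by
  rw [norm_mul, hz, mul_one]; exact ht

lemma unit_ne {z : ℂ} (hz : ‖z‖ = 1) : z ≠ 0 := by rintro rfl; simp at hz

lemma unit_inv {z : ℂ} (hz : ‖z‖ = 1) : ‖z⁻¹‖ = 1 := by simp [hz]

section cont
variable {X : Type*} [TopologicalSpace X] {x : X}

lemma cAt_Dd (hp : ‖p‖ < 1) (hq : ‖q‖ < 1) {f g : X → ℂ} (hf : ContinuousAt f x)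
    (hg : ContinuousAt g x) (hf0 : f x ≠ 0) (hg0 : g x ≠ 0) :
    ContinuousAt (fun x => Dd p q (f x) (g x)) x := by
  unfold Dd
  have gi := hg.inv₀ hg0
  have h0 : f x * g x ≠ 0 := mul_ne_zero hf0 hg0
  have h1 : f x * (g x)⁻¹ ≠ 0 := mul_ne_zero hf0 (inv_ne_zero hg0)
  exact ((cAt_th hp (hf.mul hg) h0).mul (cAt_th hp (hf.mul gi) h1)).mul
    ((cAt_th hq ((hf.mul hg).inv₀ h0) (inv_ne_zero h0)).mul
    (cAt_th hq ((hf.mul gi).inv₀ h1) (inv_ne_zero h1)))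

lemma cAt_W0 (hp : ‖p‖ < 1) (hq : ‖q‖ < 1) {f : X → ℂ} (hf : ContinuousAt f x)
    (hf0 : f x ≠ 0) : ContinuousAt (fun x => W0 p q (f x)) x := by
  unfold W0
  have h0 : f x ^ 2 ≠ 0 := pow_ne_zero 2 hf0
  exact (cAt_th hp (hf.pow 2) h0).mul (cAt_th hq ((hf.pow 2).inv₀ h0) (inv_ne_zero h0))

lemma cAt_Gw {κ : Type*} [Fintype κ] (hp : ‖p‖ < 1) (hq : ‖q‖ < 1) {t : X → κ → ℂ} {f : X → ℂ}
    (ht : ∀ m, ContinuousAt (fun x => t x m) x) (ht0 : ∀ m, t x m ≠ 0) (ht1 : ∀ m, ‖t x m‖ < 1)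
    (hf : ContinuousAt f x)
    (hf0 : ‖f x‖ = 1) : ContinuousAt (fun x => Gw p q (t x) (f x)) x := by
  unfold Gw
  refine tendsto_finset_prod _ fun m _ => ?_
  have hf00 := unit_ne hf0
  exact (cAt_gam hp hq ((ht m).mul hf) (mul_ne_zero (ht0 m) hf00) (norm_tz (ht1 m) hf0)).mul
    (cAt_gam hp hq ((ht m).mul (hf.inv₀ hf00)) (mul_ne_zero (ht0 m) (inv_ne_zero hf00))
      (norm_tz (ht1 m) (unit_inv hf0)))

lemma cAt_wI {n : ℕ} {κ : Type*} [Fintype κ] (hp : ‖p‖ < 1) (hq : ‖q‖ < 1) {t : X → κ → ℂ}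
    {z : X → Fin n → ℂ}
    (ht : ∀ m, ContinuousAt (fun x => t x m) x) (ht0 : ∀ m, t x m ≠ 0) (ht1 : ∀ m, ‖t x m‖ < 1)
    (hz : ∀ i, ContinuousAt (fun x => z x i) x) (hz0 : ∀ i, ‖z x i‖ = 1) :
    ContinuousAt (fun x => wI p q (t x) (z x)) x := by
  unfold wI
  refine ContinuousAt.mul (tendsto_finset_prod _ fun ij _ => ?_) (tendsto_finset_prod _ fun j _ => ?_)
  · exact cAt_Dd hp hq (hz _) (hz _) (unit_ne (hz0 _)) (unit_ne (hz0 _))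
  · exact (cAt_W0 hp hq (hz _) (unit_ne (hz0 _))).mul (cAt_Gw hp hq ht ht0 ht1 (hz j) (hz0 j))
end cont

lemma cont_coord {n : ℕ} (i : Fin n) : Continuous fun z : Tor n => (z i : ℂ) :=
  continuous_subtype_val.comp (continuous_apply i)

lemma cnorm (z : Circle) : ‖(z : ℂ)‖ = 1 := Circle.norm_coe z

lemma cont_wI {n : ℕ} {κ : Type*} [Fintype κ] (hp : ‖p‖ < 1) (hq : ‖q‖ < 1) {t : κ → ℂ}
    (ht0 : ∀ m, t m ≠ 0) (ht1 : ∀ m, ‖t m‖ < 1) :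
    Continuous fun z : Tor n => wI p q t (fun i => (z i : ℂ)) := by
  rw [continuous_iff_continuousAt]
  intro z
  exact cAt_wI hp hq (fun m => continuousAt_const) ht0 ht1 (fun i => (cont_coord i).continuousAt)
    (fun i => cnorm _)

lemma dAt_Gw {κ : Type*} [Fintype κ] (hp : ‖p‖ < 1) (hq : ‖q‖ < 1) {t : ℂ → κ → ℂ} {x z : ℂ}
    (ht : ∀ m, DifferentiableAt ℂ (fun x => t x m) x) (ht0 : ∀ m, t x m ≠ 0)
    (ht1 : ∀ m, ‖t x m‖ < 1) (hz : ‖z‖ = 1) : DifferentiableAt ℂ (fun x => Gw p q (t x) z) x := by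
  unfold Gw
  refine DifferentiableAt.fun_finset_prod fun m _ => ?_
  have hf00 := unit_ne hz
  exact (dAt_gam hp hq ((ht m).mul_const z) (mul_ne_zero (ht0 m) hf00) (norm_tz (ht1 m) hz)).mul
    (dAt_gam hp hq ((ht m).mul_const z⁻¹) (mul_ne_zero (ht0 m) (inv_ne_zero hf00))
      (norm_tz (ht1 m) (unit_inv hz)))

lemma dAt_wI {n : ℕ} {κ : Type*} [Fintype κ] (hp : ‖p‖ < 1) (hq : ‖q‖ < 1) {t : ℂ → κ → ℂ} {x : ℂ}
    {z : Fin n → ℂ}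
    (ht : ∀ m, DifferentiableAt ℂ (fun x => t x m) x) (ht0 : ∀ m, t x m ≠ 0)
    (ht1 : ∀ m, ‖t x m‖ < 1) (hz : ∀ i, ‖z i‖ = 1) :
    DifferentiableAt ℂ (fun x => wI p q (t x) z) x := by
  unfold wI
  refine DifferentiableAt.const_mul (DifferentiableAt.fun_finset_prod fun m _ => ?_) _
  exact (dAt_Gw hp hq ht ht0 ht1 (hz _)).const_mul _

lemma II_diff {n : ℕ} {κ : Type*} [Fintype κ] (hp : ‖p‖ < 1) (hq : ‖q‖ < 1) {t : ℂ → κ → ℂ}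
    {U : Set ℂ} (hU : IsOpen U)
    (ht : ∀ x ∈ U, ∀ m, DifferentiableAt ℂ (fun x => t x m) x) (ht0 : ∀ x ∈ U, ∀ m, t x m ≠ 0)
    (ht1 : ∀ x ∈ U, ∀ m, ‖t x m‖ < 1) : DifferentiableOn ℂ (fun x => II n p q (t x)) U := by
  unfold II
  refine diff_integral hU (F := fun x z => wI p q (t x) (fun i => ((z : Tor n) i : ℂ))) ?_ ?_
  · intro x hx z
    refine cAt_wI (X := ℂ × Tor n) hp hq (t := fun y => t y.1) (z := fun y i => (y.2 i : ℂ))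
      (fun m => ?_) (ht0 x hx) (ht1 x hx) (fun i => ?_) (fun i => cnorm _)
    · exact ContinuousAt.comp (g := fun x => t x m) (f := fun y : ℂ × Tor n => y.1)
        (ht x hx m).continuousAt continuousAt_fst
    · exact ((cont_coord i).comp continuous_snd).continuousAt
  · intro x hx z
    exact dAt_wI hp hq (ht x hx) (ht0 x hx) (ht1 x hx) (fun i => cnorm _)

lemma KK_diff {κ : Type*} [Fintype κ] [LinearOrder κ] (hp : ‖p‖ < 1) (hq : ‖q‖ < 1) {t : ℂ → κ → ℂ}
    {x : ℂ} (ht : ∀ m, DifferentiableAt ℂ (fun x => t x m) x) (ht0 : ∀ m, t x m ≠ 0)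
    (ht1 : ∀ m, ‖t x m‖ < 1) : DifferentiableAt ℂ (fun x => KK p q (t x)) x := by
  unfold KK
  refine DifferentiableAt.fun_finset_prod fun m _ => ?_
  refine dAt_gam hp hq ((ht _).mul (ht _)) (mul_ne_zero (ht0 _) (ht0 _)) ?_
  rw [norm_mul]
  exact mul_lt_one_of_nonneg_of_lt_one_left (norm_nonneg _) (ht1 _) (ht1 _).le

end ESI

namespace ESI

open Filter Topology Complex MeasureTheory

variable {p q : ℂ}

/-- summand of the partial fraction identity -/
noncomputable def Rt {ι κ : Type*} [Fintype ι] [DecidableEq ι] [Fintype κ] (p : ℂ) (t : κ → ℂ)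
    (y : ι → ℂ) (i : ι) (x : ℂ) : ℂ :=
  x * (∏ m, th p (t m * x)) /
    (th p (x ^ 2) * ∏ j, if j = i then 1 else th p (x * y j) * th p (x * (y j)⁻¹))

lemma pf {ι κ : Type*} [Fintype ι] [DecidableEq ι] [Fintype κ] [DecidableEq κ]
    (hp : ‖p‖ < 1) (hp0 : p ≠ 0) (t : κ → ℂ) (y : ι → ℂ)
    (hc : Fintype.card κ = 2 * Fintype.card ι)
    (hy : ∀ i, y i ≠ 0) (ht : ∀ m, t m ≠ 0) (hprod : ∏ m, t m = p)
    (h2 : ∀ i, th p (y i ^ 2) ≠ 0)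
    (h11 : ∀ i j, i ≠ j → th p (y i * y j) ≠ 0) (h12 : ∀ i j, i ≠ j → th p (y i * (y j)⁻¹) ≠ 0) :
    ∑ i, (Rt p t y i (y i) + Rt p t y i (y i)⁻¹) = 0 := by
  have hne : ∀ x : ℂ, x ≠ 0 → th p x ≠ 0 → th p x⁻¹ ≠ 0 := by
    intro x hx h
    rw [th_inv hp hx]
    exact mul_ne_zero (neg_ne_zero.2 (inv_ne_zero hx)) h
  let a : ι × Bool → ℂ := fun k => if k.2 then y k.1 else (y k.1)⁻¹
  have ha : ∀ k, a k ≠ 0 := by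
    rintro ⟨i, b⟩
    cases b <;> simp [a, hy]
  have key := frob' (p := p) hp hp0 (Finset.univ : Finset (ι × Bool)) (Finset.univ : Finset κ) a t
    (by simp [Finset.card_univ, hc, mul_comm]) (fun k _ => ha k) (fun m _ => ht m) ?_ ?_
  · rw [Fintype.sum_prod_type] at key
    simp only [Fintype.sum_bool] at key
    rw [← key]
    refine Finset.sum_congr rfl fun i _ => ?_
    have her : ∀ b : Bool, ∏ l ∈ Finset.univ.erase (i, b), th p (a (i, b) / a l) =
        th p (a (i, b) ^ 2) * ∏ j, if j = i then 1 else
          th p (a (i, b) * y j) * th p (a (i, b) * (y j)⁻¹) := by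
      intro b
      have e1 : (Finset.univ.erase (i, b) : Finset (ι × Bool)) =
          insert (i, !b) ((Finset.univ.erase i) ×ˢ Finset.univ) := by
        ext ⟨j, c⟩
        by_cases h : j = i <;> cases b <;> cases c <;> simp [h]
      rw [e1, Finset.prod_insert (by simp), Finset.prod_product]
      congr 1
      · congr 1
        cases b <;> simp [a, sq, div_eq_mul_inv]
      · rw [← Finset.mul_prod_erase Finset.univ _ (Finset.mem_univ i)]
        simp only [if_true, one_mul]
        refine Finset.prod_congr rfl fun j hj => ?_
        rw [if_neg (Finset.ne_of_mem_erase hj), Fintype.prod_bool]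
        simp [a, div_eq_mul_inv, mul_comm]
    rw [her true, her false]
    simp [Rt, a]
  · rintro ⟨i, b⟩ - ⟨j, c⟩ - hij
    by_cases h : i = j
    · subst h
      have : b ≠ c := by rintro rfl; exact hij rfl
      have h3 := h2 i
      have h4 := hne _ (pow_ne_zero 2 (hy i)) (h2 i)
      rw [sq] at h3 h4
      cases b <;> cases c <;> simp_all [a, div_eq_mul_inv]
    · have h3 := h11 i j h
      have h4 := h12 i j h
      have h5 := hne _ (mul_ne_zero (hy i) (hy j)) h3
      have h6 := hne _ (mul_ne_zero (hy i) (inv_ne_zero (hy j))) h4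
      rw [mul_inv] at h5 h6
      cases b <;> cases c <;> simp_all [a, div_eq_mul_inv]
  · rw [hprod, Fintype.prod_prod_type]
    simp [a, hy]

/-- generic points of the torus -/
def Gen {n : ℕ} (z : Tor n) : Prop :=
  (∀ i, (z i : ℂ) ^ 2 ≠ 1) ∧ ∀ i j, i ≠ j → (z i * z j : ℂ) ≠ 1 ∧ (z i * (z j : ℂ)⁻¹ : ℂ) ≠ 1

lemma count_exp (w : ℂ) (k : ℝ) (hk : k ≠ 0) :
    {ε : ℝ | Complex.exp (ε * k * I) = w}.Countable := by
  rcases Set.eq_empty_or_nonempty {ε : ℝ | Complex.exp (ε * k * I) = w} with h | ⟨e0, h0⟩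
  · rw [h]; exact Set.countable_empty
  · refine (Set.countable_range fun m : ℤ => e0 + m * (2 * Real.pi) / k).mono ?_
    intro e he
    simp only [Set.mem_setOf_eq] at he h0
    rw [← h0, Complex.exp_eq_exp_iff_exists_int] at he
    obtain ⟨m, hm⟩ := he
    refine ⟨m, ?_⟩
    have h1 : (e * k * I : ℂ) = ((e0 * k + m * (2 * Real.pi) : ℝ) : ℂ) * I := by
      rw [hm]; push_cast; ring
    have h2 := mul_right_cancel₀ I_ne_zero h1
    have h3 : e * k = e0 * k + m * (2 * Real.pi) := by exact_mod_cast h2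
    simp only
    field_simp
    linarith

lemma ext_gen {n : ℕ} {G : Tor n → ℂ} (hG : Continuous G) (h : ∀ z, Gen z → G z = 0) (z : Tor n) :
    G z = 0 := by
  let c : ℝ → Tor n := fun ε i => z i * Circle.exp (ε * ((i : ℕ) + 1))
  have hc : Continuous c := by
    refine continuous_pi fun i => continuous_const.mul (Circle.exp.continuous.comp (by fun_prop))
  have hcoe : ∀ ε i, (c ε i : ℂ) = z i * Complex.exp (ε * ((i : ℕ) + 1 : ℝ) * I) := by
    intro ε i; simp [c, Circle.coe_exp]
  have hz : ∀ i, (z i : ℂ) ≠ 0 := fun i => unit_ne (cnorm _)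
  let bad : Set ℝ := (⋃ i : Fin n, {ε : ℝ | Complex.exp (ε * (2 * ((i : ℕ) + 1) : ℝ) * I) = ((z i : ℂ) ^ 2)⁻¹}) ∪
    ((⋃ i : Fin n, ⋃ j : Fin n, {ε : ℝ | Complex.exp (ε * ((i : ℕ) + 1 + (j : ℕ) + 1 : ℝ) * I) = ((z i * z j : ℂ))⁻¹}) ∪
    (⋃ i : Fin n, ⋃ j ∈ {j : Fin n | i ≠ j}, {ε : ℝ | Complex.exp (ε * ((i : ℕ) - (j : ℕ) : ℝ) * I) = ((z i * (z j : ℂ)⁻¹ : ℂ))⁻¹}))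
  have hbad : bad.Countable := by
    refine Set.Countable.union (Set.countable_iUnion fun i => count_exp _ _ (by positivity))
      (Set.Countable.union (Set.countable_iUnion fun i => Set.countable_iUnion fun j =>
        count_exp _ _ (by positivity)) (Set.countable_iUnion fun i => Set.Countable.biUnion
          (Set.to_countable _) fun j hj => count_exp _ _ ?_))
    rw [sub_ne_zero]
    simp only [Set.mem_setOf_eq] at hj
    exact_mod_cast fun h => hj (Fin.ext h)
  have hd : Dense badᶜ := hbad.dense_compl ℝ
  have heq : (fun ε => G (c ε)) = fun _ => 0 := by
    refine Continuous.ext_on hd (hG.comp hc) continuous_const fun ε hε => h _ ?_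
    simp only [bad, Set.mem_compl_iff, Set.mem_union, Set.mem_iUnion, Set.mem_setOf_eq, not_or,
      not_exists] at hε
    obtain ⟨h1, h2, h3⟩ := hε
    refine ⟨fun i h => h1 i ?_, fun i j hij => ⟨fun h => h2 i j ?_, fun h => h3 i j hij ?_⟩⟩
    · rw [hcoe, mul_pow, ← Complex.exp_nat_mul] at h
      rw [← eq_inv_of_mul_eq_one_right h]
      congr 1; push_cast; ring
    · rw [hcoe, hcoe, mul_mul_mul_comm, ← Complex.exp_add] at h
      rw [← eq_inv_of_mul_eq_one_right h]
      congr 1; push_cast; ring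
    · rw [hcoe, hcoe, mul_inv, mul_mul_mul_comm, ← Complex.exp_neg, ← Complex.exp_add] at h
      rw [← eq_inv_of_mul_eq_one_right h]
      congr 1; push_cast; ring
  have := congrFun heq 0
  have hc0 : c 0 = z := by ext i; simp [c]
  simpa [hc0] using this

lemma th_unit (hp : ‖p‖ < 1) (hp0 : p ≠ 0) {x : ℂ} (hx : ‖x‖ = 1) (h : x ≠ 1) : th p x ≠ 0 := by
  intro h0
  have := (th_zero_iff hp hp0 (unit_ne hx)).1 h0
  obtain ⟨k, hk⟩ := this
  rw [hk, norm_zpow] at hx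
  have hpp : 0 < ‖p‖ := norm_pos_iff.2 hp0
  have : k = 0 := (zpow_eq_one_iff_right₀ hpp.le hp.ne).1 hx
  subst this
  exact h (by simpa using hk)

end ESI

namespace ESI

open Filter Topology Complex MeasureTheory

variable {p q : ℂ}

/-- product over the torus of thetas -/
noncomputable def Fz {n : ℕ} (p u : ℂ) (z : Fin n → ℂ) : ℂ := ∏ i, th p (u * z i) * th p (u * (z i)⁻¹)

/-- same without the factor `i` -/
noncomputable def Fe {n : ℕ} (p u : ℂ) (z : Fin n → ℂ) (i : Fin n) : ℂ :=
  ∏ j ∈ Finset.univ.erase i, th p (u * z j) * th p (u * (z j)⁻¹)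

/-- one-variable function with vanishing integral -/
noncomputable def hh {n : ℕ} {κ : Type*} [Fintype κ] (p q : ℂ) (t : κ → ℂ) (z : Fin n → ℂ) (i : Fin n) (x : ℂ) : ℂ :=
  x⁻¹ * th q (x ^ 2)⁻¹ * (∏ m, ellGamma (q * (t m * x)) p q * ellGamma (t m * x⁻¹) p q) *
    ∏ j ∈ Finset.univ.erase i, th q (x * z j)⁻¹ * th q (x * (z j)⁻¹)⁻¹

/-- the rest of the integrand -/
noncomputable def rst {n : ℕ} {κ : Type*} [Fintype κ] (p q : ℂ) (t : κ → ℂ) (u v : ℂ) (z : Fin n → ℂ) (i : Fin n) : ℂ :=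
  u * v * th p (u * v) * th p (u * v⁻¹) * Fe p u z i * Fe p v z i *
    (∏ ij ∈ (prs (Fin n)).filter (fun ij => ij.1 ≠ i ∧ ij.2 ≠ i), Dd p q (z ij.1) (z ij.2)) *
    ∏ j ∈ Finset.univ.erase i, (W0 p q (z j) * Gw p q t (z j))

lemma wI_split {n : ℕ} {κ : Type*} [Fintype κ] (hp : ‖p‖ < 1) (hq : ‖q‖ < 1) (t : κ → ℂ)
    {z : Fin n → ℂ} (hz : ∀ i, z i ≠ 0) (i : Fin n) :
    wI p q t z = (∏ j ∈ Finset.univ.erase i, Dd p q (z i) (z j)) * (W0 p q (z i) * Gw p q t (z i)) *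
    ((∏ ij ∈ (prs (Fin n)).filter (fun ij => ij.1 ≠ i ∧ ij.2 ≠ i), Dd p q (z ij.1) (z ij.2)) *
    ∏ j ∈ Finset.univ.erase i, (W0 p q (z j) * Gw p q t (z j))) := by
  unfold wI
  rw [prs_split (fun i j => Dd p q (z i) (z j)) (fun i j _ => Dd_symm hp hq (hz i) (hz j)) i,
    ← Finset.mul_prod_erase Finset.univ (fun j => W0 p q (z j) * Gw p q t (z j)) (Finset.mem_univ i)]
  ring

lemma pf_term {n : ℕ} {κ : Type*} [Fintype κ] (hp : ‖p‖ < 1) (hq : ‖q‖ < 1) (hq0 : q ≠ 0)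
    {t : κ → ℂ} (ht0 : ∀ m, t m ≠ 0) (ht1 : ∀ m, ‖t m‖ < 1)
    {u v : ℂ} (hu0 : u ≠ 0) (hv0 : v ≠ 0)
    {z : Fin n → ℂ} (hz : ∀ i, ‖z i‖ = 1) (i : Fin n) {x : ℂ} (hx : x = z i ∨ x = (z i)⁻¹)
    (h1 : th p (x * u) ≠ 0) (h2 : th p (x * u⁻¹) ≠ 0) (h3 : th p (x * v) ≠ 0)
    (h4 : th p (x * v⁻¹) ≠ 0) (h5 : th p (x ^ 2) ≠ 0)
    (h6 : ∀ j, j ≠ i → th p (x * z j) ≠ 0 ∧ th p (x * (z j)⁻¹) ≠ 0) :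
    wI p q t z * (th p (u * v) * th p (u * v⁻¹) * Fz p u z * Fz p v z *
      (x * (∏ m, th p (t m * x)) / (th p (x ^ 2) * (th p (x * u) * th p (x * u⁻¹) *
        (th p (x * v) * th p (x * v⁻¹) *
        ∏ j ∈ Finset.univ.erase i, th p (x * z j) * th p (x * (z j)⁻¹)))))) =
    hh p q t z i x * rst p q t u v z i := by
  have hzi := unit_ne (hz i)
  have hx1 : ‖x‖ = 1 := by rcases hx with rfl | rfl <;> simp [hz]
  have hx0 := unit_ne hx1
  have eD : ∏ j ∈ Finset.univ.erase i, Dd p q (z i) (z j) =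
      (∏ j ∈ Finset.univ.erase i, th p (x * z j) * th p (x * (z j)⁻¹)) *
      ∏ j ∈ Finset.univ.erase i, th q (x * z j)⁻¹ * th q (x * (z j)⁻¹)⁻¹ := by
    rw [← Finset.prod_mul_distrib]
    refine Finset.prod_congr rfl fun j _ => ?_
    rcases hx with rfl | rfl
    · rfl
    · rw [← Dd_inv hp hq hzi (unit_ne (hz j))]; rfl
  have eW : W0 p q (z i) = th p (x ^ 2) * th q (x ^ 2)⁻¹ := by
    rcases hx with rfl | rfl
    · rfl
    · rw [← W0_inv hp hq hzi]; rfl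
  have eG : Gw p q t (z i) * ∏ m, th p (t m * x) =
      ∏ m, ellGamma (q * (t m * x)) p q * ellGamma (t m * x⁻¹) p q := by
    have : Gw p q t (z i) = Gw p q t x := by
      rcases hx with rfl | rfl
      · rfl
      · rw [Gw_inv]
    rw [this, Gw, ← Finset.prod_mul_distrib]
    refine Finset.prod_congr rfl fun m _ => ?_
    rw [gam_q hp hq hq0 (mul_ne_zero (ht0 m) hx0) (E2_ne_of_lt hp hq (norm_tz (ht1 m) hx1))]
    ring
  have eF : ∀ w : ℂ, w ≠ 0 → Fz p w z = (-(w * x⁻¹)) * (th p (x * w) * th p (x * w⁻¹)) * Fe p w z i := by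
    intro w hw
    unfold Fz Fe
    rw [← Finset.mul_prod_erase Finset.univ _ (Finset.mem_univ i)]
    congr 1
    have e : x * w⁻¹ = (w * x⁻¹)⁻¹ := by field_simp
    rw [e, th_inv hp (mul_ne_zero hw (inv_ne_zero hx0)), mul_comm x w]
    rcases hx with rfl | rfl
    · field_simp
    · rw [inv_inv]; field_simp
  rw [wI_split hp hq t (fun i => unit_ne (hz i)) i, eD, eW, eF u hu0, eF v hv0]
  have h7 : ∏ j ∈ Finset.univ.erase i, th p (x * z j) * th p (x * (z j)⁻¹) ≠ 0 :=
    Finset.prod_ne_zero_iff.2 fun j hj =>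
      mul_ne_zero (h6 j (Finset.ne_of_mem_erase hj)).1 (h6 j (Finset.ne_of_mem_erase hj)).2
  unfold hh rst
  rw [← eG]
  generalize (∏ j ∈ Finset.univ.erase i, th p (x * z j) * th p (x * (z j)⁻¹)) = P1 at *
  generalize th p (x * u) = T1 at *
  generalize th p (x * v) = T2 at *
  generalize th p (x * u⁻¹) = T3 at *
  generalize th p (x * v⁻¹) = T4 at *
  generalize th p (x ^ 2) = T5 at *
  generalize (∏ j ∈ Finset.univ.erase i, th q (x * z j)⁻¹ * th q (x * (z j)⁻¹)⁻¹) = P2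
  generalize Gw p q t (z i) = G1
  generalize (∏ m, th p (t m * x)) = G2
  generalize (∏ j ∈ Finset.univ.erase i, (W0 p q (z j) * Gw p q t (z j))) = G3
  generalize (∏ ij ∈ (prs (Fin n)).filter (fun ij => ij.1 ≠ i ∧ ij.2 ≠ i), Dd p q (z ij.1) (z ij.2)) = G4
  generalize th q (x ^ 2)⁻¹ = T6
  generalize th p (u * v) = T7
  generalize th p (u * v⁻¹) = T8
  generalize Fe p u z i = T9
  generalize Fe p v z i = T10
  clear eD eW eG eF h6
  field_simp

lemma ptwise {n : ℕ} {κ : Type*} [Fintype κ] [DecidableEq κ] (hp : ‖p‖ < 1) (hq : ‖q‖ < 1)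
    (hp0 : p ≠ 0) (hq0 : q ≠ 0)
    (hc : Fintype.card κ = 2 * n + 4)
    {t : κ → ℂ} (ht0 : ∀ m, t m ≠ 0) (ht1 : ∀ m, ‖t m‖ < 1) (hprod : ∏ m, t m = p)
    {a b : κ} {u v : ℂ} (hu : t a = u) (hv : t b = v)
    (huu : th p (u ^ 2) ≠ 0) (hvv : th p (v ^ 2) ≠ 0) (huv : th p (u * v) ≠ 0)
    (huv' : th p (u * v⁻¹) ≠ 0)
    (huz : ∀ z : ℂ, ‖z‖ = 1 → th p (u * z) ≠ 0) (hvz : ∀ z : ℂ, ‖z‖ = 1 → th p (v * z) ≠ 0)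
    {z : Tor n} (hg : Gen z) :
    wI p q t (fun i => (z i : ℂ)) * (u * ((∏ m ∈ Finset.univ.erase a, th p (u * t m)) *
      Fz p v (fun i => (z i : ℂ)) - (∏ m ∈ Finset.univ.erase b, th p (v * t m)) *
      Fz p u (fun i => (z i : ℂ)))) +
    ∑ i, (hh p q t (fun i => (z i : ℂ)) i (z i) + hh p q t (fun i => (z i : ℂ)) i (z i)⁻¹) *
      rst p q t u v (fun i => (z i : ℂ)) i = 0 := by
  have hu0 : u ≠ 0 := hu ▸ ht0 a
  have hv0 : v ≠ 0 := hv ▸ ht0 b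
  let y : Option (Option (Fin n)) → ℂ
    | none => u
    | some none => v
    | some (some i) => z i
  have hz1 : ∀ i, ‖(z i : ℂ)‖ = 1 := fun i => cnorm _
  have hz0 : ∀ i, (z i : ℂ) ≠ 0 := fun i => unit_ne (hz1 i)
  have hinv : ∀ x : ℂ, x ≠ 0 → th p x ≠ 0 → th p x⁻¹ ≠ 0 := by
    intro x hx h
    rw [th_inv hp hx]
    exact mul_ne_zero (neg_ne_zero.2 (inv_ne_zero hx)) h
  have hzu : ∀ w : ℂ, w ≠ 0 → (∀ z : ℂ, ‖z‖ = 1 → th p (w * z) ≠ 0) → ∀ z : ℂ, ‖z‖ = 1 →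
      th p (z * w) ≠ 0 ∧ th p (z * w⁻¹) ≠ 0 := by
    intro w hw h z hz
    refine ⟨by rw [mul_comm]; exact h z hz, ?_⟩
    have := hinv _ (mul_ne_zero hw (inv_ne_zero (unit_ne hz))) (h _ (unit_inv hz))
    rwa [mul_inv, inv_inv, mul_comm] at this
  have hzz2 : ∀ i, th p ((z i : ℂ) ^ 2) ≠ 0 := fun i => th_unit hp hp0 (by rw [norm_pow, hz1, one_pow]) (hg.1 i)
  have hzz : ∀ i j, i ≠ j → th p (z i * z j : ℂ) ≠ 0 :=
    fun i j h => th_unit hp hp0 (by rw [norm_mul, hz1, hz1, one_mul]) (hg.2 i j h).1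
  have hzz' : ∀ i j, i ≠ j → th p (z i * (z j : ℂ)⁻¹ : ℂ) ≠ 0 :=
    fun i j h => th_unit hp hp0 (by rw [norm_mul, norm_inv, hz1, hz1, inv_one, one_mul]) (hg.2 i j h).2
  have key := pf hp hp0 t y (by simp [hc]; ring) ?_ ht0 hprod ?_ ?_ ?_
  rotate_left
  · rintro (_ | _ | i) <;> simp [y, hu0, hv0]
  · rintro (_ | _ | i)
    · exact huu
    · exact hvv
    · exact hzz2 i
  · rintro (_ | _ | i) (_ | _ | j) h
    · simp at h
    · exact huv
    · exact huz _ (hz1 j)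
    · rw [mul_comm]; exact huv
    · simp at h
    · exact hvz _ (hz1 j)
    · exact (hzu u hu0 huz _ (hz1 i)).1
    · exact (hzu v hv0 hvz _ (hz1 i)).1
    · exact hzz i j (fun h' => h (by rw [h']))
  · rintro (_ | _ | i) (_ | _ | j) h
    · simp at h
    · exact huv'
    · exact huz _ (unit_inv (hz1 j))
    · have := hinv _ (mul_ne_zero hu0 (inv_ne_zero hv0)) huv'
      rw [mul_inv, inv_inv, mul_comm] at this
      exact this
    · simp at h
    · exact hvz _ (unit_inv (hz1 j))
    · exact (hzu u hu0 huz _ (hz1 i)).2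
    · exact (hzu v hv0 hvz _ (hz1 i)).2
    · exact hzz' i j (fun h' => h (by rw [h']))
  rw [Fintype.sum_option, Fintype.sum_option] at key
  have hFu : Fz p u (fun i => (z i : ℂ)) ≠ 0 := Finset.prod_ne_zero_iff.2 fun i _ =>
    mul_ne_zero (huz _ (hz1 i)) (huz _ (unit_inv (hz1 i)))
  have hFv : Fz p v (fun i => (z i : ℂ)) ≠ 0 := Finset.prod_ne_zero_iff.2 fun i _ =>
    mul_ne_zero (hvz _ (hz1 i)) (hvz _ (unit_inv (hz1 i)))
  have hzero : ∀ w : ℂ, ∀ c : κ, w ≠ 0 → t c = w → ∏ m, th p (t m * w⁻¹) = 0 := by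
    intro w c hw h
    refine Finset.prod_eq_zero (Finset.mem_univ c) ?_
    rw [h, mul_inv_cancel₀ hw, th_one hp]
  have hsplit : ∀ w : ℂ, ∀ c : κ, t c = w → ∏ m, th p (t m * w) =
      th p (w ^ 2) * ∏ m ∈ Finset.univ.erase c, th p (w * t m) := by
    intro w c h
    rw [← Finset.mul_prod_erase Finset.univ _ (Finset.mem_univ c), h, sq]
    congr 1
    exact Finset.prod_congr rfl fun m _ => by rw [mul_comm]
  have e1 : Rt p t y none (y none) = u * (∏ m ∈ Finset.univ.erase a, th p (u * t m)) /
      (th p (u * v) * th p (u * v⁻¹) * Fz p u (fun i => (z i : ℂ))) := by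
    simp only [Rt, Fintype.prod_option, y, reduceCtorEq, if_true, if_false, one_mul, hsplit u a hu, Fz]
    rw [mul_left_comm u, mul_div_mul_left _ _ huu]
  have e2 : Rt p t y none (y none)⁻¹ = 0 := by
    simp only [Rt, y, hzero u a hu0 hu]; simp
  have e3 : Rt p t y (some none) (y (some none)) = -u * (∏ m ∈ Finset.univ.erase b, th p (v * t m)) /
      (th p (u * v) * th p (u * v⁻¹) * Fz p v (fun i => (z i : ℂ))) := by
    simp only [Rt, Fintype.prod_option, y, reduceCtorEq, if_true, if_false, one_mul, hsplit v b hv, Fz,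
      Option.some.injEq]
    rw [mul_left_comm v, mul_div_mul_left _ _ hvv]
    have : v * u⁻¹ = (u * v⁻¹)⁻¹ := by field_simp
    rw [this, th_inv hp (mul_ne_zero hu0 (inv_ne_zero hv0)), mul_comm v u]
    unfold Fz at hFv
    field_simp
  have e4 : Rt p t y (some none) (y (some none))⁻¹ = 0 := by
    simp only [Rt, y, hzero v b hv0 hv]; simp
  rw [e1, e2, e3, e4] at key
  have e5 : ∀ i : Fin n, ∀ x : ℂ, Rt p t y (some (some i)) x =
      (x * (∏ m, th p (t m * x)) / (th p (x ^ 2) * (th p (x * u) * th p (x * u⁻¹) *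
        (th p (x * v) * th p (x * v⁻¹) *
        ∏ j ∈ Finset.univ.erase i, th p (x * z j) * th p (x * (z j : ℂ)⁻¹))))) := by
    intro i x
    simp only [Rt, Fintype.prod_option, y, reduceCtorEq, if_false, Option.some.injEq]
    rw [← Finset.mul_prod_erase Finset.univ _ (Finset.mem_univ i)]
    simp only [if_true, one_mul]
    rw [Finset.prod_congr rfl fun j hj => if_neg (Finset.ne_of_mem_erase hj)]
  have e6 : ∀ i : Fin n, ∀ x : ℂ, (x = z i ∨ x = (z i : ℂ)⁻¹) → wI p q t (fun i => (z i : ℂ)) *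
      (th p (u * v) * th p (u * v⁻¹) * Fz p u (fun i => (z i : ℂ)) * Fz p v (fun i => (z i : ℂ)) *
        Rt p t y (some (some i)) x) =
      hh p q t (fun i => (z i : ℂ)) i x * rst p q t u v (fun i => (z i : ℂ)) i := by
    intro i x hx
    rw [e5]
    have hx1 : ‖x‖ = 1 := by
      rcases hx with rfl | rfl
      · exact hz1 i
      · exact unit_inv (hz1 i)
    refine pf_term hp hq hq0 ht0 ht1 hu0 hv0 hz1 i hx (hzu u hu0 huz x hx1).1 (hzu u hu0 huz x hx1).2
      (hzu v hv0 hvz x hx1).1 (hzu v hv0 hvz x hx1).2 ?_ ?_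
    · rcases hx with rfl | rfl
      · exact hzz2 i
      · rw [inv_pow]; exact hinv _ (pow_ne_zero 2 (hz0 i)) (hzz2 i)
    · intro j hj
      rcases hx with rfl | rfl
      · exact ⟨hzz i j hj.symm, hzz' i j hj.symm⟩
      · have h1 := hinv _ (mul_ne_zero (hz0 i) (hz0 j)) (hzz i j hj.symm)
        have h2 := hinv _ (mul_ne_zero (hz0 i) (inv_ne_zero (hz0 j))) (hzz' i j hj.symm)
        rw [mul_inv] at h1 h2
        rw [inv_inv] at h2
        exact ⟨h2, h1⟩
  have e7 : ∀ i : Fin n, (hh p q t (fun i => (z i : ℂ)) i (z i) + hh p q t (fun i => (z i : ℂ)) i (z i)⁻¹) *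
      rst p q t u v (fun i => (z i : ℂ)) i = wI p q t (fun i => (z i : ℂ)) *
      (th p (u * v) * th p (u * v⁻¹) * Fz p u (fun i => (z i : ℂ)) * Fz p v (fun i => (z i : ℂ))) *
      (Rt p t y (some (some i)) (y (some (some i))) + Rt p t y (some (some i)) (y (some (some i)))⁻¹) := by
    intro i
    rw [add_mul, ← e6 i _ (Or.inl rfl), ← e6 i _ (Or.inr rfl)]
    ring
  rw [Finset.sum_congr rfl fun i _ => e7 i, ← Finset.mul_sum]
  generalize (∑ i, (Rt p t y (some (some i)) (y (some (some i))) + Rt p t y (some (some i)) (y (some (some i)))⁻¹)) = S at *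
  generalize (wI p q t fun i => (z i : ℂ)) = w at *
  generalize Fz p u (fun i => (z i : ℂ)) = f1 at *
  generalize Fz p v (fun i => (z i : ℂ)) = f2 at *
  generalize (∏ m ∈ Finset.univ.erase a, th p (u * t m)) = A at *
  generalize (∏ m ∈ Finset.univ.erase b, th p (v * t m)) = B at *
  have hS : S = -(u * A / (th p (u * v) * th p (u * v⁻¹) * f1) + -u * B / (th p (u * v) * th p (u * v⁻¹) * f2)) := by
    linear_combination key
  rw [hS]
  clear key hS hsplit hzero e1 e2 e3 e4 e5 e6 e7
  generalize th p (u * v) = T1 at *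
  generalize th p (u * v⁻¹) = T2 at *
  clear hzz hzz' hzz2 hinv hzu huz hvz
  field_simp
  ring

end ESI

namespace ESI

open Filter Topology Complex MeasureTheory

variable {p q : ℂ}

lemma hh_anti {n : ℕ} {κ : Type*} [Fintype κ] (hq : ‖q‖ < 1) (hq0 : q ≠ 0) (t : κ → ℂ)
    {z : Fin n → ℂ} (hz : ∀ i, z i ≠ 0) (i : Fin n) {x : ℂ} (hx : x ≠ 0) :
    hh p q t z i (q⁻¹ * x⁻¹) = - hh p q t z i x := by
  unfold hh
  have e1 : ∏ m, ellGamma (q * (t m * (q⁻¹ * x⁻¹))) p q * ellGamma (t m * (q⁻¹ * x⁻¹)⁻¹) p q =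
      ∏ m, ellGamma (q * (t m * x)) p q * ellGamma (t m * x⁻¹) p q := by
    refine Finset.prod_congr rfl fun m _ => ?_
    have a1 : q * (t m * (q⁻¹ * x⁻¹)) = t m * x⁻¹ := by field_simp
    have a2 : t m * (q⁻¹ * x⁻¹)⁻¹ = q * (t m * x) := by field_simp
    rw [a1, a2, mul_comm]
  have e2 : ∏ j ∈ Finset.univ.erase i, th q (q⁻¹ * x⁻¹ * z j)⁻¹ * th q (q⁻¹ * x⁻¹ * (z j)⁻¹)⁻¹ =
      ∏ j ∈ Finset.univ.erase i, th q (x * z j)⁻¹ * th q (x * (z j)⁻¹)⁻¹ := by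
    refine Finset.prod_congr rfl fun j _ => ?_
    have hj := hz j
    have a1 : (q⁻¹ * x⁻¹ * z j)⁻¹ = q * (x * (z j)⁻¹) := by field_simp
    have a2 : (q⁻¹ * x⁻¹ * (z j)⁻¹)⁻¹ = q * (x * z j) := by field_simp
    rw [a1, a2, th_p_mul hq hq0 (by positivity), th_p_mul hq hq0 (by positivity), mul_comm]
  have e3 : th q ((q⁻¹ * x⁻¹) ^ 2)⁻¹ = -(q⁻¹ * (x ^ 2)⁻¹) * th q (x ^ 2)⁻¹ := by
    have a1 : ((q⁻¹ * x⁻¹) ^ 2)⁻¹ = q * (q * x ^ 2) := by field_simp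
    have hx2 : x ^ 2 ≠ 0 := pow_ne_zero 2 hx
    rw [a1, th_p hq hq0 (mul_ne_zero hq0 hx2), th_p_mul hq hq0 hx2]
    field_simp
  rw [e1, e2, e3]
  field_simp

lemma hh_dAt {n : ℕ} {κ : Type*} [Fintype κ] (hp : ‖p‖ < 1) (hq : ‖q‖ < 1) (hq0 : q ≠ 0) {t : κ → ℂ}
    (ht0 : ∀ m, t m ≠ 0) (ht1 : ∀ m, ‖t m‖ < 1)
    {z : Fin n → ℂ} (hz : ∀ i, z i ≠ 0) (i : Fin n) {x : ℂ} (hx1 : 1 ≤ ‖x‖) (hx2 : ‖x‖ ≤ ‖q‖⁻¹) :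
    DifferentiableAt ℂ (hh p q t z i) x := by
  have hx : x ≠ 0 := by rintro rfl; simp at hx1; linarith
  have hid : DifferentiableAt ℂ (fun x : ℂ => x) x := differentiableAt_fun_id
  have hqp : 0 < ‖q‖ := norm_pos_iff.2 hq0
  unfold hh
  refine (((hid.inv hx).mul (dAt_th hq ((hid.pow 2).inv (pow_ne_zero 2 hx)) (inv_ne_zero (pow_ne_zero 2 hx)))).mul
    (DifferentiableAt.fun_finset_prod fun m _ => ?_)).mul (DifferentiableAt.fun_finset_prod fun j _ => ?_)
  · refine (dAt_gam hp hq ((hid.const_mul _).const_mul _)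
      (mul_ne_zero hq0 (mul_ne_zero (ht0 m) hx)) ?_).mul
      (dAt_gam hp hq ((hid.inv hx).const_mul _) (mul_ne_zero (ht0 m) (inv_ne_zero hx)) ?_)
    · rw [norm_mul, norm_mul]
      calc ‖q‖ * (‖t m‖ * ‖x‖) ≤ ‖q‖ * (‖t m‖ * ‖q‖⁻¹) := by gcongr
        _ = ‖t m‖ := by field_simp
        _ < 1 := ht1 m
    · rw [norm_mul, norm_inv]
      calc ‖t m‖ * ‖x‖⁻¹ ≤ ‖t m‖ * 1 := by gcongr; exact inv_le_one_of_one_le₀ hx1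
        _ < 1 := by rw [mul_one]; exact ht1 m
  · have a1 : x * z j ≠ 0 := mul_ne_zero hx (hz j)
    have a2 : x * (z j)⁻¹ ≠ 0 := mul_ne_zero hx (inv_ne_zero (hz j))
    exact (dAt_th hq ((hid.mul_const _).inv a1) (inv_ne_zero a1)).mul
      (dAt_th hq ((hid.mul_const _).inv a2) (inv_ne_zero a2))

lemma hh_Mi {n : ℕ} {κ : Type*} [Fintype κ] (hp : ‖p‖ < 1) (hq : ‖q‖ < 1) (hq0 : q ≠ 0) {t : κ → ℂ}
    (ht0 : ∀ m, t m ≠ 0) (ht1 : ∀ m, ‖t m‖ < 1)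
    {z : Fin n → ℂ} (hz : ∀ i, z i ≠ 0) (i : Fin n) : Mi (hh p q t z i) 1 = 0 := by
  have hqp : 0 < ‖q‖ := norm_pos_iff.2 hq0
  have h1 := Mi_annulus (F := hh p q t z i) (r := 1) (R := ‖q‖⁻¹) one_pos
    (by rw [one_le_inv₀ hqp]; exact hq.le) (fun x a b => hh_dAt hp hq hq0 ht0 ht1 hz i a b)
  have h2 := Mi_mul (hh p q t z i) 1 q⁻¹
  have h3 := Mi_inv (fun x => hh p q t z i (q⁻¹ * x)) 1
  have h4 := Mi_congr (F := fun x => hh p q t z i (q⁻¹ * x⁻¹)) (G := fun x => (-1) * hh p q t z i x)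
    (r := 1) zero_le_one (fun x hx => by rw [hh_anti hq hq0 t hz i (unit_ne hx)]; ring)
  rw [Mi_const_mul] at h4
  rw [inv_one] at h3
  rw [mul_one, norm_inv] at h2
  have h5 : Mi (hh p q t z i) 1 = -1 * Mi (hh p q t z i) 1 := by
    conv_lhs => rw [h1, ← h2, ← h3, h4]
  have h6 : (2 : ℂ) * Mi (hh p q t z i) 1 = 0 := by linear_combination h5
  simpa using h6

lemma hh_congr {n : ℕ} {κ : Type*} [Fintype κ] (t : κ → ℂ) {z z' : Fin n → ℂ} {i : Fin n}
    (h : ∀ j, j ≠ i → z j = z' j) (x : ℂ) : hh p q t z i x = hh p q t z' i x := by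
  unfold hh
  congr 1
  refine Finset.prod_congr rfl fun j hj => ?_
  rw [h j (Finset.ne_of_mem_erase hj)]

lemma rst_congr {n : ℕ} {κ : Type*} [Fintype κ] (t : κ → ℂ) (u v : ℂ) {z z' : Fin n → ℂ} {i : Fin n}
    (h : ∀ j, j ≠ i → z j = z' j) : rst p q t u v z i = rst p q t u v z' i := by
  unfold rst Fe
  have e : ∀ f : ℂ → ℂ, ∏ j ∈ Finset.univ.erase i, f (z j) = ∏ j ∈ Finset.univ.erase i, f (z' j) :=
    fun f => Finset.prod_congr rfl fun j hj => by rw [h j (Finset.ne_of_mem_erase hj)]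
  rw [e (fun x => th p (u * x) * th p (u * x⁻¹)), e (fun x => th p (v * x) * th p (v * x⁻¹)),
    e (fun x => W0 p q x * Gw p q t x)]
  congr 2
  refine Finset.prod_congr rfl fun ij hij => ?_
  rw [Finset.mem_filter] at hij
  rw [h _ hij.2.1, h _ hij.2.2]

lemma cont_hh {n : ℕ} {κ : Type*} [Fintype κ] (hp : ‖p‖ < 1) (hq : ‖q‖ < 1) (hq0 : q ≠ 0) {t : κ → ℂ}
    (ht0 : ∀ m, t m ≠ 0) (ht1 : ∀ m, ‖t m‖ < 1) (i : Fin n) {X : Type*} [TopologicalSpace X]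
    {g : X → ℂ} (hg : Continuous g) (hg1 : ∀ z, ‖g z‖ = 1) {c : X → Tor n} (hc : Continuous c) :
    Continuous fun z : X => hh p q t (fun i => (c z i : ℂ)) i (g z) := by
  rw [continuous_iff_continuousAt]
  intro z
  have hx : g z ≠ 0 := unit_ne (hg1 z)
  have hz : ∀ i, (c z i : ℂ) ≠ 0 := fun i => unit_ne (cnorm _)
  have hzc : ∀ j, ContinuousAt (fun z : X => (c z j : ℂ)) z :=
    fun j => ((cont_coord j).comp hc).continuousAt
  have hid := hg.continuousAt (x := z)
  unfold hh
  refine (((hid.inv₀ hx).mul (cAt_th hq ((hid.pow 2).inv₀ (pow_ne_zero 2 hx)) (inv_ne_zero (pow_ne_zero 2 hx)))).mul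
    (tendsto_finset_prod _ fun m _ => ?_)).mul (tendsto_finset_prod _ fun j _ => ?_)
  · refine (cAt_gam hp hq (continuousAt_const.mul (continuousAt_const.mul hid))
      (mul_ne_zero hq0 (mul_ne_zero (ht0 m) hx)) ?_).mul
      (cAt_gam hp hq (continuousAt_const.mul (hid.inv₀ hx)) (mul_ne_zero (ht0 m) (inv_ne_zero hx))
      (norm_tz (ht1 m) (unit_inv (hg1 z))))
    have : ‖q * (t m * g z)‖ < 1 := by
      rw [norm_mul]
      exact mul_lt_one_of_nonneg_of_lt_one_left (norm_nonneg _) hq (norm_tz (ht1 m) (hg1 z)).le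
    exact this
  · have a1 : g z * (c z j : ℂ) ≠ 0 := mul_ne_zero hx (hz j)
    have a2 : g z * (c z j : ℂ)⁻¹ ≠ 0 := mul_ne_zero hx (inv_ne_zero (hz j))
    exact (cAt_th hq ((hid.mul (hzc j)).inv₀ a1) (inv_ne_zero a1)).mul
      (cAt_th hq ((hid.mul ((hzc j).inv₀ (hz j))).inv₀ a2) (inv_ne_zero a2))

lemma cAt_thF (hp : ‖p‖ < 1) {X : Type*} [TopologicalSpace X] {f : X → ℂ} {x : X} {u : ℂ} (hu : u ≠ 0)
    (hf : ContinuousAt f x) (h : f x ≠ 0) :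
    ContinuousAt (fun x => th p (u * f x) * th p (u * (f x)⁻¹)) x :=
  (cAt_th hp (continuousAt_const.mul hf) (mul_ne_zero hu h)).mul
    (cAt_th hp (continuousAt_const.mul (hf.inv₀ h)) (mul_ne_zero hu (inv_ne_zero h)))

lemma cont_Fz {n : ℕ} (hp : ‖p‖ < 1) {u : ℂ} (hu : u ≠ 0) :
    Continuous fun z : Tor n => Fz p u (fun i => (z i : ℂ)) := by
  rw [continuous_iff_continuousAt]
  intro z
  exact tendsto_finset_prod _ fun j _ => cAt_thF hp hu (cont_coord j).continuousAt (unit_ne (cnorm _))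

lemma cont_rst {n : ℕ} {κ : Type*} [Fintype κ] (hp : ‖p‖ < 1) (hq : ‖q‖ < 1) {t : κ → ℂ}
    (ht0 : ∀ m, t m ≠ 0) (ht1 : ∀ m, ‖t m‖ < 1) {u v : ℂ} (hu : u ≠ 0) (hv : v ≠ 0) (i : Fin n) :
    Continuous fun z : Tor n => rst p q t u v (fun i => (z i : ℂ)) i := by
  rw [continuous_iff_continuousAt]
  intro z
  have hz : ∀ i, (z i : ℂ) ≠ 0 := fun i => unit_ne (cnorm _)
  have hzc : ∀ j, ContinuousAt (fun z : Tor n => (z j : ℂ)) z := fun j => (cont_coord j).continuousAt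
  unfold rst Fe
  refine (((continuousAt_const.mul (tendsto_finset_prod _ fun j _ => cAt_thF hp hu (hzc j) (hz j))).mul
    (tendsto_finset_prod _ fun j _ => cAt_thF hp hv (hzc j) (hz j))).mul
    (tendsto_finset_prod _ fun ij _ => cAt_Dd hp hq (hzc _) (hzc _) (hz _) (hz _))).mul
    (tendsto_finset_prod _ fun j _ => (cAt_W0 hp hq (hzc j) (hz j)).mul
      (cAt_Gw hp hq (fun m => continuousAt_const) ht0 ht1 (hzc j) (cnorm _)))

lemma int_zero {n : ℕ} {κ : Type*} [Fintype κ] (hp : ‖p‖ < 1) (hq : ‖q‖ < 1) (hq0 : q ≠ 0) {t : κ → ℂ}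
    (ht0 : ∀ m, t m ≠ 0) (ht1 : ∀ m, ‖t m‖ < 1) {u v : ℂ} (hu : u ≠ 0) (hv : v ≠ 0) (i : Fin n) :
    ∫ z : Tor n, (hh p q t (fun i => (z i : ℂ)) i (z i) + hh p q t (fun i => (z i : ℂ)) i (z i)⁻¹) *
      rst p q t u v (fun i => (z i : ℂ)) i ∂(ν n) = 0 := by
  cases n with
  | zero => exact i.elim0
  | succ n =>
  refine integral_zero_coord i ?_ ?_
  · exact ((cont_hh hp hq hq0 ht0 ht1 i (cont_coord i) (fun _ => cnorm _) continuous_id).add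
      (cont_hh hp hq hq0 ht0 ht1 i (c := fun z => z) (g := fun z : Tor (n + 1) => (z i : ℂ)⁻¹)
        ((cont_coord i).inv₀ fun z => unit_ne (cnorm _)) (fun _ => unit_inv (cnorm _)) continuous_id)).mul
      (cont_rst hp hq ht0 ht1 hu hv i)
  intro w
  let z0 : Tor (n + 1) := i.insertNth 1 w
  have hag : ∀ x : Circle, ∀ j, j ≠ i → ((i.insertNth x w : Tor (n + 1)) j : ℂ) = (z0 j : ℂ) := by
    intro x j hj
    obtain ⟨k, rfl⟩ := Fin.exists_succAbove_eq hj
    simp [z0]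
  have e : ∀ x : Circle, (hh p q t (fun j => ((i.insertNth x w : Tor (n + 1)) j : ℂ)) i
      ((i.insertNth x w : Tor (n + 1)) i) +
      hh p q t (fun j => ((i.insertNth x w : Tor (n + 1)) j : ℂ)) i
      ((i.insertNth x w : Tor (n + 1)) i : ℂ)⁻¹) *
      rst p q t u v (fun j => ((i.insertNth x w : Tor (n + 1)) j : ℂ)) i =
      (hh p q t (fun j => (z0 j : ℂ)) i x + hh p q t (fun j => (z0 j : ℂ)) i (x : ℂ)⁻¹) *
      rst p q t u v (fun j => (z0 j : ℂ)) i := by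
    intro x
    rw [rst_congr t u v (hag x), hh_congr t (hag x), hh_congr t (hag x), Fin.insertNth_apply_same]
  simp_rw [e]
  rw [integral_mul_const]
  have hz : ∀ i, (z0 i : ℂ) ≠ 0 := fun i => unit_ne (cnorm _)
  have c1 : Continuous fun x : Circle => hh p q t (fun j => (z0 j : ℂ)) i x :=
    cont_hh hp hq hq0 ht0 ht1 i (c := fun _ => z0) continuous_subtype_val (fun _ => cnorm _) continuous_const
  have c2 : Continuous fun x : Circle => hh p q t (fun j => (z0 j : ℂ)) i (x : ℂ)⁻¹ :=
    cont_hh hp hq hq0 ht0 ht1 i (c := fun _ => z0) (g := fun x : Circle => (x : ℂ)⁻¹)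
      (continuous_subtype_val.inv₀ fun z : Circle => unit_ne (cnorm z))
      (fun _ => unit_inv (cnorm _)) continuous_const
  rw [integral_add (integrable_cont c1) (integrable_cont c2),
    integral_μ_Mi (f := hh p q t (fun j => (z0 j : ℂ)) i) c1.aestronglyMeasurable,
    integral_μ_Mi (f := fun x => hh p q t (fun j => (z0 j : ℂ)) i x⁻¹) c2.aestronglyMeasurable,
    Mi_inv, inv_one, hh_Mi hp hq hq0 ht0 ht1 hz]
  simp

lemma Gw_shift {κ : Type*} [Fintype κ] [DecidableEq κ] (hp : ‖p‖ < 1) (hq : ‖q‖ < 1) (hq0 : q ≠ 0) {t : κ → ℂ}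
    (ht0 : ∀ m, t m ≠ 0) (ht1 : ∀ m, ‖t m‖ < 1) (b : κ) {x : ℂ} (hx : ‖x‖ = 1) :
    Gw p q (Function.update t b (q * t b)) x = th p (t b * x) * th p (t b * x⁻¹) * Gw p q t x := by
  unfold Gw
  have hx0 := unit_ne hx
  rw [← Finset.mul_prod_erase Finset.univ _ (Finset.mem_univ b), ← Finset.mul_prod_erase Finset.univ
    (fun m => ellGamma (t m * x) p q * ellGamma (t m * x⁻¹) p q) (Finset.mem_univ b)]
  rw [Finset.prod_congr rfl fun m hm => by rw [Function.update_of_ne (Finset.ne_of_mem_erase hm)]]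
  rw [Function.update_self, mul_assoc q, mul_assoc q,
    gam_q hp hq hq0 (mul_ne_zero (ht0 b) hx0) (E2_ne_of_lt hp hq (norm_tz (ht1 b) hx)),
    gam_q hp hq hq0 (mul_ne_zero (ht0 b) (inv_ne_zero hx0)) (E2_ne_of_lt hp hq (norm_tz (ht1 b) (unit_inv hx)))]
  ring

lemma wI_shift {n : ℕ} {κ : Type*} [Fintype κ] [DecidableEq κ] (hp : ‖p‖ < 1) (hq : ‖q‖ < 1) (hq0 : q ≠ 0) {t : κ → ℂ}
    (ht0 : ∀ m, t m ≠ 0) (ht1 : ∀ m, ‖t m‖ < 1) (b : κ) {z : Fin n → ℂ} (hz : ∀ i, ‖z i‖ = 1) :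
    wI p q (Function.update t b (q * t b)) z = wI p q t z * Fz p (t b) z := by
  unfold wI Fz
  rw [mul_assoc, ← Finset.prod_mul_distrib]
  congr 1
  refine Finset.prod_congr rfl fun j _ => ?_
  rw [Gw_shift hp hq hq0 ht0 ht1 b (hz j)]
  ring

lemma KK_shift {κ : Type*} [Fintype κ] [LinearOrder κ] (hp : ‖p‖ < 1) (hq : ‖q‖ < 1) (hq0 : q ≠ 0) {t : κ → ℂ}
    (ht0 : ∀ m, t m ≠ 0) (ht1 : ∀ m, ‖t m‖ < 1) (b : κ) :
    KK p q (Function.update t b (q * t b)) = (∏ m ∈ Finset.univ.erase b, th p (t b * t m)) * KK p q t := by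
  unfold KK
  rw [prs_split (fun i j => ellGamma (Function.update t b (q * t b) i * Function.update t b (q * t b) j) p q)
    (fun i j _ => by rw [mul_comm]) b,
    prs_split (fun i j => ellGamma (t i * t j) p q) (fun i j _ => by rw [mul_comm]) b, ← mul_assoc,
    ← Finset.prod_mul_distrib]
  congr 1
  · refine Finset.prod_congr rfl fun m hm => ?_
    rw [Function.update_of_ne (Finset.ne_of_mem_erase hm), Function.update_self, mul_assoc,
      gam_q hp hq hq0 (mul_ne_zero (ht0 b) (ht0 m)) (E2_ne_of_lt hp hq ?_)]
    rw [norm_mul]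
    exact mul_lt_one_of_nonneg_of_lt_one_left (norm_nonneg _) (ht1 _) (ht1 _).le
  · refine Finset.prod_congr rfl fun m hm => ?_
    rw [Finset.mem_filter] at hm
    rw [Function.update_of_ne hm.2.1, Function.update_of_ne hm.2.2]

lemma int_add_sum {n : ℕ} {f : Tor n → ℂ} {g : Fin n → Tor n → ℂ} (hf : Continuous f)
    (hg : ∀ i, Continuous (g i)) (h : ∀ z, f z + ∑ i, g i z = 0) (h0 : ∀ i, ∫ z, g i z ∂(ν n) = 0) :
    ∫ z, f z ∂(ν n) = 0 := by
  have e : ∀ z, f z = - ∑ i, g i z := fun z => by linear_combination h z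
  simp_rw [e]
  rw [integral_neg, integral_finset_sum _ fun i _ => integrable_cont (hg i)]
  simp [h0]

lemma shift {n : ℕ} {κ : Type*} [Fintype κ] [LinearOrder κ] (hp : ‖p‖ < 1) (hq : ‖q‖ < 1)
    (hp0 : p ≠ 0) (hq0 : q ≠ 0)
    (hc : Fintype.card κ = 2 * n + 4)
    {t : κ → ℂ} (ht0 : ∀ m, t m ≠ 0) (ht1 : ∀ m, ‖t m‖ < 1) (hprod : ∏ m, t m = p)
    {a b : κ}
    (huu : th p (t a ^ 2) ≠ 0) (hvv : th p (t b ^ 2) ≠ 0) (huv : th p (t a * t b) ≠ 0)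
    (huv' : th p (t a * (t b)⁻¹) ≠ 0)
    (huz : ∀ z : ℂ, ‖z‖ = 1 → th p (t a * z) ≠ 0) (hvz : ∀ z : ℂ, ‖z‖ = 1 → th p (t b * z) ≠ 0) :
    KK p q (Function.update t a (q * t a)) * II n p q (Function.update t b (q * t b)) =
    KK p q (Function.update t b (q * t b)) * II n p q (Function.update t a (q * t a)) := by
  have cw := cont_wI (n := n) (p := p) (q := q) hp hq ht0 ht1
  have ca := cont_Fz (n := n) (p := p) hp (ht0 a)
  have cb := cont_Fz (n := n) (p := p) hp (ht0 b)
  have ch : ∀ i, Continuous fun z : Tor n => (hh p q t (fun i => (z i : ℂ)) i (z i) +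
      hh p q t (fun i => (z i : ℂ)) i (z i)⁻¹) * rst p q t (t a) (t b) (fun i => (z i : ℂ)) i := fun i =>
    ((cont_hh hp hq hq0 ht0 ht1 i (cont_coord i) (fun _ => cnorm _) continuous_id).add
      (cont_hh hp hq hq0 ht0 ht1 i (c := fun z => z) (g := fun z : Tor n => (z i : ℂ)⁻¹)
        ((cont_coord i).inv₀ fun z => unit_ne (cnorm _)) (fun _ => unit_inv (cnorm _)) continuous_id)).mul
      (cont_rst hp hq ht0 ht1 (ht0 a) (ht0 b) i)
  set A := ∏ m ∈ Finset.univ.erase a, th p (t a * t m) with hA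
  set B := ∏ m ∈ Finset.univ.erase b, th p (t b * t m) with hB
  have c1 : Continuous fun z : Tor n => wI p q t (fun i => (z i : ℂ)) * (t a * (A *
      Fz p (t b) (fun i => (z i : ℂ)) - B * Fz p (t a) (fun i => (z i : ℂ)))) :=
    cw.mul (continuous_const.mul ((continuous_const.mul cb).sub (continuous_const.mul ca)))
  have key := ext_gen (n := n) (c1.add (continuous_finset_sum Finset.univ fun i _ => ch i)) (fun z hz => by
    exact ptwise hp hq hp0 hq0 hc ht0 ht1 hprod rfl rfl huu hvv huv huv' huz hvz hz)
  have hintg := int_add_sum c1 ch key (fun i => int_zero hp hq hq0 ht0 ht1 (ht0 a) (ht0 b) i)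
  have e : ∀ z : Tor n, wI p q t (fun i => (z i : ℂ)) * (t a * (A *
      Fz p (t b) (fun i => (z i : ℂ)) - B * Fz p (t a) (fun i => (z i : ℂ)))) =
      t a * A * wI p q (Function.update t b (q * t b)) (fun i => (z i : ℂ)) -
      t a * B * wI p q (Function.update t a (q * t a)) (fun i => (z i : ℂ)) := by
    intro z
    rw [wI_shift hp hq hq0 ht0 ht1 b (fun i => cnorm _), wI_shift hp hq hq0 ht0 ht1 a (fun i => cnorm _)]
    ring
  simp_rw [e] at hintg
  have hup0 : ∀ c m, Function.update t c (q * t c) m ≠ 0 := by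
    intro c m
    by_cases h : m = c
    · subst h; simp [hq0, ht0]
    · simp [h, ht0]
  have hup1 : ∀ c m, ‖Function.update t c (q * t c) m‖ < 1 := by
    intro c m
    by_cases h : m = c
    · subst h
      simp only [Function.update_self, norm_mul]
      exact mul_lt_one_of_nonneg_of_lt_one_left (norm_nonneg _) hq (ht1 _).le
    · simp [h, ht1]
  rw [integral_sub ((integrable_cont (cont_wI hp hq (hup0 b) (hup1 b))).const_mul _)
    ((integrable_cont (cont_wI hp hq (hup0 a) (hup1 a))).const_mul _), integral_const_mul, integral_const_mul] at hintg
  rw [KK_shift hp hq hq0 ht0 ht1, KK_shift hp hq hq0 ht0 ht1, ← hA, ← hB]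
  have h2 : A * II n p q (Function.update t b (q * t b)) = B * II n p q (Function.update t a (q * t a)) := by
    refine mul_left_cancel₀ (ht0 a) ?_
    unfold II
    linear_combination hintg
  linear_combination KK p q t * h2

end ESI

namespace ESI

open Filter Topology Complex MeasureTheory

variable {p q : ℂ}

/-- open annulus -/
def Ann (ρ : ℝ) : Set ℂ := {x | ρ < ‖x‖ ∧ ‖x‖ < 1}

lemma Ann_open (ρ : ℝ) : IsOpen (Ann ρ) :=
  (isOpen_lt continuous_const continuous_norm).inter (isOpen_lt continuous_norm continuous_const)

lemma Ann_pre {ρ : ℝ} (h0 : 0 < ρ) : IsPreconnected (Ann ρ) := by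
  have e : Ann ρ = Set.image Complex.exp {w : ℂ | Real.log ρ < w.re ∧ w.re < 0} := by
    ext x
    simp only [Ann, Set.mem_setOf_eq, Set.mem_image]
    constructor
    · rintro ⟨h1, h2⟩
      have hx : x ≠ 0 := by rintro rfl; simp at h1; linarith
      refine ⟨Complex.log x, ?_, Complex.exp_log hx⟩
      rw [Complex.log_re]
      exact ⟨Real.log_lt_log h0 h1, Real.log_neg (norm_pos_iff.2 hx) h2⟩
    · rintro ⟨w, ⟨h1, h2⟩, rfl⟩
      rw [Complex.norm_exp]
      refine ⟨?_, by simpa using h2⟩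
      rwa [Real.log_lt_iff_lt_exp h0] at h1
  rw [e]
  refine IsPreconnected.image ?_ _ Complex.continuous_exp.continuousOn
  have : Convex ℝ {w : ℂ | Real.log ρ < w.re ∧ w.re < 0} :=
    (convex_halfSpace_re_gt _).inter (convex_halfSpace_re_lt _)
  exact this.isPreconnected

lemma Ann_nonempty {ρ : ℝ} (h0 : 0 ≤ ρ) (h1 : ρ < 1) : (Ann ρ).Nonempty := by
  refine ⟨(((ρ + 1) / 2 : ℝ) : ℂ), ?_⟩
  simp only [Ann, Set.mem_setOf_eq, Complex.norm_real, Real.norm_eq_abs]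
  rw [abs_of_nonneg (by linarith)]
  constructor <;> linarith

lemma ident_ann {f : ℂ → ℂ} {ρ ρ' : ℝ} (h0 : 0 < ρ) (h1 : ρ' < 1) (hle : ρ ≤ ρ')
    (hf : DifferentiableOn ℂ f (Ann ρ)) (hz : ∀ x ∈ Ann ρ', f x = 0) : ∀ x ∈ Ann ρ, f x = 0 := by
  obtain ⟨z, hz'⟩ := Ann_nonempty (h0.le.trans hle) h1
  have ha := hf.analyticOnNhd (Ann_open ρ)
  have := ha.eqOn_of_preconnected_of_eventuallyEq (g := fun _ => 0) analyticOnNhd_const (Ann_pre h0)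
    (z₀ := z) ⟨hle.trans_lt hz'.1, hz'.2⟩
    (by filter_upwards [(Ann_open ρ').mem_nhds hz'] with x hx using hz x hx)
  exact this

lemma const_ann {g : ℂ → ℂ} {ρ : ℝ} {q : ℂ} (h0 : 0 < ρ) (hρ : ρ < ‖q‖) (hq : ‖q‖ < 1)
    (hg : DifferentiableOn ℂ g (Ann ρ)) (hper : ∀ x, ρ < ‖q * x‖ → ‖x‖ < 1 → g (q * x) = g x) :
    ∃ C, ∀ x ∈ Ann ρ, g x = C := by
  have hq0 : 0 < ‖q‖ := h0.trans hρ
  have hqn : q ≠ 0 := norm_pos_iff.1 hq0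
  obtain ⟨s, hs1, hs2⟩ : ∃ s : ℝ, max (ρ / ‖q‖) ‖q‖ < s ∧ s < 1 :=
    exists_between (max_lt ((div_lt_one hq0).2 hρ) hq)
  have hs3 : ρ / ‖q‖ < s := (le_max_left _ _).trans_lt hs1
  have hs4 : ‖q‖ < s := (le_max_right _ _).trans_lt hs1
  have hs5 : ρ < s * ‖q‖ := by rwa [div_lt_iff₀ hq0] at hs3
  have hs0 : 0 < s := hq0.trans hs4
  have hs6 : s * ‖q‖ < s := by nlinarith
  let K : Set ℂ := {x | s * ‖q‖ ≤ ‖x‖ ∧ ‖x‖ ≤ s}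
  have hK : IsCompact K := by
    refine (isCompact_closedBall (0 : ℂ) s).of_isClosed_subset ?_ ?_
    · exact (isClosed_le continuous_const continuous_norm).inter (isClosed_le continuous_norm continuous_const)
    · intro x hx; simpa using hx.2
  have hKs : K ⊆ Ann ρ := fun x hx => ⟨hs5.trans_le hx.1, hx.2.trans_lt hs2⟩
  have hKn : K.Nonempty := ⟨(s : ℂ), by
    simp only [K, Set.mem_setOf_eq, Complex.norm_real, Real.norm_eq_abs, abs_of_pos hs0]
    exact ⟨hs6.le, le_rfl⟩⟩
  obtain ⟨x0, hx0, hmax⟩ := hK.exists_isMaxOn hKn ((hg.continuousOn.mono hKs).norm)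
  let ρ' := max ρ (s * ‖q‖ * ‖q‖)
  have hρ's : ρ' < s * ‖q‖ := max_lt hs5 (by nlinarith [mul_pos hs0 hq0])
  have hA : ∀ x ∈ Ann ρ', ‖g x‖ ≤ ‖g x0‖ := by
    intro x hx
    by_cases h1 : ‖x‖ < s * ‖q‖
    · have e : x = q * (q⁻¹ * x) := by field_simp
      have hn : ‖q⁻¹ * x‖ = ‖x‖ / ‖q‖ := by rw [norm_mul, norm_inv]; field_simp
      have hlt : ‖x‖ / ‖q‖ < s := by rwa [div_lt_iff₀ hq0]
      have hgt : s * ‖q‖ < ‖x‖ / ‖q‖ := by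
        rw [lt_div_iff₀ hq0]; exact (le_max_right _ _).trans_lt hx.1
      rw [e, hper _ (by rw [← e]; exact (le_max_left _ _).trans_lt hx.1) (by rw [hn]; linarith)]
      exact hmax (show q⁻¹ * x ∈ K from ⟨by rw [hn]; exact hgt.le, by rw [hn]; exact hlt.le⟩)
    · by_cases h2 : ‖x‖ ≤ s
      · exact hmax (show x ∈ K from ⟨not_lt.1 h1, h2⟩)
      · push Not at h1 h2
        have hn : ‖q * x‖ = ‖x‖ * ‖q‖ := by rw [norm_mul, mul_comm]
        have hgt : s * ‖q‖ < ‖x‖ * ‖q‖ := by gcongr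
        have hx1 := hx.2
        rw [← hper x (by rw [hn]; linarith) hx1]
        refine hmax (show q * x ∈ K from ⟨by rw [hn]; exact hgt.le, ?_⟩)
        rw [hn]; nlinarith
  have hsub : Ann ρ' ⊆ Ann ρ := fun x hx => ⟨(le_max_left _ _).trans_lt hx.1, hx.2⟩
  have h0' : 0 < ρ' := h0.trans_le (le_max_left _ _)
  have hx0' : x0 ∈ Ann ρ' := ⟨hρ's.trans_le hx0.1, hx0.2.trans_lt hs2⟩
  have hc := Complex.eqOn_of_isPreconnected_of_isMaxOn_norm (Ann_pre h0') (Ann_open ρ')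
    (hg.mono hsub) hx0' (fun x hx => hA x hx)
  refine ⟨g x0, fun x hx => ?_⟩
  have := ident_ann (f := fun x => g x - g x0) h0 (hρ's.trans (hs6.trans hs2)) (le_max_left _ _)
    (hg.sub_const _) (fun x hx => by rw [hc hx]; simp) x hx
  exact sub_eq_zero.1 this

/-- admissible parameters -/
structure Om {κ : Type*} [Fintype κ] (p q : ℂ) (t : κ → ℂ) : Prop where
  ne : ∀ m, t m ≠ 0
  lt : ∀ m, ‖t m‖ < 1
  pr : ∏ m, t m = p * q

section
variable {κ : Type*} [Fintype κ] [LinearOrder κ]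

lemma prod_two {t : κ → ℂ} {a l : κ} (h : a ≠ l) :
    ∏ m, t m = t a * t l * ∏ m ∈ (Finset.univ.erase a).erase l, t m := by
  rw [← Finset.mul_prod_erase Finset.univ _ (Finset.mem_univ a), ← Finset.mul_prod_erase (Finset.univ.erase a) _
    (show l ∈ Finset.univ.erase a by simp [h.symm]), mul_assoc]

lemma Om.two_gt {t : κ → ℂ} (ht : Om p q t) (hc : 3 ≤ Fintype.card κ) {a l : κ} (h : a ≠ l) :
    ‖p * q‖ < ‖t a * t l‖ := by
  rw [← ht.pr, prod_two h, norm_mul]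
  have hpos : 0 < ‖t a * t l‖ := norm_pos_iff.2 (mul_ne_zero (ht.ne _) (ht.ne _))
  have hne : ((Finset.univ.erase a).erase l : Finset κ).Nonempty := by
    rw [← Finset.card_pos, Finset.card_erase_of_mem (by simp [h.symm]), Finset.card_erase_of_mem (Finset.mem_univ _),
      Finset.card_univ]
    omega
  have : ‖∏ m ∈ (Finset.univ.erase a).erase l, t m‖ < 1 := by
    rw [norm_prod]
    calc _ < ∏ m ∈ (Finset.univ.erase a).erase l, (1 : ℝ) :=
        Finset.prod_lt_prod_of_nonempty (fun i _ => norm_pos_iff.2 (ht.ne i)) (fun i _ => ht.lt i) hne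
      _ = 1 := by simp
  nlinarith

lemma Om.KK_ne {t : κ → ℂ} (hp : ‖p‖ < 1) (hq : ‖q‖ < 1) (ht : Om p q t) (hc : 3 ≤ Fintype.card κ) :
    KK p q t ≠ 0 := by
  refine Finset.prod_ne_zero_iff.2 fun ij hij => ?_
  rw [Finset.mem_filter] at hij
  refine gam_ne hp hq ?_ (ht.two_gt hc hij.2.ne)
  rw [norm_mul]
  exact mul_lt_one_of_nonneg_of_lt_one_left (norm_nonneg _) (ht.lt _) (ht.lt _).le

/-- moving two parameters with fixed product -/
noncomputable def tx (t : κ → ℂ) (a l : κ) (x y : ℂ) : κ → ℂ := Function.update (Function.update t a x) l y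

lemma tx_a (t : κ → ℂ) {a l : κ} (h : a ≠ l) (x y : ℂ) : tx t a l x y a = x := by
  simp [tx, h]
lemma tx_l (t : κ → ℂ) (a l : κ) (x y : ℂ) : tx t a l x y l = y := by
  simp [tx]
lemma tx_o (t : κ → ℂ) {a l m : κ} (h : m ≠ a) (h' : m ≠ l) (x y : ℂ) : tx t a l x y m = t m := by
  simp [tx, h, h']

lemma tx_all (t : κ → ℂ) {a l : κ} (h : a ≠ l) (x y : ℂ) (P : ℂ → κ → Prop) (h1 : P x a) (h2 : P y l)
    (h3 : ∀ m, m ≠ a → m ≠ l → P (t m) m) (m : κ) : P (tx t a l x y m) m := by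
  by_cases hl : m = l
  · subst hl; rwa [tx_l]
  · by_cases ha : m = a
    · subst ha; rwa [tx_a t h]
    · rw [tx_o t ha hl]; exact h3 m ha hl

lemma tx_prod (t : κ → ℂ) {a l : κ} (h : a ≠ l) (x y : ℂ) :
    ∏ m, tx t a l x y m = x * y * ∏ m ∈ (Finset.univ.erase a).erase l, t m := by
  rw [prod_two h, tx_a t h, tx_l]
  congr 1
  refine Finset.prod_congr rfl fun m hm => ?_
  simp only [Finset.mem_erase] at hm
  exact tx_o t hm.2.1 hm.1 x y

lemma Om.tx {t : κ → ℂ} (ht : Om p q t) {a l : κ} (h : a ≠ l) {x : ℂ} (hx : x ∈ Ann ‖t a * t l‖) :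
    Om p q (tx t a l x (t a * t l / x)) := by
  have hc0 : t a * t l ≠ 0 := mul_ne_zero (ht.ne _) (ht.ne _)
  have hx0 : x ≠ 0 := by
    rintro rfl; have := hx.1; rw [norm_zero] at this; exact absurd this (norm_nonneg _).not_gt
  refine ⟨tx_all t h _ _ (fun y _ => y ≠ 0) hx0 (div_ne_zero hc0 hx0) fun m _ _ => ht.ne m,
    tx_all t h _ _ (fun y _ => ‖y‖ < 1) hx.2 ?_ fun m _ _ => ht.lt m, ?_⟩
  · rw [norm_div, div_lt_one (norm_pos_iff.2 hx0)]; exact hx.1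
  · rw [tx_prod t h, ← ht.pr, prod_two h]
    field_simp

lemma tx_self (t : κ → ℂ) {a l : κ} (h : a ≠ l) (ha : t a ≠ 0) : tx t a l (t a) (t a * t l / t a) = t := by
  have : t a * t l / t a = t l := by field_simp
  rw [this]
  unfold tx
  rw [Function.update_eq_self, Function.update_eq_self]

lemma tx_diff (t : κ → ℂ) {a l : κ} (h : a ≠ l) (c : ℂ) {x : ℂ} (hx : x ≠ 0) (m : κ) :
    DifferentiableAt ℂ (fun x => tx t a l x (c / x) m) x := by
  by_cases hl : m = l
  · subst hl; simp only [tx_l]; exact (differentiableAt_const c).div differentiableAt_fun_id hx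
  · by_cases ha : m = a
    · subst ha; simp only [tx_a t h]; exact differentiableAt_fun_id
    · simp only [tx_o t ha hl]; exact differentiableAt_const _

lemma Ann_ne {ρ : ℝ} (h : 0 ≤ ρ) {x : ℂ} (hx : x ∈ Ann ρ) : x ≠ 0 := by
  rintro rfl; have := hx.1; rw [norm_zero] at this; linarith

lemma tx_II_diff (hp : ‖p‖ < 1) (hq : ‖q‖ < 1) (n : ℕ) {t : κ → ℂ} (ht : Om p q t) {a l : κ} (h : a ≠ l) :
    DifferentiableOn ℂ (fun x => II n p q (tx t a l x (t a * t l / x))) (Ann ‖t a * t l‖) :=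
  II_diff hp hq (Ann_open _) (fun x hx m => tx_diff t h _ (Ann_ne (norm_nonneg _) hx) m)
    (fun x hx m => (ht.tx h hx).ne m) (fun x hx m => (ht.tx h hx).lt m)

lemma tx_KK_diff (hp : ‖p‖ < 1) (hq : ‖q‖ < 1) {t : κ → ℂ} (ht : Om p q t) {a l : κ} (h : a ≠ l) :
    DifferentiableOn ℂ (fun x => KK p q (tx t a l x (t a * t l / x))) (Ann ‖t a * t l‖) :=
  fun x hx => (KK_diff hp hq (fun m => tx_diff t h _ (Ann_ne (norm_nonneg _) hx) m)
    (fun m => (ht.tx h hx).ne m) (fun m => (ht.tx h hx).lt m)).differentiableWithinAt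
end

lemma th_ne_norm (hp : ‖p‖ < 1) {x : ℂ} (hx : x ≠ 0) (h : ∀ k : ℤ, ‖x‖ ≠ ‖p‖ ^ k) : th p x ≠ 0 :=
  th_ne hp hx fun k hk => h k (by rw [hk, norm_zpow])

lemma count_sq (w : ℝ) : {s : ℝ | s ^ 2 = w}.Countable := by
  refine (Set.Countable.insert √w (Set.countable_singleton (-√w))).mono ?_
  intro s hs
  simp only [Set.mem_setOf_eq] at hs
  have hw : 0 ≤ w := hs ▸ sq_nonneg s
  have : s ^ 2 = √w ^ 2 := by rw [hs, Real.sq_sqrt hw]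
  rcases sq_eq_sq_iff_eq_or_eq_neg.1 this with h | h <;> simp [h]

end ESI

namespace ESI

open Filter Topology Complex MeasureTheory

variable {p q : ℂ}

section
variable {κ : Type*} [Fintype κ] [LinearOrder κ]

lemma tx_upd_a (t : κ → ℂ) {a l : κ} (h : a ≠ l) (x y w : ℂ) :
    Function.update (tx t a l x y) a w = tx t a l w y := by
  unfold tx
  rw [Function.update_comm h.symm, Function.update_idem]

lemma tx_upd_l (t : κ → ℂ) {a l : κ} (x y w : ℂ) :
    Function.update (tx t a l x y) l w = tx t a l x w := by
  unfold tx
  rw [Function.update_idem]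

lemma per_gen {n : ℕ} (hp : ‖p‖ < 1) (hq : ‖q‖ < 1) (hp0 : p ≠ 0) (hq0 : q ≠ 0)
    (hc : Fintype.card κ = 2 * n + 4) {t : κ → ℂ} (ht : Om p q t) {a l : κ} (h : a ≠ l)
    (hcq : ‖t a * t l‖ < ‖q‖) {x : ℂ} (hx1 : ‖t a * t l‖ < ‖q * x‖) (hx2 : ‖x‖ < 1)
    (g1 : ∀ k : ℤ, ‖x‖ ^ 2 ≠ ‖p‖ ^ k) (g2 : ∀ k : ℤ, ‖x‖ ^ 2 ≠ (‖t a * t l‖ / ‖q‖) ^ 2 * ‖p‖ ^ k)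
    (g3 : ∀ k : ℤ, ‖x‖ ^ 2 ≠ ‖t a * t l‖ / ‖q‖ * ‖p‖ ^ k) :
    KK p q (tx t a l (q * x) (t a * t l / (q * x))) * II n p q (tx t a l x (t a * t l / x)) =
    KK p q (tx t a l x (t a * t l / x)) * II n p q (tx t a l (q * x) (t a * t l / (q * x))) := by
  have hqp : 0 < ‖q‖ := norm_pos_iff.2 hq0
  have hpp : 0 < ‖p‖ := norm_pos_iff.2 hp0
  have hc0 : t a * t l ≠ 0 := mul_ne_zero (ht.ne _) (ht.ne _)
  have hcg := ht.two_gt (by omega) h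
  generalize hcdef : t a * t l = c at *
  have hcp : 0 < ‖c‖ := norm_pos_iff.2 hc0
  have hx0 : x ≠ 0 := by
    rintro rfl; rw [mul_zero, norm_zero] at hx1; linarith
  have hxp : 0 < ‖x‖ := norm_pos_iff.2 hx0
  set v := c / (q * x) with hv
  have hv0 : v ≠ 0 := div_ne_zero hc0 (mul_ne_zero hq0 hx0)
  have hvn : ‖v‖ = ‖c‖ / ‖q‖ / ‖x‖ := by rw [hv, norm_div, norm_mul, div_div]
  have hv1 : ‖v‖ < 1 := by
    rw [hv, norm_div, div_lt_one (norm_pos_iff.2 (mul_ne_zero hq0 hx0))]; exact hx1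
  have gx : ∀ k : ℤ, ‖x‖ ≠ ‖p‖ ^ k := by
    intro k hk
    apply g1 (k * 2)
    rw [hk, zpow_mul]; norm_cast
  have gv2 : ∀ k : ℤ, ‖v‖ ^ 2 ≠ ‖p‖ ^ k := by
    intro k hk
    apply g2 (-k)
    rw [zpow_neg, ← hk, hvn]
    field_simp
  have gv : ∀ k : ℤ, ‖v‖ ≠ ‖p‖ ^ k := by
    intro k hk
    apply gv2 (k * 2)
    rw [hk, zpow_mul]; norm_cast
  have key := shift (n := n) hp hq hp0 hq0 hc (t := tx t a l x v) (a := a) (b := l)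
    (tx_all t h _ _ (fun y _ => y ≠ 0) hx0 hv0 fun m _ _ => ht.ne m)
    (tx_all t h _ _ (fun y _ => ‖y‖ < 1) hx2 hv1 fun m _ _ => ht.lt m) ?_ ?_ ?_ ?_ ?_ ?_ ?_
  · rw [tx_upd_a t h, tx_upd_l, tx_a t h, tx_l] at key
    have e : q * v = c / x := by rw [hv]; field_simp
    rw [e] at key
    exact key
  · rw [tx_prod t h]
    have := ht.pr
    rw [prod_two h, hcdef] at this
    have e : x * v = c / q := by rw [hv]; field_simp
    rw [e]
    field_simp
    linear_combination this
  · rw [tx_a t h]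
    refine th_ne_norm hp (pow_ne_zero 2 hx0) ?_
    rw [norm_pow]; exact g1
  · rw [tx_l]
    refine th_ne_norm hp (pow_ne_zero 2 hv0) ?_
    rw [norm_pow]; exact gv2
  · rw [tx_a t h, tx_l]
    have e : x * v = c / q := by rw [hv]; field_simp
    rw [e]
    refine th_ne_of hp ?_ ?_
    · rw [norm_div, lt_div_iff₀ hqp, ← norm_mul]; exact hcg
    · rw [norm_div, div_lt_one hqp]; exact hcq
  · rw [tx_a t h, tx_l]
    refine th_ne_norm hp (mul_ne_zero hx0 (inv_ne_zero hv0)) fun k hk => g3 k ?_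
    rw [norm_mul, norm_inv, hvn] at hk
    rw [← hk]
    field_simp
  · intro z hz
    rw [tx_a t h]
    refine th_ne_norm hp (mul_ne_zero hx0 (unit_ne hz)) ?_
    rw [norm_mul, hz, mul_one]; exact gx
  · intro z hz
    rw [tx_l]
    refine th_ne_norm hp (mul_ne_zero hv0 (unit_ne hz)) ?_
    rw [norm_mul, hz, mul_one]; exact gv

lemma per {n : ℕ} (hp : ‖p‖ < 1) (hq : ‖q‖ < 1) (hp0 : p ≠ 0) (hq0 : q ≠ 0)
    (hc : Fintype.card κ = 2 * n + 4) {t : κ → ℂ} (ht : Om p q t) {a l : κ} (h : a ≠ l)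
    (hcq : ‖t a * t l‖ < ‖q‖) {x : ℂ} (hx1 : ‖t a * t l‖ < ‖q * x‖) (hx2 : ‖x‖ < 1) :
    KK p q (tx t a l (q * x) (t a * t l / (q * x))) * II n p q (tx t a l x (t a * t l / x)) -
    KK p q (tx t a l x (t a * t l / x)) * II n p q (tx t a l (q * x) (t a * t l / (q * x))) = 0 := by
  have hx0 : x ≠ 0 := by
    rintro rfl; rw [mul_zero, norm_zero] at hx1; exact absurd hx1 (norm_nonneg _).not_gt
  have hxp : 0 < ‖x‖ := norm_pos_iff.2 hx0
  have hqp : 0 < ‖q‖ := norm_pos_iff.2 hq0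
  let G : ℂ → ℂ := fun x => KK p q (tx t a l (q * x) (t a * t l / (q * x))) * II n p q (tx t a l x (t a * t l / x)) -
    KK p q (tx t a l x (t a * t l / x)) * II n p q (tx t a l (q * x) (t a * t l / (q * x)))
  have hmem : x ∈ Ann ‖t a * t l‖ := ⟨by rw [norm_mul q x] at hx1; nlinarith, hx2⟩
  have hmemq : q * x ∈ Ann ‖t a * t l‖ := ⟨hx1, by rw [norm_mul]; nlinarith⟩
  have hI := ((tx_II_diff hp hq n ht h).differentiableAt ((Ann_open _).mem_nhds hmem)).continuousAt
  have hK := ((tx_KK_diff hp hq ht h).differentiableAt ((Ann_open _).mem_nhds hmem)).continuousAt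
  have hIq := ((tx_II_diff hp hq n ht h).differentiableAt ((Ann_open _).mem_nhds hmemq)).continuousAt
  have hKq := ((tx_KK_diff hp hq ht h).differentiableAt ((Ann_open _).mem_nhds hmemq)).continuousAt
  have hmulq : ContinuousAt (fun x : ℂ => q * x) x := by fun_prop
  have hIq' := ContinuousAt.comp (f := fun x : ℂ => q * x) (x := x) hIq hmulq
  have hKq' := ContinuousAt.comp (f := fun x : ℂ => q * x) (x := x) hKq hmulq
  have hG : ContinuousAt G x := (hKq'.mul hI).sub (hK.mul hIq')
  have hs : ContinuousAt (fun s : ℝ => (s : ℂ) * x) 1 := by fun_prop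
  have hs1 : Tendsto (fun s : ℝ => (s : ℂ) * x) (𝓝 1) (𝓝 x) := by
    have := hs.tendsto; simpa using this
  let bad : Set ℝ := ((⋃ k : ℤ, {s : ℝ | s ^ 2 = ‖p‖ ^ k / ‖x‖ ^ 2}) ∪
    (⋃ k : ℤ, {s : ℝ | s ^ 2 = (‖t a * t l‖ / ‖q‖) ^ 2 * ‖p‖ ^ k / ‖x‖ ^ 2})) ∪
    (⋃ k : ℤ, {s : ℝ | s ^ 2 = (‖t a * t l‖ / ‖q‖) * ‖p‖ ^ k / ‖x‖ ^ 2})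
  have hbad : bad.Countable := ((Set.countable_iUnion fun k => count_sq _).union
    (Set.countable_iUnion fun k => count_sq _)).union (Set.countable_iUnion fun k => count_sq _)
  have hd : Dense badᶜ := hbad.dense_compl ℝ
  have hfreq : ∃ᶠ s : ℝ in 𝓝 (1 : ℝ), s ∈ badᶜ := mem_closure_iff_frequently.1 (hd 1)
  have hev : ∀ᶠ s : ℝ in 𝓝 (1 : ℝ), ‖t a * t l‖ < ‖q * ((s : ℂ) * x)‖ ∧ ‖(s : ℂ) * x‖ < 1 := by
    refine hs1.eventually (p := fun y => ‖t a * t l‖ < ‖q * y‖ ∧ ‖y‖ < 1) ?_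
    have c1 : Continuous fun y : ℂ => ‖q * y‖ := by fun_prop
    exact (c1.tendsto x |>.eventually_const_lt hx1).and ((continuous_norm.tendsto x).eventually_lt_const hx2)
  have hz : ∃ᶠ s : ℝ in 𝓝 (1 : ℝ), G ((s : ℂ) * x) ∈ ({0} : Set ℂ) := by
    refine (hfreq.and_eventually hev).mono ?_
    rintro s ⟨hs, h1, h2⟩
    simp only [bad, Set.mem_compl_iff, Set.mem_union, Set.mem_iUnion, Set.mem_setOf_eq, not_or, not_exists] at hs
    have hn : ‖(s : ℂ) * x‖ ^ 2 = s ^ 2 * ‖x‖ ^ 2 := by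
      rw [norm_mul, mul_pow, Complex.norm_real, Real.norm_eq_abs, sq_abs]
    have hx2 : ‖x‖ ^ 2 ≠ 0 := by positivity
    refine sub_eq_zero.2 (per_gen hp hq hp0 hq0 hc ht h hcq h1 h2 ?_ ?_ ?_)
    · intro k; rw [hn, ne_eq, ← eq_div_iff hx2]; exact hs.1.1 k
    · intro k; rw [hn, ne_eq, ← eq_div_iff hx2]; exact hs.1.2 k
    · intro k; rw [hn, ne_eq, ← eq_div_iff hx2]; exact hs.2 k
  have := isClosed_singleton.mem_of_frequently_of_tendsto hz (hG.tendsto.comp hs1)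
  exact this

lemma const_x {n : ℕ} (hp : ‖p‖ < 1) (hq : ‖q‖ < 1) (hp0 : p ≠ 0) (hq0 : q ≠ 0)
    (hc : Fintype.card κ = 2 * n + 4) {t : κ → ℂ} (ht : Om p q t) {a l : κ} (h : a ≠ l)
    (hcq : ‖t a * t l‖ < ‖q‖) {x : ℂ} (hx : x ∈ Ann ‖t a * t l‖) :
    II n p q (tx t a l x (t a * t l / x)) / KK p q (tx t a l x (t a * t l / x)) = II n p q t / KK p q t := by
  have hqp : 0 < ‖q‖ := norm_pos_iff.2 hq0
  have hc0 : t a * t l ≠ 0 := mul_ne_zero (ht.ne _) (ht.ne _)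
  have hcp : 0 < ‖t a * t l‖ := norm_pos_iff.2 hc0
  have hKne : ∀ x ∈ Ann ‖t a * t l‖, KK p q (tx t a l x (t a * t l / x)) ≠ 0 :=
    fun x hx => (ht.tx h hx).KK_ne hp hq (by omega)
  obtain ⟨C, hC⟩ := const_ann (q := q)
    (g := fun x => II n p q (tx t a l x (t a * t l / x)) / KK p q (tx t a l x (t a * t l / x)))
    hcp hcq hq ((tx_II_diff hp hq n ht h).div (tx_KK_diff hp hq ht h) hKne) (by
      intro x h1 h2
      have := per (n := n) hp hq hp0 hq0 hc ht h hcq h1 h2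
      rw [div_eq_div_iff (hKne _ ⟨h1, by rw [norm_mul]; nlinarith [norm_nonneg x]⟩)
        (hKne _ ⟨by rw [norm_mul q x] at h1; nlinarith [norm_nonneg x], h2⟩)]
      linear_combination -this)
  have hta : t a ∈ Ann ‖t a * t l‖ := by
    refine ⟨?_, ht.lt a⟩
    rw [norm_mul]
    have := norm_pos_iff.2 (ht.ne a)
    have := ht.lt l
    nlinarith
  have h1 := hC x hx
  have h2 := hC _ hta
  beta_reduce at h1 h2
  rw [tx_self t h (ht.ne a)] at h2
  rw [h1, h2]

lemma Om.last {t : κ → ℂ} (ht : Om p q t) (l : κ) :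
    t l = p * q / ∏ m ∈ Finset.univ.erase l, t m := by
  have h0 : ∏ m ∈ Finset.univ.erase l, t m ≠ 0 := Finset.prod_ne_zero_iff.2 fun m _ => ht.ne m
  rw [eq_div_iff h0, ← ht.pr, ← Finset.mul_prod_erase Finset.univ t (Finset.mem_univ l)]

lemma const_r {n : ℕ} (hp : ‖p‖ < 1) (hq : ‖q‖ < 1) (hp0 : p ≠ 0) (hq0 : q ≠ 0)
    (hc : Fintype.card κ = 2 * n + 4) {l : κ} {r : ℝ} (hr0 : 0 < r) (hr : ‖p‖ ≤ r ^ (2 * n + 2))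
    (hrq : ‖p * q‖ ≤ r ^ (2 * n + 3))
    {t' : κ → ℂ} (ht' : Om p q t') (hr' : ∀ m, m ≠ l → r < ‖t' m‖) (S : Finset κ) :
    ∀ t : κ → ℂ, Om p q t → (∀ m, m ≠ l → r < ‖t m‖) → (∀ m, m ∉ S → m ≠ l → t m = t' m) →
      II n p q t / KK p q t = II n p q t' / KK p q t' := by
  induction S using Finset.induction_on with
  | empty =>
    intro t ht _ h
    have : t = t' := by
      funext m
      by_cases hm : m = l
      · subst hm
        rw [ht.last m, ht'.last m, Finset.prod_congr rfl fun k hk => h k (by simp) (Finset.ne_of_mem_erase hk)]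
      · exact h m (by simp) hm
    rw [this]
  | insert a S ha ih =>
    intro t ht htr h
    by_cases hal : a = l
    · subst hal
      refine ih t ht htr fun m hm hma => h m ?_ hma
      simp [hm, hma]
    · have hcard : ((Finset.univ.erase a).erase l : Finset κ).card = 2 * n + 2 := by
        rw [Finset.card_erase_of_mem (by simp [Ne.symm hal]), Finset.card_erase_of_mem (Finset.mem_univ _),
          Finset.card_univ, hc]
        omega
      have hP : r ^ (2 * n + 2) < ‖∏ m ∈ (Finset.univ.erase a).erase l, t m‖ := by
        rw [norm_prod, ← hcard, ← Finset.prod_const]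
        refine Finset.prod_lt_prod_of_nonempty (fun _ _ => hr0) (fun m hm => htr m (Finset.ne_of_mem_erase hm)) ?_
        rw [← Finset.card_pos, hcard]; omega
      have hpq : ‖t a * t l‖ * ‖∏ m ∈ (Finset.univ.erase a).erase l, t m‖ = ‖p * q‖ := by
        rw [← norm_mul, ← prod_two hal, ht.pr]
      have hqp : 0 < ‖q‖ := norm_pos_iff.2 hq0
      have hcp : 0 < ‖t a * t l‖ := norm_pos_iff.2 (mul_ne_zero (ht.ne _) (ht.ne _))
      have hcq : ‖t a * t l‖ < ‖q‖ := by
        rw [norm_mul p q] at hpq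
        by_contra hcon
        push Not at hcon
        have h1 : ‖q‖ * ‖∏ m ∈ (Finset.univ.erase a).erase l, t m‖ ≤ ‖p‖ * ‖q‖ := by
          rw [← hpq]; gcongr
        nlinarith
      have hx : t' a ∈ Ann ‖t a * t l‖ := by
        refine ⟨?_, ht'.lt a⟩
        refine lt_of_le_of_lt ?_ (hr' a hal)
        by_contra hcon
        push Not at hcon
        have : r ^ (2 * n + 3) < ‖p * q‖ := by
          rw [← hpq, pow_succ']
          have : 0 < r ^ (2 * n + 2) := by positivity
          nlinarith
        linarith
      rw [← const_x hp hq hp0 hq0 hc ht hal hcq hx]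
      refine ih _ (ht.tx hal hx) ?_ ?_
      · intro m hm
        by_cases hma : m = a
        · subst hma; rw [tx_a t hal]; exact hr' m hm
        · rw [tx_o t hma hm]; exact htr m hm
      · intro m hm hml
        by_cases hma : m = a
        · subst hma; rw [tx_a t hal]
        · rw [tx_o t hma hml]; exact h m (by simp [hm, hma]) hml

lemma const_all {n : ℕ} (hp : ‖p‖ < 1) (hq : ‖q‖ < 1) {l : κ} {r : ℝ} (hr1 : r < 1) {C : ℂ}
    (hC : ∀ t : κ → ℂ, Om p q t → (∀ m, m ≠ l → r < ‖t m‖) → II n p q t = C * KK p q t)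
    (S : Finset κ) : ∀ t : κ → ℂ, Om p q t → (∀ m, m ∉ S → m ≠ l → r < ‖t m‖) → II n p q t = C * KK p q t := by
  induction S using Finset.induction_on with
  | empty => intro t ht h; exact hC t ht fun m hm => h m (by simp) hm
  | insert a S ha ih =>
    intro t ht h
    by_cases hal : a = l
    · subst hal
      refine ih t ht fun m hm hma => h m ?_ hma
      simp [hm, hma]
    · have hcp : 0 < ‖t a * t l‖ := norm_pos_iff.2 (mul_ne_zero (ht.ne _) (ht.ne _))
      have hta : t a ∈ Ann ‖t a * t l‖ := by
        refine ⟨?_, ht.lt a⟩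
        rw [norm_mul]
        have := norm_pos_iff.2 (ht.ne a)
        have := ht.lt l
        nlinarith
      have := ident_ann (ρ' := max r ‖t a * t l‖) (f := fun x => II n p q (tx t a l x (t a * t l / x)) -
        C * KK p q (tx t a l x (t a * t l / x))) hcp (max_lt hr1 (hta.1.trans hta.2)) (le_max_right _ _)
        ((tx_II_diff hp hq n ht hal).sub ((tx_KK_diff hp hq ht hal).const_mul C)) (by
          intro x hx
          have hx' : x ∈ Ann ‖t a * t l‖ := ⟨(le_max_right _ _).trans_lt hx.1, hx.2⟩
          refine sub_eq_zero.2 (ih _ (ht.tx hal hx') fun m hm hml => ?_)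
          by_cases hma : m = a
          · subst hma; rw [tx_a t hal]; exact (le_max_left _ _).trans_lt hx.1
          · rw [tx_o t hma hml]; exact h m (by simp [hm, hma]) hml) (t a) hta
      simp only [tx_self t hal (ht.ne a)] at this
      exact sub_eq_zero.1 this

end

theorem typeI (n : ℕ) (hp : ‖p‖ < 1) (hq : ‖q‖ < 1) (hp0 : p ≠ 0) (hq0 : q ≠ 0) :
    ∃ C : ℂ, ∀ t : Fin (2 * n + 4) → ℂ, Om p q t → II n p q t = C * KK p q t := by
  have hpp : 0 < ‖p‖ := norm_pos_iff.2 hp0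
  have hqp : 0 < ‖q‖ := norm_pos_iff.2 hq0
  have hM : max ‖p‖ ‖p * q‖ < 1 := max_lt hp (pq_lt hp hq)
  have hM0 : 0 < max ‖p‖ ‖p * q‖ := lt_max_of_lt_left hpp
  obtain ⟨r, hr0, hr1, hr2⟩ : ∃ r : ℝ, 0 < r ∧ r < 1 ∧ max ‖p‖ ‖p * q‖ < r ^ (2 * n + 3) := by
    have : Tendsto (fun r : ℝ => r ^ (2 * n + 3)) (𝓝[<] 1) (𝓝 1) := by
      have : Continuous fun r : ℝ => r ^ (2 * n + 3) := by fun_prop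
      have h := this.tendsto 1
      rw [one_pow] at h
      exact h.mono_left nhdsWithin_le_nhds
    have h1 := this.eventually_const_lt hM
    have h2 : ∀ᶠ r : ℝ in 𝓝[<] 1, r < 1 := eventually_mem_nhdsWithin
    have h3 : ∀ᶠ r : ℝ in 𝓝[<] 1, 0 < r :=
      (eventually_gt_nhds (zero_lt_one)).filter_mono nhdsWithin_le_nhds
    obtain ⟨r, a, b, c⟩ := (h1.and (h2.and h3)).exists
    exact ⟨r, c, b, a⟩
  obtain ⟨s, hs1, hs2⟩ := exists_between hr1
  let l : Fin (2 * n + 4) := Fin.last _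
  have hs0 : 0 < s := hr0.trans hs1
  let t' : Fin (2 * n + 4) → ℂ := Function.update (fun _ => (s : ℂ)) l (p * q / s ^ (2 * n + 3))
  have hsc : (s : ℂ) ≠ 0 := by exact_mod_cast hs0.ne'
  have hsn : ‖(s : ℂ)‖ = s := by rw [Complex.norm_real, Real.norm_eq_abs, abs_of_pos hs0]
  have ht'o : ∀ m, m ≠ l → t' m = s := fun m hm => by simp [t', hm]
  have ht'l : t' l = p * q / s ^ (2 * n + 3) := by simp [t']
  have hrs : r ^ (2 * n + 3) ≤ s ^ (2 * n + 3) := by gcongr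
  have ht' : Om p q t' := by
    refine ⟨fun m => ?_, fun m => ?_, ?_⟩
    · by_cases hm : m = l
      · rw [hm, ht'l]; exact div_ne_zero (mul_ne_zero hp0 hq0) (pow_ne_zero _ hsc)
      · rw [ht'o m hm]; exact hsc
    · by_cases hm : m = l
      · rw [hm, ht'l, norm_div, norm_pow, hsn, div_lt_one (by positivity)]
        exact ((le_max_right _ _).trans_lt hr2).trans_le hrs
      · rw [ht'o m hm, hsn]; exact hs2
    · rw [← Finset.mul_prod_erase Finset.univ t' (Finset.mem_univ l),
        Finset.prod_congr rfl fun m hm => ht'o m (Finset.ne_of_mem_erase hm), Finset.prod_const,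
        Finset.card_erase_of_mem (Finset.mem_univ _), Finset.card_univ, Fintype.card_fin, ht'l]
      have : 2 * n + 4 - 1 = 2 * n + 3 := by omega
      rw [this]
      field_simp
  refine ⟨II n p q t' / KK p q t', fun t ht => ?_⟩
  refine const_all (l := l) hp hq hr1 ?_ Finset.univ t ht (by simp)
  intro t ht htr
  have hr3 : r ^ (2 * n + 3) ≤ r ^ (2 * n + 2) := pow_le_pow_of_le_one hr0.le hr1.le (by omega)
  have := const_r (n := n) hp hq hp0 hq0 (by simp) hr0 (((le_max_left _ _).trans hr2.le).trans hr3)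
    ((le_max_right _ _).trans hr2.le) ht' (fun m hm => by rw [ht'o m hm, hsn]; exact hs1) Finset.univ t ht htr (by simp)
  rw [← this, div_mul_cancel₀ _ (ht.KK_ne hp hq (by simp))]

end ESI

namespace ESI

open Filter Topology Complex MeasureTheory

variable {p q : ℂ}

/-- Poisson kernel -/
noncomputable def Ph (ζ : Circle) (τ : ℝ) (z : Circle) : ℝ := (1 - τ ^ 2) / ‖(z : ℂ) - τ * ζ‖ ^ 2

lemma Ph_den {ζ z : Circle} {τ : ℝ} (h0 : 0 < τ) (h1 : τ < 1) : 0 < ‖(z : ℂ) - τ * ζ‖ := by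
  have := norm_sub_norm_le (z : ℂ) (τ * ζ)
  rw [norm_mul, cnorm, cnorm, mul_one, Complex.norm_real, Real.norm_eq_abs, abs_of_pos h0] at this
  linarith

lemma Ph_cont {ζ : Circle} {τ : ℝ} (h0 : 0 < τ) (h1 : τ < 1) : Continuous (Ph ζ τ) := by
  unfold Ph
  refine Continuous.div continuous_const ?_ fun z => (pow_pos (Ph_den h0 h1) 2).ne'
  have := continuous_subtype_val (p := fun z : ℂ => z ∈ Submonoid.unitSphere ℂ)
  exact ((this.sub continuous_const).norm).pow 2

lemma Ph_nonneg {ζ z : Circle} {τ : ℝ} (h0 : 0 < τ) (h1 : τ < 1) : 0 ≤ Ph ζ τ z := by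
  unfold Ph
  refine div_nonneg ?_ (by positivity)
  nlinarith

lemma Ph_int {ζ : Circle} {τ : ℝ} (h0 : 0 < τ) (h1 : τ < 1) : ∫ z, Ph ζ τ z ∂μ = 1 := by
  have hc := Ph_cont (ζ := ζ) h0 h1
  have hcc : Continuous fun z : Circle => ((Ph ζ τ z : ℝ) : ℂ) := Complex.continuous_ofReal.comp hc
  have hP : DiffContOnCl ℂ (fun _ : ℂ => (1 : ℂ)) (Metric.ball 0 1) := diffContOnCl_const
  have h := hP.circleAverage_poissonKernel_smul' (w := τ * ζ) (by
    rw [mem_ball_zero_iff, norm_mul, cnorm, mul_one, Complex.norm_real, Real.norm_eq_abs, abs_of_pos h0]; exact h1)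
  have e : ((∫ z, Ph ζ τ z ∂μ : ℝ) : ℂ) = 1 := by
    rw [← integral_complex_ofReal, integral_μ hcc.aestronglyMeasurable]
    rw [Real.circleAverage, Complex.real_smul] at h
    push_cast at h
    rw [← h]
    congr 1
    refine intervalIntegral.integral_congr fun θ _ => ?_
    simp only [Ph, sub_zero, Complex.real_smul, mul_one]
    have e1 : (Circle.exp θ : ℂ) = circleMap 0 1 θ := by simp [circleMap_zero, Circle.coe_exp]
    have e2 : ‖circleMap 0 1 θ‖ = 1 := by simp
    rw [e1, e2, norm_mul, cnorm, mul_one, Complex.norm_real, Real.norm_eq_abs, sq_abs, one_pow]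
  exact_mod_cast e

lemma Ph_tendsto (ζ : Circle) {g : Circle → ℂ} (hg : Continuous g) :
    Tendsto (fun τ => ∫ z, Ph ζ τ z • g z ∂μ) (𝓝[<] 1) (𝓝 (g ζ)) := by
  have e01 : ∀ᶠ τ : ℝ in 𝓝[<] 1, 0 < τ ∧ τ < 1 := by
    refine ((eventually_gt_nhds (zero_lt_one)).filter_mono nhdsWithin_le_nhds).and eventually_mem_nhdsWithin
  have := tendsto_setIntegral_peak_smul_of_integrableOn_of_tendsto (μ := μ) (s := Set.univ) (t := Set.univ)
    (x₀ := ζ) (φ := Ph ζ) (l := 𝓝[<] 1) (g := g) (a := g ζ) MeasurableSet.univ MeasurableSet.univ subset_rfl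
    univ_mem (measure_ne_top _ _) ?_ ?_ ?_ ?_ ?_ ?_
  · simpa using this
  · filter_upwards [e01] with τ h x _ using Ph_nonneg h.1 h.2
  · intro u hu hζ
    obtain ⟨δ, hδ, hb⟩ := Metric.isOpen_iff.1 hu ζ hζ
    rw [Metric.tendstoUniformlyOn_iff]
    intro ε hε
    have h1 : ∀ᶠ τ : ℝ in 𝓝[<] 1, 1 - τ < δ / 2 := by
      filter_upwards [(eventually_gt_nhds (show 1 - δ / 2 < (1 : ℝ) by linarith)).filter_mono nhdsWithin_le_nhds]
        with τ h using by linarith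
    have h2 : ∀ᶠ τ : ℝ in 𝓝[<] 1, (1 - τ ^ 2) / (δ / 2) ^ 2 < ε := by
      have : Tendsto (fun τ : ℝ => (1 - τ ^ 2) / (δ / 2) ^ 2) (𝓝 1) (𝓝 ((1 - 1 ^ 2) / (δ / 2) ^ 2)) := by
        have : Continuous (fun τ : ℝ => (1 - τ ^ 2) / (δ / 2) ^ 2) := by fun_prop
        exact this.tendsto 1
      norm_num at this
      exact (this.mono_left nhdsWithin_le_nhds).eventually_lt_const hε
    filter_upwards [e01, h1, h2] with τ h h1 h2 z hz
    have hz' : δ ≤ ‖(z : ℂ) - ζ‖ := by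
      by_contra hcon
      push Not at hcon
      refine hz.2 (hb ?_)
      rw [Metric.mem_ball]
      change dist (z : ℂ) (ζ : ℂ) < δ
      rw [dist_eq_norm]
      exact hcon
    have h3 : δ / 2 ≤ ‖(z : ℂ) - τ * ζ‖ := by
      have e : (z : ℂ) - ζ = (z - τ * ζ) + (τ - 1) * ζ := by ring
      have := norm_add_le ((z : ℂ) - τ * ζ) ((τ - 1) * ζ)
      rw [← e, norm_mul, cnorm, mul_one] at this
      have e2 : ‖(τ : ℂ) - 1‖ = 1 - τ := by
        rw [show (τ : ℂ) - 1 = ((τ - 1 : ℝ) : ℂ) by push_cast; ring, Complex.norm_real, Real.norm_eq_abs,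
          abs_of_neg (by linarith)]
        ring
      linarith
    simp only [Pi.zero_apply, dist_zero_left, Real.norm_eq_abs]
    rw [abs_of_nonneg (Ph_nonneg h.1 h.2)]
    refine lt_of_le_of_lt ?_ h2
    unfold Ph
    have : 0 ≤ 1 - τ ^ 2 := by nlinarith
    gcongr
  · refine tendsto_const_nhds.congr' ?_
    filter_upwards [e01] with τ h
    rw [Measure.restrict_univ, Ph_int h.1 h.2]
  · filter_upwards [e01] with τ h
    exact (Ph_cont h.1 h.2).aestronglyMeasurable
  · exact (integrable_cont hg).integrableOn
  · rw [nhdsWithin_univ]; exact hg.tendsto ζ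

lemma unif_small {X : Type*} [TopologicalSpace X] [CompactSpace X] {F : ℝ × X → ℂ}
    (hF : ∀ z, ContinuousAt F (1, z)) {ε : ℝ} (hε : 0 < ε) :
    ∀ᶠ τ in 𝓝 (1 : ℝ), ∀ z, ‖F (τ, z) - F (1, z)‖ < ε := by
  have hc : Continuous fun z => F (1, z) := by
    rw [continuous_iff_continuousAt]
    intro z
    exact ContinuousAt.comp (g := F) (f := fun z => ((1 : ℝ), z)) (hF z) (by fun_prop)
  have := (isCompact_univ (X := X)).eventually_forall_of_forall_eventually (x₀ := (1 : ℝ))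
    (P := fun τ z => ‖F (τ, z) - F (1, z)‖ < ε) (by
      intro z _
      have h1 : ContinuousAt (fun y : ℝ × X => ‖F y - F (1, y.2)‖) (1, z) :=
        ((hF z).sub (ContinuousAt.comp (g := fun z => F (1, z)) (f := Prod.snd) hc.continuousAt
          continuous_snd.continuousAt)).norm
      exact h1.tendsto.eventually_lt_const (by simpa using hε))
  filter_upwards [this] with τ h z using h z (Set.mem_univ _)

lemma Ph_tendsto' (ζ : Circle) {F : ℝ × Circle → ℂ} (hF : ∀ z, ContinuousAt F (1, z))
    (hc : ∀ᶠ τ in 𝓝[<] (1 : ℝ), Continuous fun z => F (τ, z)) :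
    Tendsto (fun τ => ∫ z, Ph ζ τ z • F (τ, z) ∂μ) (𝓝[<] 1) (𝓝 (F (1, ζ))) := by
  have hc1 : Continuous fun z => F (1, z) := by
    rw [continuous_iff_continuousAt]
    intro z
    exact ContinuousAt.comp (g := F) (f := fun z => ((1 : ℝ), z)) (hF z) (by fun_prop)
  have e01 : ∀ᶠ τ : ℝ in 𝓝[<] 1, 0 < τ ∧ τ < 1 := by
    refine ((eventually_gt_nhds (zero_lt_one)).filter_mono nhdsWithin_le_nhds).and eventually_mem_nhdsWithin
  have h1 := Ph_tendsto ζ hc1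
  have h2 : Tendsto (fun τ => (∫ z, Ph ζ τ z • F (τ, z) ∂μ) - ∫ z, Ph ζ τ z • F (1, z) ∂μ) (𝓝[<] 1) (𝓝 0) := by
    rw [Metric.tendsto_nhds]
    intro ε hε
    filter_upwards [e01, hc, (unif_small hF (half_pos hε)).filter_mono nhdsWithin_le_nhds] with τ h hcτ hsm
    have hP := Ph_cont (ζ := ζ) h.1 h.2
    have i1 : Integrable (fun z => Ph ζ τ z • F (τ, z)) μ := integrable_cont (hP.smul hcτ)
    have i2 : Integrable (fun z => Ph ζ τ z • F (1, z)) μ := integrable_cont (hP.smul hc1)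
    rw [← integral_sub i1 i2, dist_zero_right]
    refine lt_of_le_of_lt (norm_integral_le_of_norm_le (g := fun z => Ph ζ τ z * (ε / 2)) ?_ ?_) ?_
    · exact (hP.integrable_of_hasCompactSupport (HasCompactSupport.of_compactSpace _)).mul_const _
    · refine Eventually.of_forall fun z => ?_
      rw [← smul_sub, norm_smul, Real.norm_eq_abs, abs_of_nonneg (Ph_nonneg h.1 h.2)]
      exact mul_le_mul_of_nonneg_left (hsm z).le (Ph_nonneg h.1 h.2)
    · rw [integral_mul_const, Ph_int h.1 h.2, one_mul]; exact half_lt_self hε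
  have := h2.add h1
  simpa using this

/-- regularized gamma -/
noncomputable def gr (p q z : ℂ) : ℂ :=
  E2 p q (p * q / z) / (pochInf (p * z) p * pochInf (q * z) q * E2 p q (p * q * z))

lemma gam_gr (hp : ‖p‖ < 1) (hq : ‖q‖ < 1) (z : ℂ) : ellGamma z p q = gr p q z / (1 - z) := by
  rw [ellGamma_eq hp hq, E2_pq hp hq z, gr, div_div, mul_comm (1 - z)]

lemma gr_den (hp : ‖p‖ < 1) (hq : ‖q‖ < 1) {z : ℂ} (h : ‖z‖ ≤ 1) :
    pochInf (p * z) p * pochInf (q * z) q * E2 p q (p * q * z) ≠ 0 := by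
  refine mul_ne_zero (mul_ne_zero (poch_ne_of_lt hp ?_) (poch_ne_of_lt hq ?_)) (E2_ne_of_lt hp hq ?_)
  · rw [norm_mul]; nlinarith [norm_nonneg p, norm_nonneg z]
  · rw [norm_mul]; nlinarith [norm_nonneg q, norm_nonneg z]
  · rw [norm_mul]; nlinarith [norm_nonneg (p * q), norm_nonneg z, pq_lt hp hq]

lemma gr_diff (hp : ‖p‖ < 1) (hq : ‖q‖ < 1) {z : ℂ} (h0 : z ≠ 0) (h : ‖z‖ ≤ 1) :
    DifferentiableAt ℂ (gr p q) z := by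
  unfold gr
  refine DifferentiableAt.div ?_ ?_ (gr_den hp hq h)
  · exact DifferentiableAt.fun_comp' z (E2_diff hp hq _) (by fun_prop (disch := assumption))
  · exact ((DifferentiableAt.fun_comp' z (poch_diff hp _) (by fun_prop)).mul
      (DifferentiableAt.fun_comp' z (poch_diff hq _) (by fun_prop))).mul
      (DifferentiableAt.fun_comp' z (E2_diff hp hq _) (by fun_prop))

lemma gr_one (hp : ‖p‖ < 1) (hq : ‖q‖ < 1) : gr p q 1 = (pochInf p p * pochInf q q)⁻¹ := by
  unfold gr
  rw [div_one, mul_one, mul_one, mul_one]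
  have := E2_ne_of_lt hp hq (pq_lt hp hq)
  field_simp

lemma cAt_gr (hp : ‖p‖ < 1) (hq : ‖q‖ < 1) {X : Type*} [TopologicalSpace X] {f : X → ℂ} {x : X}
    (hf : ContinuousAt f x) (h : f x ≠ 0) (h1 : ‖f x‖ ≤ 1) :
    ContinuousAt (fun x => gr p q (f x)) x :=
  ContinuousAt.comp (g := gr p q) (gr_diff hp hq h h1).continuousAt hf

end ESI

namespace ESI

open Filter Topology Complex MeasureTheory

variable {p q : ℂ}

lemma II_one {κ : Type*} [Fintype κ] (hp : ‖p‖ < 1) (hq : ‖q‖ < 1) {t : κ → ℂ}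
    (ht0 : ∀ m, t m ≠ 0) (ht1 : ∀ m, ‖t m‖ < 1) :
    II 1 p q t = ∫ z : Circle, W0 p q z * Gw p q t z ∂μ := by
  unfold II
  rw [integral_insertNth 0 (cont_wI hp hq ht0 ht1)]
  have : ∀ (x : Circle) (w : Tor 0), wI p q t (fun i => (((0 : Fin 1).insertNth x w : Tor 1) i : ℂ)) =
      W0 p q x * Gw p q t x := by
    intro x w
    unfold wI
    have : prs (Fin 1) = ∅ := by decide
    rw [this]
    simp [Fin.prod_univ_succ]
  simp only [this]
  simp

lemma prs6 (f : Fin 6 → Fin 6 → ℂ) : ∏ ij ∈ prs (Fin 6), f ij.1 ij.2 =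
    f 0 1 * (f 0 2 * f 0 3 * f 0 4 * f 0 5) * (f 1 2 * f 1 3 * f 1 4 * f 1 5) *
    (f 2 3 * f 2 4 * f 2 5 * f 3 4 * f 3 5 * f 4 5) := by
  have : prs (Fin 6) = {(0,1),(0,2),(0,3),(0,4),(0,5),(1,2),(1,3),(1,4),(1,5),(2,3),(2,4),(2,5),(3,4),(3,5),(4,5)} := by
    decide
  rw [this]
  simp only [Finset.prod_insert, Finset.mem_insert, Finset.mem_singleton, Finset.prod_singleton, Prod.mk.injEq, Fin.reduceEq,
    and_false, false_and, and_self, or_self, not_false_eq_true]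
  ring

/-- parameters for the constant -/
noncomputable def tc (σ : ℂ) (τ : ℝ) : Fin 6 → ℂ := ![I * τ, -(I * τ), σ, σ, σ, σ / τ ^ 2]

/-- regularized weight -/
noncomputable def Fc (p q σ : ℂ) (y : ℝ × Circle) : ℂ :=
  (1 + (y.1 : ℂ) ^ 2)⁻¹ * (W0 p q y.2 * (gr p q (I * y.1 * y.2) * gr p q (I * y.1 * (y.2 : ℂ)⁻¹) *
    (gr p q (-(I * y.1) * y.2) * gr p q (-(I * y.1) * (y.2 : ℂ)⁻¹)) *
    (ellGamma (σ * y.2) p q * ellGamma (σ * (y.2 : ℂ)⁻¹) p q) ^ 3 *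
    (ellGamma (σ / y.1 ^ 2 * y.2) p q * ellGamma (σ / y.1 ^ 2 * (y.2 : ℂ)⁻¹) p q)))

/-- regularized evaluation -/
noncomputable def Gc (p q σ : ℂ) (τ : ℝ) : ℂ :=
  gr p q ((τ : ℂ) ^ 2) * (ellGamma (I * τ * σ) p q ^ 3 * ellGamma (I * τ * (σ / τ ^ 2)) p q) *
    (ellGamma (-(I * τ) * σ) p q ^ 3 * ellGamma (-(I * τ) * (σ / τ ^ 2)) p q) *
    (ellGamma (σ * σ) p q ^ 3 * ellGamma (σ * (σ / τ ^ 2)) p q ^ 3)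

lemma tc_Om (hpq : p * q ≠ 0) {σ : ℂ} (hσ : σ ^ 4 = p * q) (hσ1 : ‖σ‖ < 1) {τ : ℝ} (h0 : 0 < τ) (h1 : τ < 1)
    (h2 : ‖σ‖ < τ ^ 2) : Om p q (tc σ τ) := by
  have hs0 : σ ≠ 0 := by rintro rfl; exact hpq (by rw [← hσ]; simp)
  have ht : (τ : ℂ) ≠ 0 := by exact_mod_cast h0.ne'
  refine ⟨?_, ?_, ?_⟩
  · intro m; fin_cases m <;> simp [tc, hs0, ht]
  · have e : ‖σ‖ / τ ^ 2 < 1 := by rw [div_lt_one (by positivity)]; exact h2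
    intro m; fin_cases m <;> simp [tc, hσ1, abs_of_pos h0, h1, e]
  · rw [Fin.prod_univ_six, ← hσ]
    simp only [tc, Matrix.cons_val]
    have := I_sq
    field_simp
    linear_combination -this

lemma Gc_eq (hp : ‖p‖ < 1) (hq : ‖q‖ < 1) (σ : ℂ) {τ : ℝ} (h0 : 0 < τ) (h1 : τ < 1) :
    (1 - (τ : ℂ) ^ 2) * KK p q (tc σ τ) = Gc p q σ τ := by
  unfold KK
  rw [prs6 fun i j => ellGamma (tc σ τ i * tc σ τ j) p q]
  have e : I * (τ : ℂ) * -(I * τ) = (τ : ℂ) ^ 2 := by linear_combination -(τ : ℂ) ^ 2 * I_sq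
  have hne : (1 - (τ : ℂ) ^ 2) ≠ 0 := by
    have : (1 - τ ^ 2 : ℝ) ≠ 0 := by nlinarith
    exact_mod_cast this
  simp only [tc, Matrix.cons_val]
  rw [e, gam_gr hp hq ((τ : ℂ) ^ 2), Gc]
  generalize gr p q ((τ : ℂ) ^ 2) = a
  generalize ellGamma (I * τ * σ) p q = b1
  generalize ellGamma (I * τ * (σ / τ ^ 2)) p q = b2
  generalize ellGamma (-(I * τ) * σ) p q = b3
  generalize ellGamma (-(I * τ) * (σ / τ ^ 2)) p q = b4
  generalize ellGamma (σ * σ) p q = b5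
  generalize ellGamma (σ * (σ / τ ^ 2)) p q = b6
  field_simp

lemma Fc_eq (hp : ‖p‖ < 1) (hq : ‖q‖ < 1) (σ : ℂ) {τ : ℝ} (h0 : 0 < τ) (h1 : τ < 1) {ζ ξ : Circle}
    (hζ : (ζ : ℂ) = I) (hξ : (ξ : ℂ) = -I) (z : Circle) :
    (1 - (τ : ℂ) ^ 2) * (W0 p q z * Gw p q (tc σ τ) z) =
    (1 / 2 : ℂ) * (Ph ζ τ z • Fc p q σ (τ, z) + Ph ξ τ z • Fc p q σ (τ, z)) := by
  have hz0 : (z : ℂ) ≠ 0 := unit_ne (cnorm z)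
  have hz1 : (starRingEnd ℂ) (z : ℂ) = (z : ℂ)⁻¹ := by
    rw [Complex.inv_def, Complex.normSq_eq_norm_sq, cnorm]; simp
  have key : ∀ w : ℂ, ‖w‖ = τ → (1 - w) ≠ 0 := by
    intro w hw h
    rw [← sub_eq_zero.1 h, norm_one] at hw
    linarith
  have n1 : (1 - I * τ * z) ≠ 0 := key _ (by simp [abs_of_pos h0, cnorm])
  have n2 : (1 - I * τ * (z : ℂ)⁻¹) ≠ 0 := key _ (by simp [abs_of_pos h0, cnorm])
  have n3 : (1 - -(I * τ) * z) ≠ 0 := key _ (by simp [abs_of_pos h0, cnorm])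
  have n4 : (1 - -(I * τ) * (z : ℂ)⁻¹) ≠ 0 := key _ (by simp [abs_of_pos h0, cnorm])
  have p1 : ((Ph ζ τ z : ℝ) : ℂ) = (1 - (τ : ℂ) ^ 2) / ((1 - I * τ * (z : ℂ)⁻¹) * (1 - -(I * τ) * z)) := by
    unfold Ph
    push_cast
    rw [← Complex.mul_conj', map_sub, map_mul, hz1, hζ, Complex.conj_ofReal, Complex.conj_I]
    congr 1
    field_simp
  have p2 : ((Ph ξ τ z : ℝ) : ℂ) = (1 - (τ : ℂ) ^ 2) / ((1 - -(I * τ) * (z : ℂ)⁻¹) * (1 - I * τ * z)) := by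
    unfold Ph
    push_cast
    rw [← Complex.mul_conj', map_sub, map_mul, hz1, hξ, Complex.conj_ofReal, map_neg, Complex.conj_I]
    congr 1
    field_simp
  have n5 : (1 + (τ : ℂ) ^ 2) ≠ 0 := by
    have : (1 + τ ^ 2 : ℝ) ≠ 0 := by positivity
    exact_mod_cast this
  rw [Complex.real_smul, Complex.real_smul, p1, p2, Gw, Fin.prod_univ_six]
  simp only [tc, Matrix.cons_val, Fc]
  rw [gam_gr hp hq (I * τ * z), gam_gr hp hq (I * τ * (z : ℂ)⁻¹), gam_gr hp hq (-(I * τ) * z),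
    gam_gr hp hq (-(I * τ) * (z : ℂ)⁻¹)]
  generalize gr p q (I * τ * z) = a1
  generalize gr p q (I * τ * (z : ℂ)⁻¹) = a2
  generalize gr p q (-(I * τ) * z) = a3
  generalize gr p q (-(I * τ) * (z : ℂ)⁻¹) = a4
  generalize ellGamma (σ * z) p q = b1
  generalize ellGamma (σ * (z : ℂ)⁻¹) p q = b2
  generalize ellGamma (σ / τ ^ 2 * z) p q = b3
  generalize ellGamma (σ / τ ^ 2 * (z : ℂ)⁻¹) p q = b4
  generalize W0 p q z = w
  have hs : (1 - I * τ * (z : ℂ)) * (1 - -(I * τ) * (z : ℂ)⁻¹) + (1 - I * τ * (z : ℂ)⁻¹) * (1 - -(I * τ) * (z : ℂ)) =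
      2 * (1 + (τ : ℂ) ^ 2) := by
    field_simp
    linear_combination -2 * (τ : ℂ) ^ 2 * z * I_sq
  revert hs n1 n2 n3 n4
  generalize 1 - I * τ * (z : ℂ) = d1
  generalize 1 - I * τ * (z : ℂ)⁻¹ = d2
  generalize 1 - -(I * τ) * (z : ℂ) = d3
  generalize 1 - -(I * τ) * (z : ℂ)⁻¹ = d4
  intro n1 n2 n3 n4 hs
  generalize (1 + (τ : ℂ) ^ 2) = e at *
  generalize (1 - (τ : ℂ) ^ 2) = f at *
  field_simp
  linear_combination -b1^3*b2^3*b3*b4*w*a1*a2*a3*a4*f * hs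

lemma Fc_at (hp : ‖p‖ < 1) (hq : ‖q‖ < 1) {σ : ℂ} (hs0 : σ ≠ 0) (z : Circle) {τ : ℝ} (h0 : 0 < τ)
    (h1 : τ ≤ 1) (hσ1 : ‖σ‖ < 1) (h2 : ‖σ‖ < τ ^ 2) : ContinuousAt (Fc p q σ) (τ, z) := by
  have hz0 : (z : ℂ) ≠ 0 := unit_ne (cnorm z)
  have ht : (τ : ℂ) ≠ 0 := by exact_mod_cast h0.ne'
  have c1 : ContinuousAt (fun y : ℝ × Circle => (y.1 : ℂ)) (τ, z) :=
    (Complex.continuous_ofReal.comp continuous_fst).continuousAt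
  have c2 : ContinuousAt (fun y : ℝ × Circle => (y.2 : ℂ)) (τ, z) :=
    (continuous_subtype_val.comp continuous_snd).continuousAt
  have c2i : ContinuousAt (fun y : ℝ × Circle => (y.2 : ℂ)⁻¹) (τ, z) := c2.inv₀ hz0
  have cI : ContinuousAt (fun y : ℝ × Circle => I * (y.1 : ℂ)) (τ, z) := continuousAt_const.mul c1
  have cS : ContinuousAt (fun y : ℝ × Circle => σ / (y.1 : ℂ) ^ 2) (τ, z) :=
    continuousAt_const.div (c1.pow 2) (pow_ne_zero 2 ht)
  have e : ‖σ‖ / τ ^ 2 < 1 := by rw [div_lt_one (by positivity)]; exact h2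
  have n5 : (1 + (τ : ℂ) ^ 2) ≠ 0 := by
    have : (1 + τ ^ 2 : ℝ) ≠ 0 := by positivity
    exact_mod_cast this
  unfold Fc
  refine ((continuousAt_const.add (c1.pow 2)).inv₀ n5).mul ((cAt_W0 hp hq c2 hz0).mul
    ((((cAt_gr hp hq (cI.mul c2) ?_ ?_).mul (cAt_gr hp hq (cI.mul c2i) ?_ ?_)).mul
    ((cAt_gr hp hq (cI.neg.mul c2) ?_ ?_).mul (cAt_gr hp hq (cI.neg.mul c2i) ?_ ?_)) |>.mul
    (((cAt_gam hp hq (continuousAt_const.mul c2) ?_ ?_).mul (cAt_gam hp hq (continuousAt_const.mul c2i) ?_ ?_)).pow 3)).mul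
    ((cAt_gam hp hq (cS.mul c2) ?_ ?_).mul (cAt_gam hp hq (cS.mul c2i) ?_ ?_)))) <;>
  simp [hz0, ht, hs0, cnorm, abs_of_pos h0, h1, hσ1, e]

lemma Gc_at (hp : ‖p‖ < 1) (hq : ‖q‖ < 1) {σ : ℂ} (hs0 : σ ≠ 0) (hσ1 : ‖σ‖ < 1) :
    ContinuousAt (Gc p q σ) 1 := by
  have c1 : ContinuousAt (fun y : ℝ => (y : ℂ)) 1 := Complex.continuous_ofReal.continuousAt
  have cI : ContinuousAt (fun y : ℝ => I * (y : ℂ)) 1 := continuousAt_const.mul c1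
  have cS : ContinuousAt (fun y : ℝ => σ / (y : ℂ) ^ 2) 1 :=
    continuousAt_const.div (c1.pow 2) (by simp)
  have e : ‖σ‖ * ‖σ‖ < 1 := by nlinarith [norm_nonneg σ]
  have cc : ContinuousAt (fun _ : ℝ => σ) 1 := continuousAt_const
  have cc2 : ContinuousAt (fun _ : ℝ => ellGamma (σ * σ) p q) 1 := continuousAt_const
  unfold Gc
  refine ((((cAt_gr hp hq (c1.pow 2) ?_ ?_).mul (((cAt_gam hp hq (cI.mul cc) ?_ ?_).pow 3).mul (cAt_gam hp hq (cI.mul cS) ?_ ?_))).mul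
    (((cAt_gam hp hq (cI.neg.mul cc) ?_ ?_).pow 3).mul (cAt_gam hp hq (cI.neg.mul cS) ?_ ?_))).mul
    ((cc2.pow 3).mul ((cAt_gam hp hq (cc.mul cS) ?_ ?_).pow 3))) <;>
  simp [hs0, hσ1, e]

lemma gr_neg (hp : ‖p‖ < 1) (hq : ‖q‖ < 1) : th p (-1) * th q (-1) * gr p q (-1) ^ 2 = 4 := by
  have h := gam_inv hp hq (z := -1) (by simp)
  have e : (-1 : ℂ)⁻¹ = -1 := by norm_num
  rw [e, gam_gr hp hq] at h
  have hne : gr p q (-1) ≠ 0 := by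
    unfold gr
    refine div_ne_zero (E2_ne_of_lt hp hq ?_) (gr_den hp hq (by simp))
    rw [norm_div, norm_neg, norm_one, div_one]; exact pq_lt hp hq
  rw [← h]
  field_simp
  norm_num

theorem C1 (hp : ‖p‖ < 1) (hq : ‖q‖ < 1) (hp0 : p ≠ 0) (hq0 : q ≠ 0) {C : ℂ}
    (hC : ∀ t : Fin 6 → ℂ, Om p q t → II 1 p q t = C * KK p q t) :
    C = 2 * gr p q 1 := by
  obtain ⟨σ, hσ⟩ := IsAlgClosed.exists_pow_nat_eq (p * q) (n := 4) (by norm_num)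
  have hpq : p * q ≠ 0 := mul_ne_zero hp0 hq0
  have hs0 : σ ≠ 0 := by rintro rfl; exact hpq (by rw [← hσ]; simp)
  have hσ1 : ‖σ‖ < 1 := by
    have := pq_lt hp hq
    rw [← hσ, norm_pow] at this
    exact (pow_lt_one_iff_of_nonneg (norm_nonneg _) (by norm_num)).1 this
  obtain ⟨ζ, hζ⟩ : ∃ ζ : Circle, (ζ : ℂ) = I := ⟨⟨I, by simp [Submonoid.unitSphere]⟩, rfl⟩
  obtain ⟨ξ, hξ⟩ : ∃ ζ : Circle, (ζ : ℂ) = -I := ⟨⟨-I, by simp [Submonoid.unitSphere]⟩, rfl⟩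
  have e01 : ∀ᶠ τ : ℝ in 𝓝[<] 1, (0 < τ ∧ τ < 1) ∧ ‖σ‖ < τ ^ 2 := by
    refine (((eventually_gt_nhds (zero_lt_one)).filter_mono nhdsWithin_le_nhds).and eventually_mem_nhdsWithin).and ?_
    have : Tendsto (fun τ : ℝ => τ ^ 2) (𝓝 1) (𝓝 (1 ^ 2)) := by
      have : Continuous (fun τ : ℝ => τ ^ 2) := by fun_prop
      exact this.tendsto 1
    exact (this.mono_left nhdsWithin_le_nhds).eventually_const_lt (by simpa using hσ1)
  have hFc : ∀ z, ContinuousAt (Fc p q σ) (1, z) := fun z =>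
    Fc_at hp hq hs0 z one_pos le_rfl hσ1 (by simpa using hσ1)
  have hFcc : ∀ τ : ℝ, (0 < τ ∧ τ < 1) ∧ ‖σ‖ < τ ^ 2 → Continuous fun z => Fc p q σ (τ, z) := by
    intro τ h
    rw [continuous_iff_continuousAt]
    intro z
    exact ContinuousAt.comp (g := Fc p q σ) (f := fun z => (τ, z)) (Fc_at hp hq hs0 z h.1.1 h.1.2.le hσ1 h.2) (by fun_prop)
  have l1 := Ph_tendsto' ζ hFc (e01.mono hFcc)
  have l2 := Ph_tendsto' ξ hFc (e01.mono hFcc)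
  have l3 := ((l1.add l2).const_mul (1 / 2 : ℂ))
  have l4 : Tendsto (fun τ : ℝ => C * Gc p q σ τ) (𝓝[<] 1) (𝓝 (C * Gc p q σ 1)) :=
    ((Gc_at hp hq hs0 hσ1).tendsto.const_mul C).mono_left nhdsWithin_le_nhds
  have l5 := tendsto_nhds_unique (l3.congr' ?_) l4
  · have g2 : ellGamma (σ * σ) p q * ellGamma (σ * σ) p q = 1 :=
      gam_refl hp hq hp0 hq0 (by rw [← hσ]; ring) (by rw [norm_mul]; nlinarith [norm_nonneg σ])
        (by rw [norm_mul]; nlinarith [norm_nonneg σ])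
    have hgr := gr_neg hp hq
    have Iinv : (I : ℂ)⁻¹ = -I := Complex.inv_I
    have Iinv' : (-I : ℂ)⁻¹ = I := by rw [inv_neg, Iinv, neg_neg]
    have II1 : I * I = -1 := I_mul_I
    have a1 : ellGamma (I * σ) p q ≠ 0 := by
      refine gam_ne hp hq (by simpa using hσ1) ?_
      rw [← hσ, norm_mul, norm_I, one_mul, norm_pow]
      have : 0 < ‖σ‖ := norm_pos_iff.2 hs0
      have := pow_lt_pow_right_of_lt_one₀ this hσ1 (show 1 < 4 by norm_num)
      simpa using this
    have a2 : ellGamma (-I * σ) p q ≠ 0 := by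
      refine gam_ne hp hq (by simpa using hσ1) ?_
      rw [← hσ, norm_mul, norm_neg, norm_I, one_mul, norm_pow]
      have : 0 < ‖σ‖ := norm_pos_iff.2 hs0
      have := pow_lt_pow_right_of_lt_one₀ this hσ1 (show 1 < 4 by norm_num)
      simpa using this
    have hg1 : gr p q 1 ≠ 0 := by
      rw [gr_one hp hq]
      exact inv_ne_zero (mul_ne_zero (poch_ne_of_lt hp hp) (poch_ne_of_lt hq hq))
    have W1 : W0 p q I = th p (-1) * th q (-1) := by
      rw [W0, I_sq]; norm_num
    have W2 : W0 p q (-I) = th p (-1) * th q (-1) := by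
      rw [W0, neg_sq, I_sq]; norm_num
    simp only [Fc, Gc, hζ, hξ, W1, W2, Iinv, Iinv', ofReal_one, mul_one, one_pow, div_one, mul_neg, neg_mul, neg_neg, II1] at l5 a2
    rw [mul_comm σ I] at l5
    revert l5 hgr g2 a1 a2 hg1
    generalize ellGamma (σ * σ) p q = x1
    generalize ellGamma (I * σ) p q = x2
    generalize ellGamma (-(I * σ)) p q = x3
    generalize gr p q 1 = x4
    generalize gr p q (-1) = x5
    generalize th p (-1) = x6
    generalize th q (-1) = x7
    intro g2 hgr a1 hg1 l5 a2
    have hx : x1 ^ 3 * x1 ^ 3 = 1 := by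
      calc x1 ^ 3 * x1 ^ 3 = (x1 * x1) ^ 3 := by ring
        _ = 1 := by rw [g2]; norm_num
    have : x4 * (x2 * x3) ^ 4 * C = x4 * (x2 * x3) ^ 4 * (2 * x4) := by
      linear_combination -l5 - C * x4 * x2^4*x3^4*hx + (1/2)*x4^2*x2^4*x3^4*hgr
    exact mul_left_cancel₀ (by positivity) this
  · filter_upwards [e01] with τ h
    have hO := tc_Om hpq hσ hσ1 h.1.1 h.1.2 h.2
    rw [← Gc_eq hp hq σ h.1.1 h.1.2, mul_left_comm, ← hC _ hO, II_one hp hq hO.ne hO.lt,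
      ← integral_const_mul]
    have hP := Ph_cont (ζ := ζ) h.1.1 h.1.2
    have hP' := Ph_cont (ζ := ξ) h.1.1 h.1.2
    have i1 : Integrable (fun z => Ph ζ τ z • Fc p q σ (τ, z)) μ := integrable_cont (hP.smul (hFcc τ h))
    have i2 : Integrable (fun z => Ph ξ τ z • Fc p q σ (τ, z)) μ := integrable_cont (hP'.smul (hFcc τ h))
    rw [← integral_add i1 i2, ← integral_const_mul]
    refine integral_congr_ae (Eventually.of_forall fun z => ?_)
    exact (Fc_eq hp hq σ h.1.1 h.1.2 hζ hξ z).symm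

end ESI

namespace ESI

open Filter Topology Complex MeasureTheory

variable {p q : ℂ}

lemma prs_prod {κ : Type*} [Fintype κ] [LinearOrder κ] (f : κ → κ → ℂ) :
    ∏ ij ∈ prs κ, f ij.1 ij.2 = ∏ i, ∏ j, if i < j then f i j else 1 := by
  rw [Finset.prod_filter, Fintype.prod_prod_type]

lemma KK_append {a b : ℕ} (f : Fin a → ℂ) (g : Fin b → ℂ) :
    KK p q (Fin.append f g) = KK p q f * KK p q g * ∏ i, ∏ j, ellGamma (f i * g j) p q := by
  unfold KK
  rw [prs_prod fun i j => ellGamma (Fin.append f g i * Fin.append f g j) p q,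
    prs_prod fun i j => ellGamma (f i * f j) p q, prs_prod fun i j => ellGamma (g i * g j) p q]
  rw [Fin.prod_univ_add]
  have e1 : ∀ i : Fin a, ∀ j : Fin b, Fin.castAdd b i < Fin.natAdd a j := by
    intro i j; rw [Fin.lt_def]; simp; omega
  have e2 : ∀ i : Fin a, ∀ j : Fin b, ¬ Fin.natAdd a j < Fin.castAdd b i := fun i j => (e1 i j).not_gt
  have e3 : ∀ i j : Fin a, (Fin.castAdd b i < Fin.castAdd b j) ↔ i < j := by
    intro i j; rw [Fin.lt_def, Fin.lt_def]; simp
  have e4 : ∀ i j : Fin b, (Fin.natAdd a i < Fin.natAdd a j) ↔ i < j := by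
    intro i j; rw [Fin.lt_def, Fin.lt_def]; simp
  simp only [Fin.prod_univ_add, Fin.append_left, Fin.append_right, e1, e2, e3, e4, if_true, if_false,
    Finset.prod_const_one, one_mul, Finset.prod_mul_distrib]
  ring

lemma Gw_append {a b : ℕ} (f : Fin a → ℂ) (g : Fin b → ℂ) (x : ℂ) :
    Gw p q (Fin.append f g) x = Gw p q f x * Gw p q g x := by
  unfold Gw
  rw [Fin.prod_univ_add]
  simp only [Fin.append_left, Fin.append_right]

lemma prod_append {a b : ℕ} (f : Fin a → ℂ) (g : Fin b → ℂ) :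
    ∏ i, Fin.append f g i = (∏ i, f i) * ∏ i, g i := by
  rw [Fin.prod_univ_add]
  simp only [Fin.append_left, Fin.append_right]

lemma all_append {a b : ℕ} {f : Fin a → ℂ} {g : Fin b → ℂ} {P : ℂ → Prop} (hf : ∀ i, P (f i)) (hg : ∀ i, P (g i)) :
    ∀ i, P (Fin.append f g i) := by
  intro i
  refine Fin.addCases (fun i => ?_) (fun i => ?_) i
  · rw [Fin.append_left]; exact hf i
  · rw [Fin.append_right]; exact hg i

/-- four-fold product -/
noncomputable def Gt (p q t x y : ℂ) : ℂ :=
  ellGamma (t * x * y) p q * ellGamma (t * x * y⁻¹) p q * ellGamma (t * x⁻¹ * y) p q * ellGamma (t * x⁻¹ * y⁻¹) p q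

lemma Gt_symm (t x y : ℂ) : Gt p q t x y = Gt p q t y x := by
  unfold Gt
  rw [mul_right_comm t x y, mul_right_comm t x y⁻¹, mul_right_comm t x⁻¹ y, mul_right_comm t x⁻¹ y⁻¹]
  ring

/-- doubled parameters -/
noncomputable def dbl {n b : ℕ} (s : ℂ) (z : Fin n → ℂ) (g : Fin b → ℂ) : Fin (n + n + b) → ℂ :=
  Fin.append (Fin.append (fun i => s * z i) (fun i => s * (z i)⁻¹)) g

lemma wI_dbl {n k b : ℕ} (s : ℂ) (z : Fin n → ℂ) (g : Fin b → ℂ) (w : Fin k → ℂ) :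
    wI p q (dbl s z g) w = wI p q g w * ∏ i, ∏ j, Gt p q s (z i) (w j) := by
  unfold wI
  rw [Finset.prod_comm (γ := Fin n), mul_assoc, ← Finset.prod_mul_distrib]
  congr 1
  refine Finset.prod_congr rfl fun j _ => ?_
  rw [dbl, Gw_append, Gw_append]
  have : Gw p q (fun i => s * z i) (w j) * Gw p q (fun i => s * (z i)⁻¹) (w j) = ∏ i, Gt p q s (z i) (w j) := by
    unfold Gw
    rw [← Finset.prod_mul_distrib]
    refine Finset.prod_congr rfl fun i _ => ?_
    unfold Gt
    ring
  rw [this]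
  ring

lemma prod_all {n : ℕ} (f : Fin n → Fin n → ℂ) :
    ∏ i, ∏ j, f i j = (∏ i, f i i) * ((∏ ij ∈ prs (Fin n), f ij.1 ij.2) * ∏ ij ∈ prs (Fin n), f ij.2 ij.1) := by
  rw [prs_prod f, prs_prod fun i j => f j i, Finset.prod_comm (f := fun i j => if i < j then f j i else 1),
    ← Finset.prod_mul_distrib, ← Finset.prod_mul_distrib]
  refine Finset.prod_congr rfl fun i _ => ?_
  rw [← Finset.prod_mul_distrib]
  have : f i i = ∏ j, if j = i then f i j else 1 := by simp
  rw [this, ← Finset.prod_mul_distrib]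
  refine Finset.prod_congr rfl fun j _ => ?_
  rcases lt_trichotomy i j with h | h | h
  · simp [h, h.ne', h.not_gt]
  · simp [h]
  · simp [h, h.ne, h.not_gt]

lemma KK_dbl {n b : ℕ} {s : ℂ} {z : Fin n → ℂ} (hz : ∀ i, z i ≠ 0) (g : Fin b → ℂ) :
    KK p q (dbl s z g) = ellGamma (s ^ 2) p q ^ n * (∏ ij ∈ prs (Fin n), Gt p q (s ^ 2) (z ij.1) (z ij.2)) *
      KK p q g * ∏ i, Gw p q (fun m => s * g m) (z i) := by
  rw [dbl, KK_append, KK_append, Fin.prod_univ_add]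
  simp only [Fin.append_left, Fin.append_right]
  have e1 : (∏ i : Fin n, ∏ j, ellGamma (s * z i * g j) p q) * (∏ i : Fin n, ∏ j, ellGamma (s * (z i)⁻¹ * g j) p q)
      = ∏ i, Gw p q (fun m => s * g m) (z i) := by
    rw [← Finset.prod_mul_distrib]
    refine Finset.prod_congr rfl fun i _ => ?_
    rw [← Finset.prod_mul_distrib, Gw]
    refine Finset.prod_congr rfl fun j _ => ?_
    rw [mul_right_comm s (z i) (g j), mul_right_comm s (z i)⁻¹ (g j)]
  have e2 : KK p q (fun i => s * z i) * KK p q (fun i => s * (z i)⁻¹) *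
      (∏ i, ∏ j, ellGamma (s * z i * (s * (z j)⁻¹)) p q) =
      ellGamma (s ^ 2) p q ^ n * (∏ ij ∈ prs (Fin n), Gt p q (s ^ 2) (z ij.1) (z ij.2)) := by
    rw [prod_all, KK, KK]
    have : ∏ i : Fin n, ellGamma (s * z i * (s * (z i)⁻¹)) p q = ellGamma (s ^ 2) p q ^ n := by
      rw [Finset.prod_congr rfl (g := fun _ => ellGamma (s ^ 2) p q), Finset.prod_const, Finset.card_univ, Fintype.card_fin]
      intro i _
      have := hz i
      congr 1
      field_simp
    rw [this, mul_left_comm, ← Finset.prod_mul_distrib, ← Finset.prod_mul_distrib, ← Finset.prod_mul_distrib]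
    congr 1
    refine Finset.prod_congr rfl fun ij _ => ?_
    unfold Gt
    have a1 : s * z ij.1 * (s * z ij.2) = s ^ 2 * z ij.1 * z ij.2 := by ring
    have a2 : s * (z ij.1)⁻¹ * (s * (z ij.2)⁻¹) = s ^ 2 * (z ij.1)⁻¹ * (z ij.2)⁻¹ := by ring
    have a3 : s * z ij.1 * (s * (z ij.2)⁻¹) = s ^ 2 * z ij.1 * (z ij.2)⁻¹ := by ring
    have a4 : s * z ij.2 * (s * (z ij.1)⁻¹) = s ^ 2 * (z ij.1)⁻¹ * z ij.2 := by ring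
    rw [a1, a2, a3, a4]
    ring
  rw [← e1, ← e2]

/-- type II weight -/
noncomputable def wJ {n b : ℕ} (p q t : ℂ) (g : Fin b → ℂ) (z : Fin n → ℂ) : ℂ :=
  (∏ ij ∈ prs (Fin n), Gt p q t (z ij.1) (z ij.2)) * wI p q g z

/-- type II integral -/
noncomputable def JJ {b : ℕ} (n : ℕ) (p q t : ℂ) (g : Fin b → ℂ) : ℂ :=
  ∫ z : Tor n, wJ p q t g (fun i => (z i : ℂ)) ∂(ν n)

lemma wI_mul_Gw {n a b : ℕ} (f : Fin a → ℂ) (g : Fin b → ℂ) (z : Fin n → ℂ) :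
    wI p q f z * ∏ i, Gw p q g (z i) = wI p q (Fin.append f g) z := by
  unfold wI
  rw [mul_assoc, ← Finset.prod_mul_distrib]
  congr 1
  refine Finset.prod_congr rfl fun i _ => ?_
  rw [Gw_append, mul_assoc]

lemma wI_congr {n a b : ℕ} {f : Fin a → ℂ} {g : Fin b → ℂ} {z : Fin n → ℂ}
    (h : ∀ i, Gw p q f (z i) = Gw p q g (z i)) : wI p q f z = wI p q g z := by
  unfold wI
  congr 1
  exact Finset.prod_congr rfl fun i _ => by rw [h]

lemma II_dbl {n k b : ℕ} {C : ℂ} (hC : ∀ t : Fin (2 * k + 4) → ℂ, Om p q t → II k p q t = C * KK p q t)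
    (hk : n + n + b = 2 * k + 4) {s : ℂ} (hs0 : s ≠ 0) (hs1 : ‖s‖ < 1) {z : Fin n → ℂ} (hz : ∀ i, ‖z i‖ = 1)
    {g : Fin b → ℂ} (hg0 : ∀ i, g i ≠ 0) (hg1 : ∀ i, ‖g i‖ < 1) (hpr : (s ^ 2) ^ n * ∏ i, g i = p * q) :
    (∀ i, dbl s z g i ≠ 0) ∧ (∀ i, ‖dbl s z g i‖ < 1) ∧
    II k p q (dbl s z g) = C * (ellGamma (s ^ 2) p q ^ n * (∏ ij ∈ prs (Fin n), Gt p q (s ^ 2) (z ij.1) (z ij.2)) *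
      KK p q g * ∏ i, Gw p q (fun m => s * g m) (z i)) := by
  have hz0 : ∀ i, z i ≠ 0 := fun i => unit_ne (hz i)
  have hO : Om p q (dbl s z g) := by
    refine ⟨?_, ?_, ?_⟩
    · refine all_append (P := fun x => x ≠ 0) (all_append (P := fun x => x ≠ 0) (fun i => mul_ne_zero hs0 (hz0 i))
        (fun i => mul_ne_zero hs0 (inv_ne_zero (hz0 i)))) hg0
    · exact all_append (P := fun x => ‖x‖ < 1) (all_append (P := fun x => ‖x‖ < 1) (fun i => norm_tz hs1 (hz i))
        (fun i => norm_tz hs1 (unit_inv (hz i)))) hg1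
    · rw [dbl, prod_append, prod_append, ← hpr, ← Finset.prod_mul_distrib]
      congr 1
      rw [Finset.prod_congr rfl (g := fun _ => s ^ 2), Finset.prod_const, Finset.card_univ, Fintype.card_fin]
      intro i _
      have := hz0 i
      field_simp
  refine ⟨hO.ne, hO.lt, ?_⟩
  rw [← KK_dbl hz0]
  revert hO
  generalize dbl s z g = t
  revert t
  rw [hk]
  exact hC

end ESI

namespace ESI

open Filter Topology Complex MeasureTheory

variable {p q : ℂ}

/-- parameter list with distinguished last one -/
noncomputable def TT (τ : Fin 5 → ℂ) (u : ℂ) : Fin 6 → ℂ := Fin.append τ (fun _ : Fin 1 => u)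

lemma TT_all {τ : Fin 5 → ℂ} {u : ℂ} {P : ℂ → Prop} (h : ∀ i, P (τ i)) (hu : P u) : ∀ i, P (TT τ u i) :=
  all_append (a := 5) (b := 1) (f := τ) (g := fun _ => u) h (fun _ => hu)

lemma TT_prod (τ : Fin 5 → ℂ) (u : ℂ) : ∏ i, TT τ u i = (∏ i, τ i) * u := by
  unfold TT
  refine (prod_append (a := 5) (b := 1) τ (fun _ => u)).trans ?_
  simp

lemma TT_Gw (τ : Fin 5 → ℂ) (u x : ℂ) :
    Gw p q (TT τ u) x = Gw p q τ x * (ellGamma (u * x) p q * ellGamma (u * x⁻¹) p q) := by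
  unfold TT
  refine (Gw_append (a := 5) (b := 1) τ (fun _ => u) x).trans ?_
  simp [Gw]

lemma TT_smul (s : ℂ) (τ : Fin 5 → ℂ) (u : ℂ) : (fun m => s * TT τ u m) = TT (fun m => s * τ m) (s * u) := by
  funext m
  revert m
  unfold TT
  intro m
  refine Fin.addCases (m := 5) (n := 1) (fun i => ?_) (fun i => ?_) m
  · rw [Fin.append_left, Fin.append_left]
  · rw [Fin.append_right, Fin.append_right]

lemma gcan (hp : ‖p‖ < 1) (hq : ‖q‖ < 1) (hp0 : p ≠ 0) (hq0 : q ≠ 0) {x y z : ℂ} (hxy : x * y = p * q)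
    (hx : ‖x‖ < 1) (hy : ‖y‖ < 1) (hz : ‖z‖ = 1) :
    (ellGamma (x * z) p q * ellGamma (x * z⁻¹) p q) * (ellGamma (y * z) p q * ellGamma (y * z⁻¹) p q) = 1 := by
  have hz0 := unit_ne hz
  have e1 := gam_refl hp hq hp0 hq0 (z := x * z) (w := y * z⁻¹) (by rw [← hxy]; field_simp)
    (norm_tz hx hz) (norm_tz hy (unit_inv hz))
  have e2 := gam_refl hp hq hp0 hq0 (z := x * z⁻¹) (w := y * z) (by rw [← hxy]; field_simp)
    (norm_tz hx (unit_inv hz)) (norm_tz hy hz)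
  linear_combination (ellGamma (x * z⁻¹) p q * ellGamma (y * z) p q) * e1 + e2

lemma Gw_two (a b x : ℂ) : Gw p q ![a, b] x =
    (ellGamma (a * x) p q * ellGamma (a * x⁻¹) p q) * (ellGamma (b * x) p q * ellGamma (b * x⁻¹) p q) := by
  simp [Gw]

lemma KK_two (a b : ℂ) : KK p q ![a, b] = ellGamma (a * b) p q := by
  unfold KK
  rw [prs_prod fun i j => ellGamma (![a, b] i * ![a, b] j) p q]
  simp [Fin.prod_univ_two]

lemma dbl_all {n b : ℕ} {s : ℂ} (hs0 : s ≠ 0) (hs1 : ‖s‖ < 1) {z : Fin n → ℂ} (hz : ∀ i, ‖z i‖ = 1)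
    {g : Fin b → ℂ} (hg0 : ∀ i, g i ≠ 0) (hg1 : ∀ i, ‖g i‖ < 1) :
    (∀ i, dbl s z g i ≠ 0) ∧ (∀ i, ‖dbl s z g i‖ < 1) := by
  have hz0 : ∀ i, z i ≠ 0 := fun i => unit_ne (hz i)
  constructor
  · exact all_append (P := fun x => x ≠ 0) (all_append (P := fun x => x ≠ 0) (fun i => mul_ne_zero hs0 (hz0 i))
      (fun i => mul_ne_zero hs0 (inv_ne_zero (hz0 i)))) hg0
  · exact all_append (P := fun x => ‖x‖ < 1) (all_append (P := fun x => ‖x‖ < 1) (fun i => norm_tz hs1 (hz i))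
      (fun i => norm_tz hs1 (unit_inv (hz i)))) hg1

lemma cont_dbl {n k b : ℕ} (hp : ‖p‖ < 1) (hq : ‖q‖ < 1) {s : ℂ} (hs0 : s ≠ 0) (hs1 : ‖s‖ < 1)
    {g : Fin b → ℂ} (hg0 : ∀ i, g i ≠ 0) (hg1 : ∀ i, ‖g i‖ < 1) :
    Continuous fun y : Tor n × Tor k => wI p q (dbl s (fun i => (y.1 i : ℂ)) g) (fun i => (y.2 i : ℂ)) := by
  rw [continuous_iff_continuousAt]
  intro y
  obtain ⟨h0, h1⟩ := dbl_all hs0 hs1 (z := fun i => (y.1 i : ℂ)) (fun i => cnorm _) hg0 hg1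
  refine cAt_wI (X := Tor n × Tor k) hp hq (t := fun y => dbl s (fun i => (y.1 i : ℂ)) g)
    (z := fun y i => (y.2 i : ℂ)) ?_ h0 h1 (fun i => ?_) (fun i => cnorm _)
  · have c : ∀ i, ContinuousAt (fun y : Tor n × Tor k => (y.1 i : ℂ)) y := fun i =>
      ((cont_coord i).comp continuous_fst).continuousAt
    intro m
    refine Fin.addCases (fun m => ?_) (fun m => ?_) m
    · refine Fin.addCases (fun m => ?_) (fun m => ?_) m
      · simp only [dbl, Fin.append_left]
        exact continuousAt_const.mul (c m)
      · simp only [dbl, Fin.append_left, Fin.append_right]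
        exact continuousAt_const.mul ((c m).inv₀ (unit_ne (cnorm _)))
    · simp only [dbl, Fin.append_right]
      exact continuousAt_const
  · exact ((cont_coord i).comp continuous_snd).continuousAt

lemma swap_key {n k a b : ℕ} (hp : ‖p‖ < 1) (hq : ‖q‖ < 1) {s : ℂ} (hs0 : s ≠ 0) (hs1 : ‖s‖ < 1)
    {f : Fin a → ℂ} (hf0 : ∀ i, f i ≠ 0) (hf1 : ∀ i, ‖f i‖ < 1)
    {g : Fin b → ℂ} (hg0 : ∀ i, g i ≠ 0) (hg1 : ∀ i, ‖g i‖ < 1) :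
    ∫ z : Tor n, wI p q f (fun i => (z i : ℂ)) * II k p q (dbl s (fun i => (z i : ℂ)) g) ∂(ν n) =
    ∫ w : Tor k, wI p q g (fun i => (w i : ℂ)) * II n p q (dbl s (fun i => (w i : ℂ)) f) ∂(ν k) := by
  unfold II
  simp only [← integral_const_mul]
  rw [integral_integral_swap]
  · refine integral_congr_ae (Eventually.of_forall fun w => ?_)
    refine integral_congr_ae (Eventually.of_forall fun z => ?_)
    beta_reduce
    rw [wI_dbl, wI_dbl, Finset.prod_comm]
    simp only [Gt_symm s (z _ : ℂ)]
    ring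
  · have : Continuous (Function.uncurry fun (z : Tor n) (w : Tor k) => wI p q f (fun i => (z i : ℂ)) *
        wI p q (dbl s (fun i => (z i : ℂ)) g) (fun i => (w i : ℂ))) :=
      ((cont_wI hp hq hf0 hf1).comp continuous_fst).mul (cont_dbl hp hq hs0 hs1 hg0 hg1)
    exact integrable_cont this

lemma recur {j : ℕ} {C C' : ℂ} (hp : ‖p‖ < 1) (hq : ‖q‖ < 1) (hp0 : p ≠ 0) (hq0 : q ≠ 0)
    (hC : ∀ t : Fin (2 * (j + 1) + 4) → ℂ, Om p q t → II (j + 1) p q t = C * KK p q t)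
    (hC' : ∀ t : Fin (2 * (j + 2) + 4) → ℂ, Om p q t → II (j + 2) p q t = C' * KK p q t)
    {s u : ℂ} (hs0 : s ≠ 0) (hs1 : ‖s‖ < 1) (hu0 : u ≠ 0) (hu1 : ‖u‖ < ‖s‖)
    {τ : Fin 5 → ℂ} (hτ0 : ∀ i, τ i ≠ 0) (hτ1 : ∀ i, ‖τ i‖ < 1)
    (hb : (s ^ 2) ^ (2 * (j + 1)) * ((∏ i, τ i) * u) = p * q) :
    C * ellGamma (s ^ 2) p q * JJ (j + 2) p q (s ^ 2) (TT τ u) =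
      C' * ellGamma ((s ^ 2) ^ (j + 2)) p q * KK p q (TT τ ((s ^ 2) ^ (j + 1) * u)) *
        JJ (j + 1) p q (s ^ 2) (TT (fun m => s * τ m) (u / s)) := by
  have hn : ‖u‖ < 1 := hu1.trans hs1
  have hs2 : ‖s ^ 2‖ < 1 := by rw [norm_pow]; exact pow_lt_one₀ (norm_nonneg _) hs1 (by norm_num)
  have hP1 : ‖∏ i, τ i‖ < 1 := by
    rw [norm_prod, Fin.prod_univ_succ]
    refine mul_lt_one_of_nonneg_of_lt_one_left (norm_nonneg _) (hτ1 0) ?_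
    exact Finset.prod_le_one (fun _ _ => norm_nonneg _) (fun i _ => (hτ1 _).le)
  have hP0 : ∏ i, τ i ≠ 0 := Finset.prod_ne_zero_iff.2 fun i _ => hτ0 i
  obtain ⟨P, hP⟩ : ∃ P, P = ∏ i, τ i := ⟨_, rfl⟩
  rw [← hP] at hb hP1 hP0
  obtain ⟨a, ha⟩ : ∃ a, a = u / s := ⟨_, rfl⟩
  obtain ⟨b, hbd⟩ : ∃ b, b = s ^ (2 * j + 1) * P := ⟨_, rfl⟩
  obtain ⟨v, hv⟩ : ∃ v, v = (s ^ 2) ^ (j + 1) * u := ⟨_, rfl⟩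
  have ha0 : a ≠ 0 := by rw [ha]; exact div_ne_zero hu0 hs0
  have ha1 : ‖a‖ < 1 := by rw [ha, norm_div]; exact (div_lt_one (norm_pos_iff.2 hs0)).2 hu1
  have hsp : ∀ m : ℕ, ‖s ^ m‖ ≤ 1 := fun m => by rw [norm_pow]; exact pow_le_one₀ (norm_nonneg _) hs1.le
  have hb0 : b ≠ 0 := by rw [hbd]; exact mul_ne_zero (pow_ne_zero _ hs0) hP0
  have hb1 : ‖b‖ < 1 := by
    rw [hbd, norm_mul]; exact mul_lt_one_of_nonneg_of_lt_one_right (hsp _) (norm_nonneg _) hP1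
  have hv0 : v ≠ 0 := by rw [hv]; exact mul_ne_zero (pow_ne_zero _ (pow_ne_zero _ hs0)) hu0
  have hv1 : ‖v‖ < 1 := by
    rw [hv, norm_mul, ← pow_mul]; exact mul_lt_one_of_nonneg_of_lt_one_right (hsp _) (norm_nonneg _) hn
  have sv1 : ‖s * v‖ < 1 := by
    rw [norm_mul]; exact mul_lt_one_of_nonneg_of_lt_one_left (norm_nonneg _) hs1 hv1.le
  have sb1 : ‖s * b‖ < 1 := by
    rw [norm_mul]; exact mul_lt_one_of_nonneg_of_lt_one_left (norm_nonneg _) hs1 hb1.le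
  have r1 : v * (s * b) = p * q := by rw [← hb, hv, hbd]; ring
  have r2 : s * v * b = p * q := by rw [← r1]; ring
  have r3 : (s ^ 2) ^ (j + 2) * (a * b) = p * q := by rw [← hb, hbd, ha]; field_simp; ring
  have r4 : (s ^ 2) ^ (j + 1) * (P * v) = p * q := by rw [← hb, hv]; ring
  have ab1 : ‖a * b‖ < 1 := by
    rw [norm_mul]; exact mul_lt_one_of_nonneg_of_lt_one_left (norm_nonneg _) ha1 hb1.le
  have st1 : ‖(s ^ 2) ^ (j + 2)‖ < 1 := by
    rw [norm_pow]; exact pow_lt_one₀ (norm_nonneg _) hs2 (by omega)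
  have g1 := gam_refl hp hq hp0 hq0 r3 st1 ab1
  have gt0 : ellGamma (s ^ 2) p q ≠ 0 := by
    refine gam_ne hp hq hs2 ?_
    have : p * q = s ^ 2 * ((s ^ 2) ^ (2 * j + 1) * (P * u)) := by rw [← hb]; ring
    rw [this, norm_mul]
    refine mul_lt_of_lt_one_right (norm_pos_iff.2 (pow_ne_zero _ hs0)) ?_
    rw [norm_mul, ← pow_mul]
    refine mul_lt_one_of_nonneg_of_lt_one_right (hsp _) (norm_nonneg _) ?_
    rw [norm_mul]
    exact mul_lt_one_of_nonneg_of_lt_one_left (norm_nonneg _) hP1 hn.le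
  have hS0 : ∀ i, TT τ v i ≠ 0 := TT_all (P := fun x => x ≠ 0) hτ0 hv0
  have hS1 : ∀ i, ‖TT τ v i‖ < 1 := TT_all (P := fun x => ‖x‖ < 1) hτ1 hv1
  have hg0 : ∀ i, ![a, b] i ≠ 0 := by intro i; fin_cases i <;> simpa
  have hg1 : ∀ i, ‖![a, b] i‖ < 1 := by intro i; fin_cases i <;> simpa
  have key := swap_key (n := j + 2) (k := j + 1) hp hq hs0 hs1 hS0 hS1 hg0 hg1
  have L : ∀ z : Tor (j + 2), wI p q (TT τ v) (fun i => (z i : ℂ)) * II (j + 1) p q (dbl s (fun i => (z i : ℂ)) ![a, b]) =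
      C * ellGamma (s ^ 2) p q ^ (j + 2) * ellGamma (a * b) p q * wJ p q (s ^ 2) (TT τ u) (fun i => (z i : ℂ)) := by
    intro z
    have h := (II_dbl hC (by omega) hs0 hs1 (z := fun i => (z i : ℂ)) (fun i => cnorm _) hg0 hg1
      (by rw [Fin.prod_univ_two]; simpa using r3)).2.2
    rw [h, KK_two]
    have e : wI p q (TT τ u) (fun i => (z i : ℂ)) = wI p q (TT τ v) (fun i => (z i : ℂ)) *
        ∏ i, Gw p q (fun m => s * ![a, b] m) (z i) := by
      rw [wI_mul_Gw]
      refine wI_congr fun i => ?_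
      have e2 : (fun m => s * ![a, b] m) = ![u, s * b] := by
        funext m; fin_cases m
        · simp [ha]; field_simp
        · simp
      rw [Gw_append, e2, Gw_two, TT_Gw, TT_Gw]
      have := gcan hp hq hp0 hq0 r1 hv1 sb1 (cnorm (z i))
      linear_combination (-Gw p q τ (z i) * (ellGamma (u * (z i)) p q * ellGamma (u * (z i : ℂ)⁻¹) p q)) * this
    rw [wJ, e]
    ring
  have R : ∀ z : Tor (j + 1), wI p q ![a, b] (fun i => (z i : ℂ)) * II (j + 2) p q (dbl s (fun i => (z i : ℂ)) (TT τ v)) =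
      C' * ellGamma (s ^ 2) p q ^ (j + 1) * KK p q (TT τ v) * wJ p q (s ^ 2) (TT (fun m => s * τ m) a) (fun i => (z i : ℂ)) := by
    intro z
    have h := (II_dbl hC' (by omega) hs0 hs1 (z := fun i => (z i : ℂ)) (fun i => cnorm _) hS0 hS1
      (by rw [TT_prod, ← hP]; exact r4)).2.2
    rw [h]
    have e : wI p q (TT (fun m => s * τ m) a) (fun i => (z i : ℂ)) = wI p q ![a, b] (fun i => (z i : ℂ)) *
        ∏ i, Gw p q (fun m => s * TT τ v m) (z i) := by
      rw [wI_mul_Gw]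
      refine wI_congr fun i => ?_
      rw [Gw_append, TT_smul, Gw_two, TT_Gw, TT_Gw]
      have := gcan hp hq hp0 hq0 r2 sv1 hb1 (cnorm (z i))
      linear_combination (-Gw p q (fun m => s * τ m) (z i) * (ellGamma (a * (z i)) p q * ellGamma (a * (z i : ℂ)⁻¹) p q)) * this
    rw [wJ, e]
    ring
  simp only [L, R, integral_const_mul] at key
  rw [← hv, ← ha]
  change C * ellGamma (s ^ 2) p q ^ (j + 2) * ellGamma (a * b) p q * JJ (j + 2) p q (s ^ 2) (TT τ u) =
    C' * ellGamma (s ^ 2) p q ^ (j + 1) * KK p q (TT τ v) * JJ (j + 1) p q (s ^ 2) (TT (fun m => s * τ m) a) at key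
  generalize JJ (j + 2) p q (s ^ 2) (TT τ u) = J2 at *
  generalize JJ (j + 1) p q (s ^ 2) (TT (fun m => s * τ m) a) = J1 at *
  generalize ellGamma ((s ^ 2) ^ (j + 2)) p q = G1 at *
  generalize ellGamma (s ^ 2) p q = G at *
  generalize ellGamma (a * b) p q = G3 at *
  have : G ^ (j + 1) ≠ 0 := pow_ne_zero _ gt0
  apply mul_left_cancel₀ this
  linear_combination G1 * key - (C * G ^ (j + 2) * J2) * g1

end ESI

namespace ESI

open Filter Topology Complex MeasureTheory

variable {p q : ℂ}

lemma μ_single (a : Circle) : μ {a} = 0 := by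
  unfold μ
  rw [Measure.smul_apply, Measure.map_apply Circle.exp.continuous.measurable (measurableSet_singleton a),
    Measure.restrict_apply (Circle.exp.continuous.measurable (measurableSet_singleton a))]
  have : (Circle.exp ⁻¹' {a} ∩ Set.Ioc 0 (2 * Real.pi)).Subsingleton := by
    intro x hx y hy
    have h1 : Circle.exp x = Circle.exp y := hx.1.trans hy.1.symm
    obtain ⟨m, hm⟩ := Circle.exp_eq_exp.1 h1
    have hx2 := hx.2
    have hy2 := hy.2
    have hpi := Real.pi_pos
    have m1 : (m : ℝ) < 1 := by
      by_contra h
      push Not at h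
      nlinarith [hx2.1, hx2.2, hy2.1, hy2.2]
    have m2 : (-1 : ℝ) < m := by
      by_contra h
      push Not at h
      nlinarith [hx2.1, hx2.2, hy2.1, hy2.2]
    have m0 : m = 0 := by
      have a1 : m < 1 := by exact_mod_cast m1
      have a2 : -1 < m := by exact_mod_cast m2
      omega
    rw [hm, m0]; simp
  rw [this.measure_zero]
  simp

lemma ν_null {n : ℕ} {i j : Fin n} (hij : i ≠ j) {f : Circle → Circle} (hf : Continuous f) :
    ∀ᵐ z ∂(ν n), z i ≠ f (z j) := by
  cases n with
  | zero => exact i.elim0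
  | succ n =>
    obtain ⟨k, rfl⟩ := Fin.exists_succAbove_eq hij.symm
    have h := measurePreserving_piFinSuccAbove (fun _ : Fin (n + 1) => μ) i
    have hm : MeasurableSet {y : Circle × Tor n | y.1 = f (y.2 k)} := by
      refine IsClosed.measurableSet (isClosed_eq continuous_fst ?_)
      exact hf.comp ((continuous_apply k).comp continuous_snd)
    have e := h.measure_preimage hm.nullMeasurableSet
    rw [ae_iff]
    have : {a : Tor (n + 1) | ¬ a i ≠ f (a (i.succAbove k))} =
        (MeasurableEquiv.piFinSuccAbove (fun _ => Circle) i) ⁻¹' {y : Circle × Tor n | y.1 = f (y.2 k)} := by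
      ext a
      simp [MeasurableEquiv.piFinSuccAbove, Fin.insertNthEquiv, Fin.removeNth]
    rw [this, e, Measure.prod_apply_symm hm]
    have : ∀ y : Tor n, μ ((fun x => (x, y)) ⁻¹' {y : Circle × Tor n | y.1 = f (y.2 k)}) = 0 := by
      intro y
      have : ((fun x => (x, y)) ⁻¹' {y : Circle × Tor n | y.1 = f (y.2 k)}) = {f (y k)} := by
        ext x; simp
      rw [this, μ_single]
    rw [lintegral_congr this, lintegral_zero]

/-- four-fold linear factor -/
noncomputable def Li (t x y : ℂ) : ℂ :=
  (1 - t * x * y) * (1 - t * x * y⁻¹) * (1 - t * x⁻¹ * y) * (1 - t * x⁻¹ * y⁻¹)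

/-- four-fold regularised gamma -/
noncomputable def Gr (p q t x y : ℂ) : ℂ :=
  gr p q (t * x * y) * gr p q (t * x * y⁻¹) * gr p q (t * x⁻¹ * y) * gr p q (t * x⁻¹ * y⁻¹)

lemma Gt_eq (hp : ‖p‖ < 1) (hq : ‖q‖ < 1) (t x y : ℂ) : Gt p q t x y = Gr p q t x y / Li t x y := by
  unfold Gt Gr Li
  rw [gam_gr hp hq, gam_gr hp hq, gam_gr hp hq, gam_gr hp hq]
  simp only [div_mul_div_comm]

lemma Dd_Gt (hp : ‖p‖ < 1) (hq : ‖q‖ < 1) {x y : ℂ} (hx : ‖x‖ = 1) (hy : ‖y‖ = 1) :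
    Dd p q x y = (Gt p q 1 x y)⁻¹ := by
  have h1 := gam_inv hp hq (z := x * y) (by rw [norm_mul, hx, hy, mul_one])
  have h2 := gam_inv hp hq (z := x * y⁻¹) (by rw [norm_mul, hx, unit_inv hy, mul_one])
  unfold Dd Gt
  have e1 : (x * y)⁻¹ = x⁻¹ * y⁻¹ := by rw [mul_inv]
  have e2 : (x * y⁻¹)⁻¹ = x⁻¹ * y := by rw [mul_inv, inv_inv]
  rw [e1] at h1
  rw [e2] at h2
  rw [e1, e2, one_mul, one_mul, mul_mul_mul_comm, ← h1, ← h2, ← mul_inv]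
  congr 1
  ring

lemma gr_ne (hp : ‖p‖ < 1) (hq : ‖q‖ < 1) {z : ℂ} (hz : ‖z‖ = 1) : gr p q z ≠ 0 := by
  unfold gr
  refine div_ne_zero (E2_ne_of_lt hp hq ?_) (gr_den hp hq hz.le)
  rw [norm_div, hz, div_one]
  exact pq_lt hp hq

lemma Gr_ne (hp : ‖p‖ < 1) (hq : ‖q‖ < 1) {x y : ℂ} (hx : ‖x‖ = 1) (hy : ‖y‖ = 1) : Gr p q 1 x y ≠ 0 := by
  unfold Gr
  simp only [one_mul]
  refine mul_ne_zero (mul_ne_zero (mul_ne_zero ?_ ?_) ?_) ?_ <;> refine gr_ne hp hq ?_ <;> simp [hx, hy]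

lemma Gt_Dd (hp : ‖p‖ < 1) (hq : ‖q‖ < 1) (t : ℂ) {x y : ℂ} (hx : ‖x‖ = 1) (hy : ‖y‖ = 1) :
    Gt p q t x y * Dd p q x y = (Gr p q t x y / Gr p q 1 x y) * (Li 1 x y / Li t x y) := by
  rw [Dd_Gt hp hq hx hy, Gt_eq hp hq, Gt_eq hp hq, inv_div, div_mul_div_comm, div_mul_div_comm, mul_comm (Li t x y)]

lemma lin_bd {r : ℝ} (h0 : 0 ≤ r) (h1 : r < 1) {u : ℂ} (hu : ‖u‖ = 1) : ‖1 - u‖ ≤ 2 * ‖1 - r * u‖ := by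
  have a1 : ‖1 - u‖ ≤ ‖1 - r * u‖ + ‖r * u - u‖ := by
    have := norm_add_le (1 - r * u) (r * u - u)
    simpa using this
  have a2 : ‖r * u - u‖ = 1 - r := by
    have : (r : ℂ) * u - u = ((r - 1 : ℝ) : ℂ) * u := by push_cast; ring
    rw [this, norm_mul, hu, mul_one, Complex.norm_real, Real.norm_eq_abs, abs_of_neg (by linarith)]
    ring
  have a3 : 1 - r ≤ ‖1 - r * u‖ := by
    have := norm_sub_norm_le (1 : ℂ) (r * u)
    rw [norm_mul, hu, mul_one, Complex.norm_real, Real.norm_eq_abs, abs_of_nonneg h0, norm_one] at this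
    exact this
  linarith

lemma Li_bd {r : ℝ} (h0 : 0 ≤ r) (h1 : r < 1) {x y : ℂ} (hx : ‖x‖ = 1) (hy : ‖y‖ = 1) :
    ‖Li 1 x y / Li r x y‖ ≤ 16 := by
  rw [norm_div]
  refine div_le_of_le_mul₀ (norm_nonneg _) (by norm_num) ?_
  unfold Li
  simp only [norm_mul, one_mul]
  have b := fun u hu => lin_bd h0 h1 (u := u) hu
  have b1 := b (x * y) (by simp [hx, hy])
  have b2 := b (x * y⁻¹) (by simp [hx, hy])
  have b3 := b (x⁻¹ * y) (by simp [hx, hy])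
  have b4 := b (x⁻¹ * y⁻¹) (by simp [hx, hy])
  simp only [← mul_assoc] at b1 b2 b3 b4
  calc _ ≤ (2 * ‖1 - r * x * y‖) * (2 * ‖1 - r * x * y⁻¹‖) * (2 * ‖1 - r * x⁻¹ * y‖) * (2 * ‖1 - r * x⁻¹ * y⁻¹‖) := by
        gcongr
    _ = _ := by ring

lemma Li_ne {x y : Circle} (h1 : x ≠ y) (h2 : x ≠ y⁻¹) : Li 1 x y ≠ 0 := by
  have hx : (x : ℂ) ≠ 0 := Circle.coe_ne_zero x
  have hy : (y : ℂ) ≠ 0 := Circle.coe_ne_zero y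
  have h1 : (x : ℂ) ≠ y := fun h => h1 (Circle.coe_injective h)
  have h2 : (x : ℂ) ≠ (y : ℂ)⁻¹ := fun h => h2 (Circle.coe_injective (by rw [h, Circle.coe_inv]))
  unfold Li
  simp only [one_mul]
  refine mul_ne_zero (mul_ne_zero (mul_ne_zero ?_ ?_) ?_) ?_ <;> rw [sub_ne_zero] <;> intro h
  · exact h2 (eq_inv_of_mul_eq_one_left h.symm)
  · apply h1; field_simp at h; exact h.symm
  · apply h1; field_simp at h; exact h
  · apply h2; field_simp at h; field_simp; exact h

lemma cAt_Gt {X : Type*} [TopologicalSpace X] {a : X} (hp : ‖p‖ < 1) (hq : ‖q‖ < 1) {t f g : X → ℂ}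
    (ht : ContinuousAt t a) (ht0 : t a ≠ 0) (ht1 : ‖t a‖ < 1) (hf : ContinuousAt f a) (hf1 : ‖f a‖ = 1)
    (hg : ContinuousAt g a) (hg1 : ‖g a‖ = 1) : ContinuousAt (fun a => Gt p q (t a) (f a) (g a)) a := by
  unfold Gt
  have f0 := unit_ne hf1
  have g0 := unit_ne hg1
  have fi := hf.inv₀ f0
  have gi := hg.inv₀ g0
  have f0' := inv_ne_zero f0
  have g0' := inv_ne_zero g0
  have f1' := unit_inv hf1
  have g1' := unit_inv hg1
  exact (((cAt_gam hp hq ((ht.mul hf).mul hg) (mul_ne_zero (mul_ne_zero ht0 f0) g0) (norm_tz (norm_tz ht1 hf1) hg1)).mul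
    (cAt_gam hp hq ((ht.mul hf).mul gi) (mul_ne_zero (mul_ne_zero ht0 f0) g0') (norm_tz (norm_tz ht1 hf1) g1'))).mul
    (cAt_gam hp hq ((ht.mul fi).mul hg) (mul_ne_zero (mul_ne_zero ht0 f0') g0) (norm_tz (norm_tz ht1 f1') hg1))).mul
    (cAt_gam hp hq ((ht.mul fi).mul gi) (mul_ne_zero (mul_ne_zero ht0 f0') g0') (norm_tz (norm_tz ht1 f1') g1'))

lemma cAt_Gr {X : Type*} [TopologicalSpace X] {a : X} (hp : ‖p‖ < 1) (hq : ‖q‖ < 1) {t f g : X → ℂ}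
    (ht : ContinuousAt t a) (ht0 : ‖t a‖ = 1) (hf : ContinuousAt f a) (hf1 : ‖f a‖ = 1)
    (hg : ContinuousAt g a) (hg1 : ‖g a‖ = 1) : ContinuousAt (fun a => Gr p q (t a) (f a) (g a)) a := by
  unfold Gr
  have f0 := unit_ne hf1
  have g0 := unit_ne hg1
  have fi := hf.inv₀ f0
  have gi := hg.inv₀ g0
  have k : ∀ {h : X → ℂ}, ContinuousAt h a → ‖h a‖ = 1 → ContinuousAt (fun a => gr p q (h a)) a :=
    fun h1 h2 => cAt_gr hp hq h1 (unit_ne h2) h2.le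
  exact (((k ((ht.mul hf).mul hg) (by simp [*])).mul
    (k ((ht.mul hf).mul gi) (by simp [*]))).mul
    (k ((ht.mul fi).mul hg) (by simp [*]))).mul
    (k ((ht.mul fi).mul gi) (by simp [*]))

lemma cAt_wJ {X : Type*} [TopologicalSpace X] {a : X} {n b : ℕ} (hp : ‖p‖ < 1) (hq : ‖q‖ < 1) {t : X → ℂ}
    {g : X → Fin b → ℂ} {z : X → Fin n → ℂ}
    (ht : ContinuousAt t a) (ht0 : t a ≠ 0) (ht1 : ‖t a‖ < 1)
    (hg : ∀ m, ContinuousAt (fun x => g x m) a) (hg0 : ∀ m, g a m ≠ 0) (hg1 : ∀ m, ‖g a m‖ < 1)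
    (hz : ∀ i, ContinuousAt (fun x => z x i) a) (hz0 : ∀ i, ‖z a i‖ = 1) :
    ContinuousAt (fun x => wJ p q (t x) (g x) (z x)) a := by
  unfold wJ
  exact ContinuousAt.mul (tendsto_finset_prod _ fun ij _ => cAt_Gt hp hq ht ht0 ht1 (hz _) (hz0 _) (hz _) (hz0 _))
    (cAt_wI hp hq hg hg0 hg1 hz hz0)

lemma cont_wJ {n b : ℕ} (hp : ‖p‖ < 1) (hq : ‖q‖ < 1) {t : ℂ} (ht0 : t ≠ 0) (ht1 : ‖t‖ < 1)
    {g : Fin b → ℂ} (hg0 : ∀ m, g m ≠ 0) (hg1 : ∀ m, ‖g m‖ < 1) :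
    Continuous fun z : Tor n => wJ p q t g (fun i => (z i : ℂ)) := by
  rw [continuous_iff_continuousAt]
  intro z
  exact cAt_wJ hp hq continuousAt_const ht0 ht1 (fun m => continuousAt_const) hg0 hg1
    (fun i => (cont_coord i).continuousAt) (fun i => cnorm _)

lemma JJ_lim {n b : ℕ} (hp : ‖p‖ < 1) (hq : ‖q‖ < 1) {g : ℝ → Fin b → ℂ}
    (hg : ∀ m, ContinuousAt (fun r => g r m) 1) (hg0 : ∀ m, g 1 m ≠ 0) (hg1 : ∀ m, ‖g 1 m‖ < 1) :
    Tendsto (fun r : ℝ => JJ n p q ((r : ℂ) ^ 2) (g r)) (𝓝[<] 1) (𝓝 ((II 1 p q (g 1)) ^ n)) := by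
  obtain ⟨F, hFd⟩ : ∃ F : ℝ × Tor n → ℂ, F = fun y =>
    (∏ ij ∈ prs (Fin n), Gr p q ((y.1 : ℂ) ^ 2) (y.2 ij.1) (y.2 ij.2) / Gr p q 1 (y.2 ij.1) (y.2 ij.2)) *
      ∏ j, (W0 p q (y.2 j) * Gw p q (g y.1) (y.2 j)) := ⟨_, rfl⟩
  have hF : ∀ z, ContinuousAt F (1, z) := by
    intro z
    have cz : ∀ i, ContinuousAt (fun y : ℝ × Tor n => (y.2 i : ℂ)) (1, z) := fun i =>
      ((cont_coord i).comp continuous_snd).continuousAt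
    have cr : ContinuousAt (fun y : ℝ × Tor n => ((y.1 : ℝ) : ℂ) ^ 2) (1, z) :=
      ((Complex.continuous_ofReal.comp continuous_fst).pow 2).continuousAt
    rw [hFd]
    refine ContinuousAt.mul (tendsto_finset_prod _ fun ij _ => ?_) (tendsto_finset_prod _ fun j _ => ?_)
    · exact (cAt_Gr hp hq cr (by simp) (cz _) (cnorm _) (cz _) (cnorm _)).div
        (cAt_Gr hp hq continuousAt_const (by simp) (cz _) (cnorm _) (cz _) (cnorm _)) (Gr_ne hp hq (cnorm _) (cnorm _))
    · refine (cAt_W0 hp hq (cz _) (unit_ne (cnorm _))).mul (cAt_Gw hp hq (t := fun y : ℝ × Tor n => g y.1) (fun m => ?_) hg0 hg1 (cz j) (cnorm _))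
      exact ContinuousAt.comp (g := fun r => g r m) (f := fun y : ℝ × Tor n => y.1) (hg m) continuousAt_fst
  have hc1 : Continuous fun z => F (1, z) := by
    rw [continuous_iff_continuousAt]
    intro z
    exact ContinuousAt.comp (g := F) (f := fun z => ((1 : ℝ), z)) (hF z) (by fun_prop)
  have hF1 : ∀ z, F (1, z) = ∏ j, (W0 p q (z j) * Gw p q (g 1) (z j)) := by
    intro z
    rw [hFd]
    have : ∏ ij ∈ prs (Fin n), Gr p q (((1 : ℝ) : ℂ) ^ 2) (z ij.1) (z ij.2) / Gr p q 1 (z ij.1) (z ij.2) = 1 := by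
      refine Finset.prod_eq_one fun ij _ => ?_
      rw [Complex.ofReal_one, one_pow]
      exact div_self (Gr_ne hp hq (cnorm _) (cnorm _))
    beta_reduce
    rw [this, one_mul]
  have hw : ∀ (r : ℝ) (z : Tor n), wJ p q ((r : ℂ) ^ 2) (g r) (fun i => (z i : ℂ)) =
      F (r, z) * ∏ ij ∈ prs (Fin n), (Li 1 (z ij.1) (z ij.2) / Li ((r : ℂ) ^ 2) (z ij.1) (z ij.2)) := by
    intro r z
    rw [hFd]
    unfold wJ wI
    beta_reduce
    rw [← mul_assoc, ← Finset.prod_mul_distrib, mul_right_comm, ← Finset.prod_mul_distrib]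
    congr 1
    exact Finset.prod_congr rfl fun ij _ => Gt_Dd hp hq _ (cnorm _) (cnorm _)
  have e01 : ∀ᶠ τ : ℝ in 𝓝[<] 1, 0 < τ ∧ τ < 1 := by
    refine ((eventually_gt_nhds (zero_lt_one)).filter_mono nhdsWithin_le_nhds).and eventually_mem_nhdsWithin
  have eg0 : ∀ᶠ r : ℝ in 𝓝[<] 1, ∀ m, g r m ≠ 0 := by
    rw [eventually_all]
    exact fun m => ((hg m).eventually_ne (hg0 m)).filter_mono nhdsWithin_le_nhds
  have eg1 : ∀ᶠ r : ℝ in 𝓝[<] 1, ∀ m, ‖g r m‖ < 1 := by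
    rw [eventually_all]
    exact fun m => ((hg m).norm.eventually (gt_mem_nhds (hg1 m))).filter_mono nhdsWithin_le_nhds
  have es := (unif_small hF one_pos).filter_mono (nhdsWithin_le_nhds (s := Set.Iio (1 : ℝ)))
  have main := tendsto_integral_filter_of_dominated_convergence (μ := ν n) (l := 𝓝[<] (1 : ℝ))
    (F := fun r z => wJ p q ((r : ℂ) ^ 2) (g r) (fun i => ((z : Tor n) i : ℂ))) (f := fun z => F (1, z))
    (fun z => (‖F (1, z)‖ + 1) * ∏ ij ∈ prs (Fin n), (16 : ℝ)) ?_ ?_ ?_ ?_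
  · have : ∫ z, F (1, z) ∂(ν n) = II 1 p q (g 1) ^ n := by
      simp_rw [hF1]
      rw [integral_fintype_prod_eq_pow (fun x : Circle => W0 p q x * Gw p q (g 1) x), Fintype.card_fin, II_one hp hq hg0 hg1]
    rw [this] at main
    exact main
  · filter_upwards [e01, eg0, eg1] with r h1 h2 h3
    refine (cont_wJ hp hq ?_ ?_ h2 h3).aestronglyMeasurable
    · exact pow_ne_zero _ (Complex.ofReal_ne_zero.2 h1.1.ne')
    · rw [norm_pow, Complex.norm_real, Real.norm_eq_abs, abs_of_pos h1.1]
      exact pow_lt_one₀ h1.1.le h1.2 (by norm_num)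
  · filter_upwards [e01, es] with r h1 h2
    refine Eventually.of_forall fun z => ?_
    rw [hw, norm_mul]
    have b1 : ‖F (r, z)‖ ≤ ‖F (1, z)‖ + 1 := by
      have := norm_sub_norm_le (F (r, z)) (F (1, z))
      linarith [h2 z]
    refine mul_le_mul b1 ?_ (norm_nonneg _) (by positivity)
    rw [norm_prod]
    refine Finset.prod_le_prod (fun _ _ => norm_nonneg _) fun ij _ => ?_
    have := Li_bd (r := r ^ 2) (by positivity) (pow_lt_one₀ h1.1.le h1.2 (by norm_num)) (cnorm (z ij.1)) (cnorm (z ij.2))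
    rw [Complex.ofReal_pow] at this
    exact this
  · have : Continuous fun z => (‖F (1, z)‖ + 1) * ∏ ij ∈ prs (Fin n), (16 : ℝ) :=
      (hc1.norm.add continuous_const).mul continuous_const
    exact this.integrable_of_hasCompactSupport (HasCompactSupport.of_compactSpace _)
  · have n1 : ∀ᵐ z ∂(ν n), ∀ ij ∈ prs (Fin n), Li 1 (z ij.1) (z ij.2) ≠ 0 := by
      rw [eventually_all_finset]
      intro ij hij
      have hne : ij.1 ≠ ij.2 := (Finset.mem_filter.1 hij).2.ne
      filter_upwards [ν_null hne continuous_id, ν_null hne continuous_inv] with z h1 h2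
      exact Li_ne h1 h2
    filter_upwards [n1] with z hz
    simp_rw [hw]
    have l1 : Tendsto (fun r : ℝ => F (r, z)) (𝓝[<] 1) (𝓝 (F (1, z))) := by
      refine Tendsto.mono_left ?_ nhdsWithin_le_nhds
      exact ContinuousAt.comp (g := F) (f := fun r : ℝ => (r, z)) (hF z) (by fun_prop)
    have l2 : Tendsto (fun r : ℝ => ∏ ij ∈ prs (Fin n), (Li 1 (z ij.1) (z ij.2) / Li ((r : ℂ) ^ 2) (z ij.1) (z ij.2)))
        (𝓝[<] 1) (𝓝 (∏ ij ∈ prs (Fin n), 1)) := by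
      refine tendsto_finset_prod _ fun ij hij => ?_
      refine Tendsto.mono_left ?_ nhdsWithin_le_nhds
      have c : ContinuousAt (fun r : ℝ => Li ((r : ℂ) ^ 2) (z ij.1) (z ij.2)) 1 := by
        unfold Li
        exact Continuous.continuousAt (by fun_prop)
      have c' : Tendsto (fun r : ℝ => Li 1 (z ij.1) (z ij.2) / Li ((r : ℂ) ^ 2) (z ij.1) (z ij.2)) (𝓝 1)
          (𝓝 (Li 1 (z ij.1) (z ij.2) / Li (((1 : ℝ) : ℂ) ^ 2) (z ij.1) (z ij.2))) :=
        Tendsto.div tendsto_const_nhds c (by simpa using hz ij hij)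
      rw [Complex.ofReal_one, one_pow, div_self (hz ij hij)] at c'
      exact c'
    rw [Finset.prod_const_one] at l2
    simpa using l1.mul l2

end ESI

namespace ESI

open Filter Topology Complex MeasureTheory

variable {p q : ℂ}

lemma TT_cont {X : Type*} [TopologicalSpace X] {x : X} {τ : X → Fin 5 → ℂ} {u : X → ℂ}
    (h : ∀ m, ContinuousAt (fun x => τ x m) x) (hu : ContinuousAt u x) :
    ∀ m, ContinuousAt (fun x => TT (τ x) (u x) m) x := by
  intro m
  unfold TT
  refine Fin.addCases (m := 5) (n := 1) (fun i => ?_) (fun i => ?_) m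
  · simp only [Fin.append_left]; exact h i
  · simp only [Fin.append_right]; exact hu

lemma TT_diff {x : ℂ} {τ : ℂ → Fin 5 → ℂ} {u : ℂ → ℂ}
    (h : ∀ m, DifferentiableAt ℂ (fun x => τ x m) x) (hu : DifferentiableAt ℂ u x) :
    ∀ m, DifferentiableAt ℂ (fun x => TT (τ x) (u x) m) x := by
  intro m
  unfold TT
  refine Fin.addCases (m := 5) (n := 1) (fun i => ?_) (fun i => ?_) m
  · simp only [Fin.append_left]; exact h i
  · simp only [Fin.append_right]; exact hu

lemma cAt_KK {X κ : Type*} [TopologicalSpace X] [Fintype κ] [LinearOrder κ] (hp : ‖p‖ < 1) (hq : ‖q‖ < 1)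
    {t : X → κ → ℂ} {x : X} (ht : ∀ m, ContinuousAt (fun x => t x m) x) (ht0 : ∀ m, t x m ≠ 0)
    (ht1 : ∀ m, ‖t x m‖ < 1) : ContinuousAt (fun x => KK p q (t x)) x := by
  unfold KK
  refine tendsto_finsetProd _ fun m _ => ?_
  refine cAt_gam hp hq ((ht _).mul (ht _)) (mul_ne_zero (ht0 _) (ht0 _)) ?_
  rw [norm_mul]
  exact mul_lt_one_of_nonneg_of_lt_one_left (norm_nonneg _) (ht1 _) (ht1 _).le

lemma TT_const (ω : ℂ) : TT (fun _ => ω) ω = fun _ => ω := by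
  funext m
  unfold TT
  refine Fin.addCases (m := 5) (n := 1) (fun i => ?_) (fun i => ?_) m
  · rw [Fin.append_left]
  · rw [Fin.append_right]

lemma const_rec {j : ℕ} {C C' C1 : ℂ} (hp : ‖p‖ < 1) (hq : ‖q‖ < 1) (hp0 : p ≠ 0) (hq0 : q ≠ 0)
    (hC1 : ∀ t : Fin 6 → ℂ, Om p q t → II 1 p q t = C1 * KK p q t) (hC10 : C1 ≠ 0)
    (hC : ∀ t : Fin (2 * (j + 1) + 4) → ℂ, Om p q t → II (j + 1) p q t = C * KK p q t)
    (hC' : ∀ t : Fin (2 * (j + 2) + 4) → ℂ, Om p q t → II (j + 2) p q t = C' * KK p q t) :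
    C' = (j + 2 : ℕ) * C1 * C := by
  obtain ⟨ω, hω⟩ := IsAlgClosed.exists_pow_nat_eq (p * q) (n := 6) (by norm_num)
  have hpq0 : p * q ≠ 0 := mul_ne_zero hp0 hq0
  have hω0 : ω ≠ 0 := by rintro rfl; rw [zero_pow (by norm_num)] at hω; exact hpq0 hω.symm
  have hω1 : ‖ω‖ < 1 := by
    have := pq_lt hp hq
    rw [← hω, norm_pow] at this
    exact (pow_lt_one_iff_of_nonneg (norm_nonneg _) (by norm_num)).1 this
  have hO : Om p q (fun _ : Fin 6 => ω) := ⟨fun _ => hω0, fun _ => hω1, by simp [hω]⟩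
  have hK := hO.KK_ne hp hq (by simp)
  obtain ⟨K, hKd⟩ : ∃ K, K = KK p q (fun _ : Fin 6 => ω) := ⟨_, rfl⟩
  have hI := hC1 _ hO
  rw [← hKd] at hI hK
  -- the parameter families
  obtain ⟨u, hu⟩ : ∃ u : ℝ → ℂ, u = fun r : ℝ => ω / ((r : ℂ) ^ 2) ^ (2 * (j + 1)) := ⟨_, rfl⟩
  have u1 : u 1 = ω := by simp [hu]
  have cr : ContinuousAt (fun r : ℝ => (r : ℂ)) 1 := Complex.continuous_ofReal.continuousAt
  have cu : ContinuousAt u 1 := by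
    rw [hu]
    exact continuousAt_const.div ((cr.pow 2).pow _) (by simp)
  have l2 := JJ_lim (n := j + 2) hp hq (g := fun r => TT (fun _ => ω) (u r)) (TT_cont (fun m => continuousAt_const) cu)
    (TT_all (P := fun x => x ≠ 0) (fun _ => hω0) (by rw [u1]; exact hω0))
    (TT_all (P := fun x => ‖x‖ < 1) (fun _ => hω1) (by rw [u1]; exact hω1))
  have l1 := JJ_lim (n := j + 1) hp hq (g := fun r => TT (fun _ => (r : ℂ) * ω) (u r / r))
    (TT_cont (fun m => cr.mul continuousAt_const) (cu.div cr (by simp)))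
    (TT_all (P := fun x => x ≠ 0) (fun _ => by simpa using hω0) (by simpa [u1] using hω0))
    (TT_all (P := fun x => ‖x‖ < 1) (fun _ => by simpa using hω1) (by simpa [u1] using hω1))
  have lK : Tendsto (fun r : ℝ => KK p q (TT (fun _ => ω) (((r : ℂ) ^ 2) ^ (j + 1) * u r))) (𝓝[<] 1)
      (𝓝 (KK p q (TT (fun _ => ω) ((((1 : ℝ) : ℂ) ^ 2) ^ (j + 1) * u 1)))) := by
    refine Tendsto.mono_left ?_ nhdsWithin_le_nhds
    refine cAt_KK hp hq (t := fun r : ℝ => TT (fun _ => ω) (((r : ℂ) ^ 2) ^ (j + 1) * u r))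
      (TT_cont (fun m => continuousAt_const) (((cr.pow 2).pow _).mul cu))
      (TT_all (P := fun x => x ≠ 0) (fun _ => hω0) (by simpa [u1] using hω0))
      (TT_all (P := fun x => ‖x‖ < 1) (fun _ => hω1) (by simpa [u1] using hω1))
  have lg : ∀ m : ℕ, Tendsto (fun r : ℝ => gr p q (((r : ℂ) ^ 2) ^ m)) (𝓝[<] 1) (𝓝 (gr p q 1)) := by
    intro m
    refine Tendsto.mono_left ?_ nhdsWithin_le_nhds
    have := cAt_gr hp hq (f := fun r : ℝ => ((r : ℂ) ^ 2) ^ m) (x := 1) ((cr.pow 2).pow m) (by simp) (by simp)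
    unfold ContinuousAt at this
    simpa using this
  have lS : Tendsto (fun r : ℝ => ∑ i ∈ Finset.range (j + 2), ((r : ℂ) ^ 2) ^ i) (𝓝[<] 1) (𝓝 ((j + 2 : ℕ) : ℂ)) := by
    refine Tendsto.mono_left ?_ nhdsWithin_le_nhds
    have : Continuous fun r : ℝ => ∑ i ∈ Finset.range (j + 2), ((r : ℂ) ^ 2) ^ i := by fun_prop
    have := this.tendsto 1
    simpa using this
  simp only [u1, Complex.ofReal_one, one_pow, one_mul, div_one, TT_const, hI, ← hKd] at l1 l2 lK
  have g1 : gr p q 1 ≠ 0 := gr_ne hp hq (by simp)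
  have e01 : ∀ᶠ τ : ℝ in 𝓝[<] 1, 0 < τ ∧ τ < 1 := by
    refine ((eventually_gt_nhds (zero_lt_one)).filter_mono nhdsWithin_le_nhds).and eventually_mem_nhdsWithin
  have eu : ∀ᶠ r : ℝ in 𝓝[<] 1, ‖u r‖ < ‖(r : ℂ)‖ := by
    refine Eventually.filter_mono nhdsWithin_le_nhds ?_
    refine cu.norm.eventually_lt cr.norm ?_
    simpa [u1] using hω1
  have ev : ∀ᶠ r : ℝ in 𝓝[<] 1,
      C * gr p q (((r : ℂ) ^ 2) ^ 1) * (∑ i ∈ Finset.range (j + 2), ((r : ℂ) ^ 2) ^ i) *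
        JJ (j + 2) p q ((r : ℂ) ^ 2) (TT (fun _ => ω) (u r)) =
      C' * gr p q (((r : ℂ) ^ 2) ^ (j + 2)) * KK p q (TT (fun _ => ω) (((r : ℂ) ^ 2) ^ (j + 1) * u r)) *
        JJ (j + 1) p q ((r : ℂ) ^ 2) (TT (fun _ => (r : ℂ) * ω) (u r / r)) := by
    filter_upwards [e01, eu] with r h1 h2
    have hr0 : (r : ℂ) ≠ 0 := Complex.ofReal_ne_zero.2 h1.1.ne'
    have hr1 : ‖(r : ℂ)‖ < 1 := by rw [Complex.norm_real, Real.norm_eq_abs, abs_of_pos h1.1]; exact h1.2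
    have hu0 : u r ≠ 0 := by rw [hu]; exact div_ne_zero hω0 (pow_ne_zero _ (pow_ne_zero _ hr0))
    have h := recur hp hq hp0 hq0 hC hC' hr0 hr1 hu0 h2 (τ := fun _ => ω) (fun _ => hω0) (fun _ => hω1)
      (by rw [hu, ← hω]; simp only [Finset.prod_const, Finset.card_univ, Fintype.card_fin]; field_simp)
    have hs2 : ‖(r : ℂ) ^ 2‖ < 1 := by rw [norm_pow]; exact pow_lt_one₀ (norm_nonneg _) hr1 (by norm_num)
    have ne1 : ∀ x : ℂ, ‖x‖ < 1 → 1 - x ≠ 0 := by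
      intro x hx h
      rw [sub_eq_zero] at h
      rw [← h] at hx
      simp at hx
    have n1 := ne1 _ hs2
    have n2 := ne1 (((r : ℂ) ^ 2) ^ (j + 2)) (by rw [norm_pow]; exact pow_lt_one₀ (norm_nonneg _) hs2 (by omega))
    rw [gam_gr hp hq ((r : ℂ) ^ 2), gam_gr hp hq (((r : ℂ) ^ 2) ^ (j + 2))] at h
    have gs := mul_neg_geom_sum ((r : ℂ) ^ 2) (j + 2)
    rw [pow_one]
    generalize JJ (j + 2) p q ((r : ℂ) ^ 2) (TT (fun _ => ω) (u r)) = J2 at *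
    generalize JJ (j + 1) p q ((r : ℂ) ^ 2) (TT (fun _ => (r : ℂ) * ω) (u r / r)) = J1 at *
    generalize KK p q (TT (fun _ => ω) (((r : ℂ) ^ 2) ^ (j + 1) * u r)) = K2 at *
    generalize ∑ i ∈ Finset.range (j + 2), ((r : ℂ) ^ 2) ^ i = S at *
    generalize gr p q (((r : ℂ) ^ 2) ^ (j + 2)) = g2 at *
    generalize ((r : ℂ) ^ 2) ^ (j + 2) = x2 at *
    generalize gr p q ((r : ℂ) ^ 2) = g3 at *
    generalize (r : ℂ) ^ 2 = x at *
    field_simp at h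
    apply mul_left_cancel₀ n1
    linear_combination h + C * g3 * J2 * gs
  have t1 := ((tendsto_const_nhds (x := C)).mul (lg 1)).mul lS |>.mul l2
  have t2 := ((tendsto_const_nhds (x := C')).mul (lg (j + 2))).mul lK |>.mul l1
  have fin := tendsto_nhds_unique (t1.congr' ev) t2
  have hne : gr p q 1 * (C1 * K) ^ (j + 1) * K ≠ 0 := mul_ne_zero (mul_ne_zero g1 (pow_ne_zero _ (mul_ne_zero hC10 hK))) hK
  apply mul_left_cancel₀ hne
  linear_combination - fin

lemma const_fac (hp : ‖p‖ < 1) (hq : ‖q‖ < 1) (hp0 : p ≠ 0) (hq0 : q ≠ 0) (j : ℕ) :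
    ∀ t : Fin (2 * (j + 1) + 4) → ℂ, Om p q t →
      II (j + 1) p q t = (Nat.factorial (j + 1) : ℂ) * (2 * gr p q 1) ^ (j + 1) * KK p q t := by
  obtain ⟨c, hc⟩ := typeI 1 hp hq hp0 hq0
  have h1 := C1 hp hq hp0 hq0 hc
  subst h1
  have g1 : gr p q 1 ≠ 0 := gr_ne hp hq (by simp)
  induction j with
  | zero => simpa using hc
  | succ j ih =>
    obtain ⟨C, hC⟩ := typeI (j + 2) hp hq hp0 hq0
    have := const_rec hp hq hp0 hq0 hc (mul_ne_zero two_ne_zero g1) ih hC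
    subst this
    intro t ht
    rw [hC t ht, Nat.factorial_succ (j + 1)]
    push_cast
    ring

end ESI

namespace ESI

open Filter Topology Complex MeasureTheory

variable {p q : ℂ}

lemma dAt_Gt (hp : ‖p‖ < 1) (hq : ‖q‖ < 1) {t x y : ℂ}
    (ht0 : t ≠ 0) (ht1 : ‖t‖ < 1) (hx : ‖x‖ = 1) (hy : ‖y‖ = 1) :
    DifferentiableAt ℂ (fun t => Gt p q t x y) t := by
  unfold Gt
  have k : ∀ {a b : ℂ}, ‖a‖ = 1 → ‖b‖ = 1 → DifferentiableAt ℂ (fun t => ellGamma (t * a * b) p q) t := by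
    intro a b ha hb
    refine dAt_gam hp hq (f := fun t => t * a * b) (by fun_prop) ?_ ?_
    · exact mul_ne_zero (mul_ne_zero ht0 (unit_ne ha)) (unit_ne hb)
    · exact norm_tz (norm_tz ht1 ha) hb
  exact (((k hx hy).mul (k hx (unit_inv hy))).mul (k (unit_inv hx) hy)).mul (k (unit_inv hx) (unit_inv hy))

lemma JJ_diff {n b : ℕ} (hp : ‖p‖ < 1) (hq : ‖q‖ < 1) {g : ℂ → Fin b → ℂ} {U : Set ℂ} (hU : IsOpen U)
    (hU0 : ∀ x ∈ U, x ≠ 0) (hU1 : ∀ x ∈ U, ‖x‖ < 1)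
    (ht : ∀ x ∈ U, ∀ m, DifferentiableAt ℂ (fun x => g x m) x) (ht0 : ∀ x ∈ U, ∀ m, g x m ≠ 0)
    (ht1 : ∀ x ∈ U, ∀ m, ‖g x m‖ < 1) : DifferentiableOn ℂ (fun x => JJ n p q x (g x)) U := by
  unfold JJ
  refine diff_integral hU (F := fun x z => wJ p q x (g x) (fun i => ((z : Tor n) i : ℂ))) ?_ ?_
  · intro x hx z
    refine cAt_wJ (X := ℂ × Tor n) hp hq (t := fun y => y.1) (g := fun y => g y.1) (z := fun y i => (y.2 i : ℂ))
      continuousAt_fst (hU0 x hx) (hU1 x hx) (fun m => ?_) (ht0 x hx) (ht1 x hx) (fun i => ?_) (fun i => cnorm _)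
    · exact ContinuousAt.comp (g := fun x => g x m) (f := fun y : ℂ × Tor n => y.1)
        (ht x hx m).continuousAt continuousAt_fst
    · exact ((cont_coord i).comp continuous_snd).continuousAt
  · intro x hx z
    unfold wJ
    refine DifferentiableAt.mul (DifferentiableAt.fun_finset_prod fun m _ => ?_)
      (dAt_wI hp hq (ht x hx) (ht0 x hx) (ht1 x hx) (fun i => cnorm _))
    exact dAt_Gt hp hq (hU0 x hx) (hU1 x hx) (cnorm _) (cnorm _)

/-- pair product with multiplier -/
noncomputable def RK {n : ℕ} (p q x : ℂ) (τ : Fin n → ℂ) : ℂ :=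
  ∏ ij ∈ prs (Fin n), ellGamma (x * τ ij.1 * τ ij.2) p q

/-- cross product -/
noncomputable def BB (p q : ℂ) (τ : Fin 5 → ℂ) (y : ℂ) : ℂ := ∏ m, ellGamma (τ m * y) p q

lemma RK_TT (x : ℂ) (τ : Fin 5 → ℂ) (u : ℂ) : RK p q x (TT τ u) = RK p q x τ * BB p q τ (x * u) := by
  unfold RK BB
  rw [prs_prod fun i j => ellGamma (x * TT τ u i * TT τ u j) p q, prs_prod fun i j => ellGamma (x * τ i * τ j) p q]
  have e : ∀ (f : Fin 6 → ℂ), ∏ i, f i = (∏ i : Fin 5, f (Fin.castAdd 1 i)) * f (Fin.natAdd 5 (0 : Fin 1)) := by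
    intro f
    exact Fin.prod_univ_castSucc f
  have e1 : ∀ i : Fin 5, Fin.castAdd 1 i < (Fin.natAdd 5 (0 : Fin 1)) := by
    intro i; rw [Fin.lt_def]; simp
  have e2 : ∀ i : Fin 5, ¬ (Fin.natAdd 5 (0 : Fin 1)) < Fin.castAdd 1 i := fun i => (e1 i).not_gt
  have e3 : ∀ i j : Fin 5, (Fin.castAdd 1 i < Fin.castAdd 1 j) ↔ i < j := by
    intro i j; rw [Fin.lt_def, Fin.lt_def]; simp
  have a1 : ∀ i : Fin 5, TT τ u (Fin.castAdd 1 i) = τ i := fun i => Fin.append_left _ _ i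
  have a2 : TT τ u (Fin.natAdd 5 (0 : Fin 1)) = u := Fin.append_right _ _ 0
  simp only [e, a1, a2, e1, e2, e3, if_true, if_false, lt_irrefl, Finset.prod_const_one, mul_one,
    Finset.prod_mul_distrib]
  congr 1
  refine Finset.prod_congr rfl fun i _ => ?_
  congr 1
  ring

lemma KK_RK {n : ℕ} (τ : Fin n → ℂ) : KK p q τ = RK p q 1 τ := by
  unfold KK RK
  simp only [one_mul]

lemma RK_smul {n : ℕ} (s x : ℂ) (τ : Fin n → ℂ) : RK p q x (fun m => s * τ m) = RK p q (x * s ^ 2) τ := by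
  unfold RK
  refine Finset.prod_congr rfl fun ij _ => ?_
  congr 1
  ring

lemma BB_smul {s : ℂ} (hs : s ≠ 0) (τ : Fin 5 → ℂ) (x u : ℂ) :
    BB p q (fun m => s * τ m) (x * (u / s)) = BB p q τ (x * u) := by
  unfold BB
  refine Finset.prod_congr rfl fun ij _ => ?_
  congr 1
  field_simp

/-- right-hand side -/
noncomputable def Rhs (k : ℕ) (p q t : ℂ) (τ : Fin 6 → ℂ) : ℂ :=
  (Nat.factorial (k + 1) : ℂ) * (2 * gr p q 1) ^ (k + 1) * (∏ i ∈ Finset.range k, ellGamma (t ^ (i + 2)) p q) *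
    ∏ i ∈ Finset.range (k + 1), RK p q (t ^ i) τ

lemma step_near {j : ℕ} (hp : ‖p‖ < 1) (hq : ‖q‖ < 1) (hp0 : p ≠ 0) (hq0 : q ≠ 0)
    (ih : ∀ t : ℂ, t ≠ 0 → ‖t‖ < 1 → ∀ τ : Fin 6 → ℂ, (∀ m, τ m ≠ 0) → (∀ m, ‖τ m‖ < 1) →
      t ^ (2 * j) * ∏ m, τ m = p * q → ellGamma t p q ^ j * JJ (j + 1) p q t τ = Rhs j p q t τ)
    {s u : ℂ} (hs0 : s ≠ 0) (hs1 : ‖s‖ < 1) (hu0 : u ≠ 0) (hu1 : ‖u‖ < ‖s‖)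
    {τ : Fin 5 → ℂ} (hτ0 : ∀ i, τ i ≠ 0) (hτ1 : ∀ i, ‖τ i‖ < 1)
    (hb : (s ^ 2) ^ (2 * (j + 1)) * ((∏ i, τ i) * u) = p * q) :
    ellGamma (s ^ 2) p q ^ (j + 1) * JJ (j + 2) p q (s ^ 2) (TT τ u) = Rhs (j + 1) p q (s ^ 2) (TT τ u) := by
  have h := recur hp hq hp0 hq0 (const_fac hp hq hp0 hq0 j) (const_fac hp hq hp0 hq0 (j + 1)) hs0 hs1 hu0 hu1 hτ0 hτ1 hb
  have hs2 : ‖s ^ 2‖ < 1 := by rw [norm_pow]; exact pow_lt_one₀ (norm_nonneg _) hs1 (by norm_num)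
  have hs20 := pow_ne_zero 2 hs0
  have i := ih (s ^ 2) hs20 hs2 (TT (fun m => s * τ m) (u / s))
    (TT_all (P := fun x => x ≠ 0) (fun i => mul_ne_zero hs0 (hτ0 i)) (div_ne_zero hu0 hs0))
    (TT_all (P := fun x => ‖x‖ < 1) (fun i => by
      rw [norm_mul]; exact mul_lt_one_of_nonneg_of_lt_one_left (norm_nonneg _) hs1 (hτ1 i).le)
      (by rw [norm_div]; exact (div_lt_one (norm_pos_iff.2 hs0)).2 hu1))
    (by
      rw [TT_prod, Finset.prod_mul_distrib, ← hb]
      simp only [Finset.prod_const, Finset.card_univ, Fintype.card_fin]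
      field_simp
      ring)
  have g1 : gr p q 1 ≠ 0 := gr_ne hp hq (by simp)
  have hc0 : (Nat.factorial (j + 1) : ℂ) * (2 * gr p q 1) ^ (j + 1) ≠ 0 :=
    mul_ne_zero (Nat.cast_ne_zero.2 (Nat.factorial_ne_zero _)) (pow_ne_zero _ (mul_ne_zero two_ne_zero g1))
  rw [Rhs] at i ⊢
  have eR : KK p q (TT τ ((s ^ 2) ^ (j + 1) * u)) *
      ∏ i ∈ Finset.range (j + 1), RK p q ((s ^ 2) ^ i) (TT (fun m => s * τ m) (u / s)) =
      ∏ i ∈ Finset.range (j + 2), RK p q ((s ^ 2) ^ i) (TT τ u) := by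
    simp only [KK_RK, RK_TT, RK_smul, BB_smul hs0, Finset.prod_mul_distrib, ← pow_succ, one_mul]
    rw [Finset.prod_range_succ' (fun i => RK p q ((s ^ 2) ^ i) τ) (j + 1),
      Finset.prod_range_succ (fun i => BB p q τ ((s ^ 2) ^ i * u)) (j + 1), pow_zero]
    ring
  have eG : ∏ i ∈ Finset.range (j + 1), ellGamma ((s ^ 2) ^ (i + 2)) p q =
      (∏ i ∈ Finset.range j, ellGamma ((s ^ 2) ^ (i + 2)) p q) * ellGamma ((s ^ 2) ^ (j + 2)) p q :=
    Finset.prod_range_succ _ _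
  change _ = (Nat.factorial (j + 2) : ℂ) * (2 * gr p q 1) ^ (j + 2) * (∏ i ∈ Finset.range (j + 1), ellGamma ((s ^ 2) ^ (i + 2)) p q) *
    ∏ i ∈ Finset.range (j + 2), RK p q ((s ^ 2) ^ i) (TT τ u)
  rw [← eR, eG]
  change _ * _ = (Nat.factorial (j + 2) : ℂ) * (2 * gr p q 1) ^ (j + 2) * _ * _ * _ at h
  generalize (Nat.factorial (j + 1) : ℂ) * (2 * gr p q 1) ^ (j + 1) = c at *
  generalize (Nat.factorial (j + 2) : ℂ) * (2 * gr p q 1) ^ (j + 2) = c' at *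
  generalize KK p q (TT τ ((s ^ 2) ^ (j + 1) * u)) = K at *
  generalize JJ (j + 2) p q (s ^ 2) (TT τ u) = J2 at *
  generalize JJ (j + 1) p q (s ^ 2) (TT (fun m => s * τ m) (u / s)) = J1 at *
  apply mul_left_cancel₀ hc0
  linear_combination ellGamma (s ^ 2) p q ^ j * h + c' * ellGamma ((s ^ 2) ^ (j + 2)) p q * K * i

lemma dAt_Rhs {k : ℕ} (hp : ‖p‖ < 1) (hq : ‖q‖ < 1) {g : ℂ → Fin 6 → ℂ} {t : ℂ} (ht0 : t ≠ 0) (ht1 : ‖t‖ < 1)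
    (hg : ∀ m, DifferentiableAt ℂ (fun x => g x m) t) (hg0 : ∀ m, g t m ≠ 0) (hg1 : ∀ m, ‖g t m‖ < 1) :
    DifferentiableAt ℂ (fun t => Rhs k p q t (g t)) t := by
  unfold Rhs RK
  refine DifferentiableAt.mul (DifferentiableAt.const_mul (DifferentiableAt.fun_finset_prod fun i _ => ?_) _)
    (DifferentiableAt.fun_finset_prod fun i _ => DifferentiableAt.fun_finset_prod fun m _ => ?_)
  · refine dAt_gam hp hq (f := fun t => t ^ (i + 2)) (by fun_prop) (pow_ne_zero _ ht0) ?_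
    rw [norm_pow]
    exact pow_lt_one₀ (norm_nonneg _) ht1 (by omega)
  · refine dAt_gam hp hq (f := fun t => t ^ i * g t m.1 * g t m.2) ?_ (mul_ne_zero (mul_ne_zero (pow_ne_zero _ ht0) (hg0 _)) (hg0 _)) ?_
    · exact (DifferentiableAt.mul (by fun_prop) (hg _)).mul (hg _)
    · have : ‖t ^ i‖ ≤ 1 := by rw [norm_pow]; exact pow_le_one₀ (norm_nonneg _) ht1.le
      rw [norm_mul, norm_mul, mul_assoc]
      refine mul_lt_one_of_nonneg_of_lt_one_right this (by positivity) ?_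
      exact mul_lt_one_of_nonneg_of_lt_one_left (norm_nonneg _) (hg1 _) (hg1 _).le

lemma JJ_one {t : ℂ} {τ : Fin 6 → ℂ} : JJ 1 p q t τ = II 1 p q τ := by
  unfold JJ II wJ
  have : prs (Fin 1) = ∅ := by
    ext ij
    simp [prs]
  simp [this]

lemma TT_surj (τ : Fin 6 → ℂ) : ∃ τ' u, τ = TT τ' u := by
  refine ⟨fun i => τ (Fin.castAdd 1 i), τ (Fin.natAdd 5 (0 : Fin 1)), ?_⟩
  funext m
  refine Fin.addCases (m := 5) (n := 1) (fun i => ?_) (fun i => ?_) m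
  · exact (Fin.append_left (fun i : Fin 5 => τ (Fin.castAdd 1 i)) (fun _ : Fin 1 => τ (Fin.natAdd 5 (0 : Fin 1))) i).symm
  · rw [Subsingleton.elim i 0]
    exact (Fin.append_right (fun i : Fin 5 => τ (Fin.castAdd 1 i)) (fun _ : Fin 1 => τ (Fin.natAdd 5 (0 : Fin 1))) 0).symm

theorem typeII (hp : ‖p‖ < 1) (hq : ‖q‖ < 1) (hp0 : p ≠ 0) (hq0 : q ≠ 0) (k : ℕ) :
    ∀ t : ℂ, t ≠ 0 → ‖t‖ < 1 → ∀ τ : Fin 6 → ℂ, (∀ m, τ m ≠ 0) → (∀ m, ‖τ m‖ < 1) →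
      t ^ (2 * k) * ∏ m, τ m = p * q → ellGamma t p q ^ k * JJ (k + 1) p q t τ = Rhs k p q t τ := by
  induction k with
  | zero =>
    intro t ht0 ht1 τ h0 h1 hb
    have := const_fac hp hq hp0 hq0 0 τ ⟨h0, h1, by simpa using hb⟩
    rw [JJ_one, this, Rhs]
    simp [KK_RK]
  | succ j ih =>
    intro t ht0 ht1 τ h0 h1 hb
    obtain ⟨τ, u, rfl⟩ := TT_surj τ
    have hτ0 : ∀ i, τ i ≠ 0 := fun i => by
      have := h0 (Fin.castAdd 1 i)
      rwa [show TT τ u (Fin.castAdd 1 i) = τ i from Fin.append_left _ _ i] at this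
    have hτ1 : ∀ i, ‖τ i‖ < 1 := fun i => by
      have := h1 (Fin.castAdd 1 i)
      rwa [show TT τ u (Fin.castAdd 1 i) = τ i from Fin.append_left _ _ i] at this
    have hu0 : u ≠ 0 := by
      have := h0 (Fin.natAdd 5 (0 : Fin 1))
      rwa [show TT τ u (Fin.natAdd 5 (0 : Fin 1)) = u from Fin.append_right _ _ 0] at this
    have hu1 : ‖u‖ < 1 := by
      have := h1 (Fin.natAdd 5 (0 : Fin 1))
      rwa [show TT τ u (Fin.natAdd 5 (0 : Fin 1)) = u from Fin.append_right _ _ 0] at this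
    rw [TT_prod] at hb
    have hP0 : ∏ i, τ i ≠ 0 := Finset.prod_ne_zero_iff.2 fun i _ => hτ0 i
    obtain ⟨P, hP⟩ : ∃ P, P = ∏ i, τ i := ⟨_, rfl⟩
    rw [← hP] at hb hP0
    have hpq0 : p * q ≠ 0 := mul_ne_zero hp0 hq0
    obtain ⟨ξ, hξ⟩ := IsAlgClosed.exists_pow_nat_eq (p * q / P) (n := 2 * (j + 1)) (by omega)
    have hξ0 : ξ ≠ 0 := by
      rintro rfl
      rw [zero_pow (by omega)] at hξ
      exact div_ne_zero hpq0 hP0 hξ.symm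
    have hm0 : 2 * (j + 1) ≠ 0 := by omega
    obtain ⟨U, hU⟩ : ∃ U : ℂ → ℂ, U = fun x => (ξ / x) ^ (2 * (j + 1)) := ⟨_, rfl⟩
    have hUb : ∀ x, x ≠ 0 → x ^ (2 * (j + 1)) * (P * U x) = p * q := by
      intro x hx
      rw [hU]
      beta_reduce
      rw [div_pow, hξ]
      field_simp
    have hUu : U t = u := by
      have h := (hUb t ht0).trans hb.symm
      exact mul_left_cancel₀ hP0 (mul_left_cancel₀ (pow_ne_zero _ ht0) h)
    have hξt : ‖ξ‖ < ‖t‖ := by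
      rw [← hUu, hU] at hu1
      beta_reduce at hu1
      rw [norm_pow, pow_lt_one_iff_of_nonneg (norm_nonneg _) hm0, norm_div, div_lt_one (norm_pos_iff.2 ht0)] at hu1
      exact hu1
    have hξp : 0 < ‖ξ‖ := norm_pos_iff.2 hξ0
    have hξ1 : ‖ξ‖ < 1 := hξt.trans ht1
    have A0 : ∀ x ∈ Ann ‖ξ‖, x ≠ 0 := fun x hx => norm_pos_iff.1 (hξp.trans hx.1)
    have U0 : ∀ x ∈ Ann ‖ξ‖, U x ≠ 0 := fun x hx => by
      rw [hU]; exact pow_ne_zero _ (div_ne_zero hξ0 (A0 x hx))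
    have U1 : ∀ x ∈ Ann ‖ξ‖, ‖U x‖ < 1 := fun x hx => by
      rw [hU]
      beta_reduce
      rw [norm_pow, pow_lt_one_iff_of_nonneg (norm_nonneg _) hm0, norm_div, div_lt_one (norm_pos_iff.2 (A0 x hx))]
      exact hx.1
    have Ud : ∀ x ∈ Ann ‖ξ‖, DifferentiableAt ℂ U x := fun x hx => by
      rw [hU]
      exact ((differentiableAt_const ξ).div differentiableAt_id (A0 x hx)).pow _
    have g0 : ∀ x ∈ Ann ‖ξ‖, ∀ m, TT τ (U x) m ≠ 0 := fun x hx => TT_all (P := fun x => x ≠ 0) hτ0 (U0 x hx)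
    have g1 : ∀ x ∈ Ann ‖ξ‖, ∀ m, ‖TT τ (U x) m‖ < 1 := fun x hx => TT_all (P := fun x => ‖x‖ < 1) hτ1 (U1 x hx)
    have gd : ∀ x ∈ Ann ‖ξ‖, ∀ m, DifferentiableAt ℂ (fun x => TT τ (U x) m) x := fun x hx =>
      TT_diff (τ := fun _ => τ) (fun m => differentiableAt_const _) (Ud x hx)
    have sq : ‖ξ‖ ≤ √‖ξ‖ := by
      refine Real.le_sqrt_of_sq_le ?_
      nlinarith
    have key := ident_ann (ρ := ‖ξ‖) (ρ' := √‖ξ‖)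
      (f := fun x => ellGamma x p q ^ (j + 1) * JJ (j + 2) p q x (TT τ (U x)) - Rhs (j + 1) p q x (TT τ (U x)))
      hξp (by rw [Real.sqrt_lt' one_pos]; simpa using hξ1) sq
      (by
        refine DifferentiableOn.sub (DifferentiableOn.mul ?_
          (JJ_diff hp hq (Ann_open _) A0 (fun x hx => hx.2) gd g0 g1)) ?_
        · intro x hx
          exact ((dAt_gam hp hq differentiableAt_id (A0 x hx) hx.2).pow _).differentiableWithinAt
        · intro x hx
          exact (dAt_Rhs hp hq (A0 x hx) hx.2 (gd x hx) (g0 x hx) (g1 x hx)).differentiableWithinAt)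
      (by
        intro x hx
        have hx' : x ∈ Ann ‖ξ‖ := ⟨sq.trans_lt hx.1, hx.2⟩
        have hx0 := A0 x hx'
        obtain ⟨s, hs⟩ := IsAlgClosed.exists_pow_nat_eq x (n := 2) (by norm_num)
        have hs0 : s ≠ 0 := by rintro rfl; apply hx0; rw [← hs]; simp
        have hn : ‖s‖ ^ 2 = ‖x‖ := by rw [← hs, norm_pow]
        have hs1 : ‖s‖ < 1 := by
          rw [← pow_lt_one_iff_of_nonneg (norm_nonneg s) two_ne_zero, hn]; exact hx.2
        have hxp : 0 < ‖x‖ := norm_pos_iff.2 hx0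
        have hxx : ‖ξ‖ < ‖x‖ ^ 2 := (Real.sqrt_lt' hxp).1 hx.1
        have hus : ‖U x‖ < ‖s‖ := by
          rw [hU]
          beta_reduce
          rw [norm_pow, norm_div]
          have d0 : 0 ≤ ‖ξ‖ / ‖x‖ := by positivity
          have d1 : ‖ξ‖ / ‖x‖ < ‖x‖ := by rw [div_lt_iff₀ hxp]; nlinarith
          have d2 : (‖ξ‖ / ‖x‖) ^ (2 * (j + 1)) ≤ ‖ξ‖ / ‖x‖ :=
            pow_le_of_le_one d0 (d1.le.trans hx.2.le) hm0
          have : ‖x‖ ≤ ‖s‖ := by rw [← hn]; nlinarith [norm_nonneg s]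
          linarith
        have h := step_near hp hq hp0 hq0 ih hs0 hs1 (U0 x hx') hus hτ0 hτ1
          (by rw [hs, ← hP]; exact hUb x hx0)
        rw [hs] at h
        rw [h, sub_self])
    have := key t ⟨hξt, ht1⟩
    rw [hUu, sub_eq_zero] at this
    exact this

end ESI

namespace ESI

open Filter Topology Complex MeasureTheory

lemma frozen_eq {p q : ℂ} (hp : ‖p‖ < 1) (hq : ‖q‖ < 1) (t₀ : ℂ) (t : Fin 6 → ℂ) {n : ℕ} (z : Tor n) :
    (∏ ij ∈ Finset.univ.filter (fun ij : Fin n × Fin n => ij.1 < ij.2),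
            ellGamma (t₀ * z ij.1 * z ij.2) p q * ellGamma (t₀ * z ij.1 * (z ij.2 : ℂ)⁻¹) p q *
              ellGamma (t₀ * (z ij.1 : ℂ)⁻¹ * z ij.2) p q *
              ellGamma (t₀ * (z ij.1 : ℂ)⁻¹ * (z ij.2 : ℂ)⁻¹) p q /
            (ellGamma ((z ij.1 : ℂ) * z ij.2) p q * ellGamma ((z ij.1 : ℂ) * (z ij.2 : ℂ)⁻¹) p q *
              ellGamma ((z ij.1 : ℂ)⁻¹ * z ij.2) p q * ellGamma ((z ij.1 : ℂ)⁻¹ * (z ij.2 : ℂ)⁻¹) p q)) *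
        ∏ j : Fin n,
          (∏ m, ellGamma (t m * z j) p q * ellGamma (t m * (z j : ℂ)⁻¹) p q) /
            (ellGamma ((z j : ℂ) ^ 2) p q * ellGamma ((z j : ℂ)⁻¹ ^ 2) p q) =
    wJ p q t₀ t (fun i => (z i : ℂ)) := by
  have hz : ∀ i, ‖(z i : ℂ)‖ = 1 := fun i => Circle.norm_coe (z i)
  unfold wJ wI
  rw [← mul_assoc, ← Finset.prod_mul_distrib]
  congr 1
  · refine Finset.prod_congr rfl fun ij _ => ?_
    rw [Dd_Gt hp hq (hz _) (hz _), div_eq_mul_inv]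
    simp only [Gt, one_mul]
  · refine Finset.prod_congr rfl fun j _ => ?_
    have h := gam_inv hp hq (z := (z j : ℂ) ^ 2) (by rw [norm_pow, hz, one_pow])
    rw [div_eq_mul_inv, inv_pow, h, mul_comm]
    rfl

end ESI

/-- The elliptic Selberg integral (type II `BC_N` elliptic beta integral) of
van Diejen and Spiridonov. -/
theorem elliptic_selberg_integral (N : ℕ) (hN : 1 ≤ N) (p q : ℂ)
    (hp0 : 0 < ‖p‖) (hp1 : ‖p‖ < 1)
    (hq0 : 0 < ‖q‖) (hq1 : ‖q‖ < 1)
    (t₀ : ℂ) (t : Fin 6 → ℂ)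
    (ht₀0 : 0 < ‖t₀‖) (ht₀1 : ‖t₀‖ < 1)
    (ht0 : ∀ m, 0 < ‖t m‖) (ht1 : ∀ m, ‖t m‖ < 1)
    (hbal : t₀ ^ (2 * N - 2) * ∏ m, t m = p * q) :
    pochInf p p ^ N * pochInf q q ^ N / (2 ^ N * (N.factorial : ℂ)) *
      ellGamma t₀ p q ^ (N - 1) *
      torusInt N (fun z =>
        (∏ ij ∈ Finset.univ.filter (fun ij : Fin N × Fin N => ij.1 < ij.2),
            ellGamma (t₀ * z ij.1 * z ij.2) p q * ellGamma (t₀ * z ij.1 * (z ij.2)⁻¹) p q *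
              ellGamma (t₀ * (z ij.1)⁻¹ * z ij.2) p q *
              ellGamma (t₀ * (z ij.1)⁻¹ * (z ij.2)⁻¹) p q /
            (ellGamma (z ij.1 * z ij.2) p q * ellGamma (z ij.1 * (z ij.2)⁻¹) p q *
              ellGamma ((z ij.1)⁻¹ * z ij.2) p q * ellGamma ((z ij.1)⁻¹ * (z ij.2)⁻¹) p q)) *
        ∏ j : Fin N,
          (∏ m, ellGamma (t m * z j) p q * ellGamma (t m * (z j)⁻¹) p q) /
            (ellGamma (z j ^ 2) p q * ellGamma ((z j)⁻¹ ^ 2) p q)) =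
    (∏ j ∈ Finset.Icc 2 N, ellGamma (t₀ ^ j) p q) *
      ∏ j ∈ Finset.Icc 1 N,
        ∏ ms ∈ Finset.univ.filter (fun ms : Fin 6 × Fin 6 => ms.1 < ms.2),
          ellGamma (t₀ ^ (j - 1) * t ms.1 * t ms.2) p q := by
  obtain ⟨k, rfl⟩ : ∃ k, N = k + 1 := ⟨N - 1, by omega⟩
  have hp : p ≠ 0 := norm_pos_iff.1 hp0
  have hq : q ≠ 0 := norm_pos_iff.1 hq0
  have htz : t₀ ≠ 0 := norm_pos_iff.1 ht₀0
  have htm : ∀ m, t m ≠ 0 := fun m => norm_pos_iff.1 (ht0 m)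
  have hb : t₀ ^ (2 * k) * ∏ m, t m = p * q := by
    rw [← hbal]
    congr 2
  have key := ESI.typeII hp1 hq1 hp hq k t₀ htz ht₀1 t htm ht1 hb
  have hw := fun z => ESI.frozen_eq (p := p) (q := q) hp1 hq1 t₀ t (n := k + 1) (z := z)
  have hc := ESI.cont_wJ (n := k + 1) hp1 hq1 htz ht₀1 htm ht1
  rw [ESI.torusInt_eq]
  swap
  · simp only [hw]
    exact hc
  simp only [hw]
  change _ * _ * ESI.JJ (k + 1) p q t₀ t = _
  rw [Nat.add_sub_cancel, mul_assoc, key, ESI.Rhs, ESI.gr_one hp1 hq1]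
  have e1 : ∏ j ∈ Finset.Icc 2 (k + 1), ellGamma (t₀ ^ j) p q =
      ∏ i ∈ Finset.range k, ellGamma (t₀ ^ (i + 2)) p q := by
    rw [← Finset.Ico_add_one_right_eq_Icc, Finset.prod_Ico_eq_prod_range]
    refine Finset.prod_congr (by congr 1) fun i _ => ?_
    rw [add_comm 2 i]
  have e2 : ∏ j ∈ Finset.Icc 1 (k + 1),
        ∏ ms ∈ Finset.univ.filter (fun ms : Fin 6 × Fin 6 => ms.1 < ms.2),
          ellGamma (t₀ ^ (j - 1) * t ms.1 * t ms.2) p q =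
      ∏ i ∈ Finset.range (k + 1), ESI.RK p q (t₀ ^ i) t := by
    rw [← Finset.Ico_add_one_right_eq_Icc, Finset.prod_Ico_eq_prod_range]
    refine Finset.prod_congr (by congr 1) fun i _ => ?_
    rw [Nat.add_sub_cancel_left]
    rfl
  rw [e1, e2]
  have c1 := ESI.poch_ne_of_lt hp1 hp1
  have c2 := ESI.poch_ne_of_lt hq1 hq1
  have c3 : ((k + 1).factorial : ℂ) ≠ 0 := Nat.cast_ne_zero.2 (Nat.factorial_ne_zero _)
  rw [mul_pow 2, inv_pow, mul_pow (pochInf p p)]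
  have c4 := pow_ne_zero (k + 1) c1
  have c5 := pow_ne_zero (k + 1) c2
  have c6 : (2 : ℂ) ^ (k + 1) ≠ 0 := pow_ne_zero _ two_ne_zero
  generalize pochInf p p ^ (k + 1) = a at *
  generalize pochInf q q ^ (k + 1) = b at *
  generalize (2 : ℂ) ^ (k + 1) = c at *
  generalize ((k + 1).factorial : ℂ) = d at *
  generalize ∏ i ∈ Finset.range k, ellGamma (t₀ ^ (i + 2)) p q = A
  generalize ∏ i ∈ Finset.range (k + 1), ESI.RK p q (t₀ ^ i) t = B
  field_simp
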